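/- For every ε > 0 there exist constants c_ε ≥ 1 and C_ε ≥ 1, depending only on ε, with the following property: for every R ≥ 1 and every convex function γ : [0,1] → ℝ satisfying 0 ≤ γ'_R(0) ≤ γ'_L(1) ≤ 1, there exists an ideal partition 𝒥 of [0,1] with parameters ε, R and constant c_ε (depending on ε and R) such that every Schwartz function f : ℝ² → ℂ whose Fourier transform is supported in N_{R^{−1}}(Γ) satisfies ‖f‖_{L⁶(ℝ²)} ≤ C_ε · R^{ε} · (Σ_{J ∈ 𝒥} ‖f_J‖²_{L⁶(ℝ²)})^{1/2}. -/

import Mathlib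

open MeasureTheory Set
open scoped FourierTransform ENNReal

noncomputable section

/-- The plane `ℝ²` with the Euclidean norm. -/
abbrev E2 := EuclideanSpace ℝ (Fin 2)

/-- `γR` and `γL` are the one-sided derivatives of `γ` on the interval `[a,b]`:
the right derivative is defined on `[a,b)` and the left derivative on `(a,b]`. -/
def HasOneSidedDerivs (γ γR γL : ℝ → ℝ) (a b : ℝ) : Prop :=
  (∀ x ∈ Set.Ico a b, HasDerivWithinAt γ (γR x) (Set.Ioc x b) x) ∧
  (∀ x ∈ Set.Ioc a b, HasDerivWithinAt γ (γL x) (Set.Ico a x) x)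

/-- The curve `Γ = {(t, γ t) : t ∈ [0,1]} ⊆ ℝ²`. -/
def curveGraph (γ : ℝ → ℝ) : Set E2 :=
  {p : E2 | p 0 ∈ Icc (0:ℝ) 1 ∧ p 1 = γ (p 0)}

/-- The line `{x : ⟪w,x⟫ = c}` (with `w ≠ 0`) is a supporting line for `Γ`:
it meets the closure of `Γ` and `Γ` lies in one of the two closed half-planes it bounds. -/
def IsSupportingLine (γ : ℝ → ℝ) (w : E2) (c : ℝ) : Prop :=
  w ≠ 0 ∧ (∃ x ∈ closure (curveGraph γ), inner (𝕜 := ℝ) w x = c) ∧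
    ((∀ x ∈ curveGraph γ, inner (𝕜 := ℝ) w x ≤ c) ∨
      (∀ x ∈ curveGraph γ, c ≤ inner (𝕜 := ℝ) w x))

/-- The cap `B(ℓ, r)`: points of `Γ` at distance `< r` from the line
`ℓ = {x : ⟪w,x⟫ = c}`; the distance from `ξ` to `ℓ` is `|⟪w,ξ⟫ − c|/‖w‖`. -/
def cap (γ : ℝ → ℝ) (w : E2) (c r : ℝ) : Set E2 :=
  {ξ : E2 | ξ ∈ curveGraph γ ∧ |inner (𝕜 := ℝ) w ξ - c| / ‖w‖ < r}

/-- `capNumber γ r` is `N(Γ, r)`: the minimal number of caps `B(ℓ, r)` over supporting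
lines `ℓ` needed to cover `Γ`. -/
def capNumber (γ : ℝ → ℝ) (r : ℝ) : ℕ :=
  sInf {n : ℕ | ∃ (w : Fin n → E2) (c : Fin n → ℝ),
    (∀ i, IsSupportingLine γ (w i) (c i)) ∧
    curveGraph γ ⊆ ⋃ i, cap γ (w i) (c i) r}

/-- The vertical `r`-neighbourhood `N_r(Γ) = {ξ : ξ₁ ∈ [0,1], |ξ₂ − γ(ξ₁)| ≤ r}`. -/
def vnbhd (γ : ℝ → ℝ) (r : ℝ) : Set E2 :=
  {ξ : E2 | ξ 0 ∈ Icc (0:ℝ) 1 ∧ |ξ 1 - γ (ξ 0)| ≤ r}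

/-- The Fourier projection `f_J`, defined by `𝓕 f_J (ξ) = 𝓕 f (ξ) · 1_J(ξ₁)`, i.e. as the
inverse Fourier transform of the cut-off of `𝓕 f` to the vertical strip over `J`. -/
def fourierProj (f : E2 → ℂ) (J : Set ℝ) : E2 → ℂ :=
  𝓕⁻ (Set.indicator {ξ : E2 | ξ 0 ∈ J} (𝓕 f))

section
open scoped NNReal Pointwise Convolution

/-- `∫ 𝓕⁻ f · g = ∫ f · 𝓕⁻ g` for integrable functions. -/
lemma integral_fourierInv_smul_eq {f g : E2 → ℂ} (hf : Integrable f) (hg : Integrable g) :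
    ∫ ξ, 𝓕⁻ f ξ • g ξ = ∫ x, f x • 𝓕⁻ g x := by
  have h := VectorFourier.integral_fourierIntegral_smul_eq_flip (μ := (volume : Measure E2))
    (ν := (volume : Measure E2)) (L := -innerₗ E2) (f := f) (g := g)
    Real.continuous_fourierChar (by simpa using (continuous_inner (𝕜 := ℝ) (E := E2)).fun_neg) hf hg
  have hflip : (-innerₗ E2).flip = -innerₗ E2 := by
    ext x y; simp [real_inner_comm]
  rw [hflip] at h
  exact h

/-- Plancherel's identity for the inverse Fourier integral of an `L¹ ∩ L²` function. -/
lemma lintegral_enorm_sq_fourierInv {g : E2 → ℂ} (h1 : Integrable g) (h2 : MemLp g 2) :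
    ∫⁻ x, ‖𝓕⁻ g x‖ₑ ^ 2 = ∫⁻ ξ, ‖g ξ‖ₑ ^ 2 := by
  have hcont : Continuous (𝓕⁻ g : E2 → ℂ) :=
    VectorFourier.fourierIntegral_continuous Real.continuous_fourierChar
      (by simpa using (continuous_inner (𝕜 := ℝ) (E := E2)).fun_neg) h1
  have hae : (𝓕⁻ (h2.toLp g) : Lp ℂ 2 (volume : Measure E2)) =ᵐ[volume] (𝓕⁻ g : E2 → ℂ) := by
    refine ae_eq_of_integral_contDiff_smul_eq
      ((Lp.memLp _).locallyIntegrable (by norm_num)) hcont.locallyIntegrable ?_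
    intro φ hφ hφc
    have hc1 : HasCompactSupport (Complex.ofRealCLM ∘ φ) := hφc.comp_left rfl
    have hc2 : ContDiff ℝ (⊤ : ℕ∞) (Complex.ofRealCLM ∘ φ) :=
      Complex.ofRealCLM.contDiff.comp hφ
    set Φ := hc1.toSchwartzMap hc2 with hΦ
    have hΦa : ∀ x, Φ x = (φ x : ℂ) := fun x => rfl
    have e1 := congrArg (fun T => T Φ) (Lp.fourierInv_toTemperedDistribution_eq (h2.toLp g))
    simp only [TemperedDistribution.fourierInv_apply, Lp.toTemperedDistribution_apply] at e1
    calc ∫ x, φ x • (𝓕⁻ (h2.toLp g) : Lp ℂ 2 (volume : Measure E2)) x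
        = ∫ x, Φ x • (𝓕⁻ (h2.toLp g) : Lp ℂ 2 (volume : Measure E2)) x := by
          congr 1
      _ = ∫ x, (𝓕⁻ Φ) x • (h2.toLp g) x := e1.symm
      _ = ∫ x, 𝓕⁻ (Φ : E2 → ℂ) x • g x := by
          refine integral_congr_ae ?_
          filter_upwards [h2.coeFn_toLp] with x hx
          rw [hx, SchwartzMap.fourierInv_coe]
      _ = ∫ x, Φ x • 𝓕⁻ g x := integral_fourierInv_smul_eq Φ.integrable h1
      _ = _ := by congr 1
  have hn : ‖(𝓕⁻ (h2.toLp g) : Lp ℂ 2 (volume : Measure E2))‖ = ‖h2.toLp g‖ :=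
    (Lp.fourierTransformₗᵢ E2 ℂ).symm.norm_map _
  have key : eLpNorm (𝓕⁻ g : E2 → ℂ) 2 volume = eLpNorm g 2 volume := by
    rw [← eLpNorm_congr_ae hae, ← eLpNorm_congr_ae h2.coeFn_toLp, ← Lp.enorm_def, ← Lp.enorm_def]
    rw [← ofReal_norm, ← ofReal_norm, hn]
  have h := fun u : E2 → ℂ => eLpNorm_nnreal_pow_eq_lintegral (f := u) (p := 2) (μ := volume)
    (by norm_num)
  simpa using (h (𝓕⁻ g)).symm.trans ((congrArg (· ^ (2:ℝ)) key).trans (h g))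

section

/-- `f` is the inverse Fourier transform of a bounded function with bounded support in `S`. -/
def BL (S : Set E2) (f : E2 → ℂ) : Prop :=
  ∃ g : E2 → ℂ, AEStronglyMeasurable g volume ∧ (∃ C : ℝ, ∀ ξ, ‖g ξ‖ ≤ C) ∧
    Bornology.IsBounded (Function.support g) ∧ Function.support g ⊆ S ∧ f = 𝓕⁻ g

lemma memLp_of_bounded_of_support {g : E2 → ℂ} (hm : AEStronglyMeasurable g volume) {C : ℝ}
    (hC : ∀ ξ, ‖g ξ‖ ≤ C) (hb : Bornology.IsBounded (Function.support g)) (p : ℝ≥0∞) :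
    MemLp g p volume := by
  obtain ⟨r, hr⟩ := hb.subset_closedBall 0
  have : MemLp g ⊤ volume := memLp_top_of_bound hm C (Filter.Eventually.of_forall hC)
  refine MemLp.mono_exponent_of_measure_support_ne_top (s := Metric.closedBall 0 r) this
    (fun x hx => ?_) measure_closedBall_lt_top.ne le_top
  by_contra h
  exact hx (hr h)

lemma continuous_fourierInv {g : E2 → ℂ} (h1 : Integrable g) : Continuous (𝓕⁻ g : E2 → ℂ) :=
  VectorFourier.fourierIntegral_continuous Real.continuous_fourierChar
    (by simpa using (continuous_inner (𝕜 := ℝ) (E := E2)).fun_neg) h1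

lemma fourierInv_add' {g h : E2 → ℂ} (hg : Integrable g) (hh : Integrable h) :
    (𝓕⁻ (g + h) : E2 → ℂ) = 𝓕⁻ g + 𝓕⁻ h :=
  VectorFourier.fourierIntegral_add Real.continuous_fourierChar
    (by simpa using (continuous_inner (𝕜 := ℝ) (E := E2)).fun_neg) hg hh

lemma fourierInv_const_mul (c : ℂ) (g : E2 → ℂ) :
    (𝓕⁻ (fun ξ => c * g ξ) : E2 → ℂ) = fun x => c * 𝓕⁻ g x := by
  have := VectorFourier.fourierIntegral_const_smul Real.fourierChar (volume : Measure E2)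
    (-innerₗ E2) g c
  exact this

lemma fourierInv_conj (g : E2 → ℂ) :
    (𝓕⁻ (fun ξ => starRingEnd ℂ (g (-ξ))) : E2 → ℂ) = fun x => starRingEnd ℂ (𝓕⁻ g x) := by
  ext x
  rw [Real.fourierInv_eq', Real.fourierInv_eq', ← integral_conj, ← integral_neg_eq_self]
  congr 1
  ext ξ
  have h2 : starRingEnd ℂ (2 : ℂ) = 2 := map_ofNat _ 2
  simp [← Complex.exp_conj, h2]

lemma norm_fourierInv_le (g : E2 → ℂ) (x : E2) : ‖𝓕⁻ g x‖ ≤ ∫ ξ, ‖g ξ‖ :=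
  VectorFourier.norm_fourierIntegral_le_integral_norm _ _ _ _ _

lemma fourierInv_mul_convolution {g h : E2 → ℂ} (hg : Integrable g) (hh : Integrable h) :
    (𝓕⁻ (g ⋆[ContinuousLinearMap.mul ℂ ℂ] h) : E2 → ℂ) = fun x => 𝓕⁻ g x * 𝓕⁻ h x := by
  ext x
  simp only [Real.fourierInv_eq_fourier_neg]
  exact Real.fourier_mul_convolution_eq hg hh (-x)

namespace BL
variable {S T : Set E2} {f f₁ f₂ : E2 → ℂ}

lemma mono (h : BL S f) (hST : S ⊆ T) : BL T f := by
  obtain ⟨g, a, b, c, d, e⟩ := h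
  exact ⟨g, a, b, c, d.trans hST, e⟩

lemma zero : BL S (fun _ => 0) := by
  refine ⟨0, aestronglyMeasurable_zero, ⟨0, by simp⟩, by simp, by simp, ?_⟩
  ext x; simp [Real.fourierInv_eq]

lemma add (h₁ : BL S f₁) (h₂ : BL S f₂) : BL S (fun x => f₁ x + f₂ x) := by
  obtain ⟨g, a, ⟨C, b⟩, c, d, rfl⟩ := h₁
  obtain ⟨g', a', ⟨C', b'⟩, c', d', rfl⟩ := h₂
  refine ⟨g + g', a.add a', ⟨C + C', fun ξ => (norm_add_le _ _).trans (add_le_add (b ξ) (b' ξ))⟩,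
    (c.union c').subset (Function.support_add _ _),
    (Function.support_add _ _).trans (union_subset d d'), ?_⟩
  rw [fourierInv_add' (memLp_one_iff_integrable.1 (memLp_of_bounded_of_support a b c 1))
    (memLp_one_iff_integrable.1 (memLp_of_bounded_of_support a' b' c' 1))]
  rfl

lemma const_mul (h : BL S f) (z : ℂ) : BL S (fun x => z * f x) := by
  obtain ⟨g, a, ⟨C, b⟩, c, d, rfl⟩ := h
  refine ⟨fun ξ => z * g ξ, a.const_mul z, ⟨‖z‖ * C, fun ξ => ?_⟩, c.subset ?_, ?_, ?_⟩
  · rw [norm_mul]; gcongr; exact b ξ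
  · intro ξ h h'; exact h (by simp [h'])
  · refine subset_trans ?_ d
    intro ξ h h'; exact h (by simp [h'])
  · rw [fourierInv_const_mul]

lemma sub (h₁ : BL S f₁) (h₂ : BL S f₂) : BL S (fun x => f₁ x - f₂ x) := by
  simpa [sub_eq_add_neg] using h₁.add (h₂.const_mul (-1))

lemma sum {ι : Type*} (s : Finset ι) {F : ι → E2 → ℂ} (h : ∀ i ∈ s, BL S (F i)) :
    BL S (fun x => ∑ i ∈ s, F i x) := by
  classical
  induction s using Finset.induction_on with
  | empty => simpa using zero
  | insert i s his ih =>
    simp only [Finset.sum_insert his]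
    exact (h i (by simp)).add (ih fun j hj => h j (by simp [hj]))

lemma conj (h : BL S f) : BL (-S) (fun x => starRingEnd ℂ (f x)) := by
  obtain ⟨g, a, ⟨C, b⟩, c, d, rfl⟩ := h
  have hs : Function.support (fun ξ => starRingEnd ℂ (g (-ξ))) = -Function.support g := by
    ext ξ; simp
  refine ⟨fun ξ => starRingEnd ℂ (g (-ξ)), ?_, ⟨C, fun ξ => by simpa using b (-ξ)⟩,
    by rw [hs]; exact c.neg, by rw [hs]; exact neg_subset_neg.2 d, (fourierInv_conj g).symm⟩
  exact Complex.continuous_conj.comp_aestronglyMeasurable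
    (a.comp_measurePreserving (Measure.measurePreserving_neg volume))

lemma mul (h₁ : BL S f₁) (h₂ : BL T f₂) : BL (S + T) (fun x => f₁ x * f₂ x) := by
  obtain ⟨g, a, ⟨C, b⟩, c, d, rfl⟩ := h₁
  obtain ⟨g', a', ⟨C', b'⟩, c', d', rfl⟩ := h₂
  have i1 := memLp_one_iff_integrable.1 (memLp_of_bounded_of_support a b c 1)
  have i2 := memLp_one_iff_integrable.1 (memLp_of_bounded_of_support a' b' c' 1)
  have hs := support_convolution_subset (ContinuousLinearMap.mul ℂ ℂ) (μ := volume)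
    (f := g) (g := g')
  refine ⟨g ⋆[ContinuousLinearMap.mul ℂ ℂ] g', ?_, ⟨(∫ ξ, ‖g ξ‖) * C', fun ξ => ?_⟩,
    (c.add c').subset hs, hs.trans (add_subset_add d d'), (fourierInv_mul_convolution i1 i2).symm⟩
  · exact (i1.integrable_convolution _ i2).aestronglyMeasurable
  · rw [convolution_def, ← integral_mul_const]
    refine norm_integral_le_of_norm_le (i1.norm.mul_const _) (Filter.Eventually.of_forall fun t => ?_)
    simp only [ContinuousLinearMap.mul_apply', norm_mul]
    gcongr
    exact b' _

lemma continuous (h : BL S f) : Continuous f := by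
  obtain ⟨g, a, ⟨C, b⟩, c, d, rfl⟩ := h
  exact continuous_fourierInv (memLp_one_iff_integrable.1 (memLp_of_bounded_of_support a b c 1))

lemma bounded (h : BL S f) : ∃ C : ℝ, ∀ x, ‖f x‖ ≤ C := by
  obtain ⟨g, a, ⟨C, b⟩, c, d, rfl⟩ := h
  exact ⟨_, norm_fourierInv_le g⟩

lemma lintegral_sq_lt_top (h : BL S f) : ∫⁻ x, ‖f x‖ₑ ^ 2 < ⊤ := by
  obtain ⟨g, a, ⟨C, b⟩, c, d, rfl⟩ := h
  have h2 := memLp_of_bounded_of_support a b c 2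
  rw [lintegral_enorm_sq_fourierInv
    (memLp_one_iff_integrable.1 (memLp_of_bounded_of_support a b c 1)) h2]
  have := lintegral_rpow_enorm_lt_top_of_eLpNorm_lt_top (by norm_num) (by norm_num) h2.2
  simpa using this

lemma fourierInv_sum {ι : Type*} (s : Finset ι) {G : ι → E2 → ℂ} (h : ∀ i ∈ s, Integrable (G i)) :
    (𝓕⁻ (fun ξ => ∑ i ∈ s, G i ξ) : E2 → ℂ) = fun x => ∑ i ∈ s, 𝓕⁻ (G i) x := by
  ext x
  simp only [Real.fourierInv_eq, Finset.smul_sum]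
  rw [integral_finsetSum]
  intro i hi
  have := (Real.fourierIntegral_convergent_iff (μ := volume) (f := G i) (-x)).2 (h i hi)
  simpa using this

/-- Almost orthogonality of functions with boundedly overlapping Fourier supports. -/
lemma lintegral_sum_sq_le {ι : Type*} (s : Finset ι) {F : ι → E2 → ℂ} {S : ι → Set E2}
    (h : ∀ i ∈ s, BL (S i) (F i)) (M : ℕ)
    (hM : ∀ ξ, ∀ t ⊆ s, (∀ i ∈ t, ξ ∈ S i) → t.card ≤ M) :
    ∫⁻ x, ‖∑ i ∈ s, F i x‖ₑ ^ 2 ≤ M * ∑ i ∈ s, ∫⁻ x, ‖F i x‖ₑ ^ 2 := by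
  classical
  choose! g a b c d e using h
  choose! C b using b
  have hm2 := fun i hi => memLp_of_bounded_of_support (a i hi) (b i hi) (c i hi) 2
  have hm1 := fun i hi => memLp_one_iff_integrable.1
    (memLp_of_bounded_of_support (a i hi) (b i hi) (c i hi) 1)
  have h1 : ∀ x, ∑ i ∈ s, F i x = 𝓕⁻ (fun ξ => ∑ i ∈ s, g i ξ) x := by
    intro x
    rw [fourierInv_sum s hm1]
    exact Finset.sum_congr rfl fun i hi => by rw [e i hi]
  simp_rw [h1]
  rw [lintegral_enorm_sq_fourierInv (integrable_finsetSum s hm1) (memLp_finsetSum s hm2)]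
  have h2 : ∑ i ∈ s, ∫⁻ x, ‖F i x‖ₑ ^ 2 = ∑ i ∈ s, ∫⁻ x, ‖g i x‖ₑ ^ 2 :=
    Finset.sum_congr rfl fun i hi => by
      rw [e i hi, lintegral_enorm_sq_fourierInv (hm1 i hi) (hm2 i hi)]
  rw [h2, ← lintegral_finsetSum' s fun i hi => ((a i hi).enorm.pow_const 2),
    ← lintegral_const_mul' _ _ (by simp)]
  refine lintegral_mono fun ξ => ?_
  set t := s.filter fun i => g i ξ ≠ 0
  have hsum : ∑ i ∈ s, g i ξ = ∑ i ∈ t, g i ξ := (Finset.sum_filter_ne_zero s).symm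
  have ht : t.card ≤ M := hM ξ t (Finset.filter_subset _ _) fun i hi => by
    rw [Finset.mem_filter] at hi
    exact d i hi.1 hi.2
  have hreal : ‖∑ i ∈ t, g i ξ‖ ^ 2 ≤ M * ∑ i ∈ s, ‖g i ξ‖ ^ 2 := by
    calc ‖∑ i ∈ t, g i ξ‖ ^ 2 ≤ (∑ i ∈ t, ‖g i ξ‖) ^ 2 := by
          gcongr; exact norm_sum_le _ _
      _ ≤ t.card * ∑ i ∈ t, ‖g i ξ‖ ^ 2 := sq_sum_le_card_mul_sum_sq
      _ ≤ M * ∑ i ∈ s, ‖g i ξ‖ ^ 2 := by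
          gcongr
          exact Finset.filter_subset _ _
  rw [hsum]
  have := ENNReal.ofReal_le_ofReal hreal
  rw [ENNReal.ofReal_pow (norm_nonneg _), ENNReal.ofReal_mul (by positivity),
    ENNReal.ofReal_sum_of_nonneg (fun _ _ => by positivity)] at this
  simpa [ENNReal.ofReal_pow, ofReal_norm] using this

end BL

end

section

/-- The convolution `k * f`. -/
def cnv (k f : E2 → ℂ) (x : E2) : ℂ := ∫ y, k (x - y) * f y

lemma cnv_comm (k f : E2 → ℂ) (x : E2) : cnv k f x = cnv f k x := by
  unfold cnv
  rw [← integral_sub_left_eq_self (fun y => k (x - y) * f y) volume x]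
  simp [mul_comm]

lemma cnv_fourierInv {k g : E2 → ℂ} (hk : Integrable k) (hg : Integrable g) (x : E2) :
    cnv k (𝓕⁻ g) x = 𝓕⁻ (fun ξ => 𝓕 k ξ * g ξ) x := by
  set gx : E2 → ℂ := fun ξ => Real.fourierChar (inner ℝ ξ x) • g ξ with hgx
  have hgxi : Integrable gx := by
    have := (Real.fourierIntegral_convergent_iff (μ := volume) (f := g) (-x)).2 hg
    simpa using this
  have h := VectorFourier.integral_fourierIntegral_smul_eq_flip (μ := (volume : Measure E2))
    (ν := (volume : Measure E2)) (L := innerₗ E2) (f := k) (g := gx)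
    Real.continuous_fourierChar (by simpa using (continuous_inner (𝕜 := ℝ) (E := E2))) hk hgxi
  rw [flip_innerₗ] at h
  rw [cnv_comm, cnv]
  have e1 : ∀ y, 𝓕⁻ g (x - y) = VectorFourier.fourierIntegral Real.fourierChar volume
      (innerₗ E2) gx y := by
    intro y
    rw [Real.fourierInv_eq, VectorFourier.fourierIntegral]
    congr 1; ext ξ
    simp only [hgx, innerₗ_apply_apply, smul_smul, inner_sub_right]
    rw [sub_eq_neg_add, AddChar.map_add_eq_mul]
  simp_rw [e1]
  calc _ = ∫ y, k y • VectorFourier.fourierIntegral Real.fourierChar volume (innerₗ E2) gx y := by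
        simp [mul_comm]
    _ = _ := h.symm
    _ = _ := by
        rw [Real.fourierInv_eq]
        congr 1; ext ξ
        simp only [hgx, smul_eq_mul, mul_smul_comm]
        rfl

lemma continuous_fourier' {k : E2 → ℂ} (hk : Integrable k) : Continuous (𝓕 k : E2 → ℂ) :=
  VectorFourier.fourierIntegral_continuous Real.continuous_fourierChar
    (by simpa using (continuous_inner (𝕜 := ℝ) (E := E2))) hk

lemma norm_fourier_le (k : E2 → ℂ) (ξ : E2) : ‖𝓕 k ξ‖ ≤ ∫ x, ‖k x‖ :=
  VectorFourier.norm_fourierIntegral_le_integral_norm _ _ _ _ _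

namespace BL
variable {S T : Set E2} {f k : E2 → ℂ}

lemma conv (hk : Integrable k) (h : BL S f) :
    BL (S ∩ {ξ | 𝓕 k ξ ≠ 0}) (cnv k f) := by
  obtain ⟨g, a, ⟨C, b⟩, c, d, rfl⟩ := h
  refine ⟨fun ξ => 𝓕 k ξ * g ξ, (continuous_fourier' hk).aestronglyMeasurable.mul a,
    ⟨(∫ x, ‖k x‖) * C, fun ξ => ?_⟩, c.subset ?_, ?_, ?_⟩
  · rw [norm_mul]
    exact mul_le_mul (norm_fourier_le k ξ) (b ξ) (norm_nonneg _)
      ((norm_nonneg _).trans (norm_fourier_le k ξ))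
  · intro ξ h; exact right_ne_zero_of_mul h
  · intro ξ h; exact ⟨d (right_ne_zero_of_mul h), left_ne_zero_of_mul h⟩
  · ext x
    exact cnv_fourierInv hk (memLp_one_iff_integrable.1 (memLp_of_bounded_of_support a b c 1)) x

lemma sub_conv (hk : Integrable k) (h : BL S f) :
    BL (S ∩ {ξ | 𝓕 k ξ ≠ 1}) (fun x => f x - cnv k f x) := by
  obtain ⟨g, a, ⟨C, b⟩, c, d, rfl⟩ := h
  have hi := memLp_one_iff_integrable.1 (memLp_of_bounded_of_support a b c 1)
  have hF := (continuous_fourier' hk).aestronglyMeasurable (μ := (volume : Measure E2))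
  have hE : ∀ ξ, (1 - 𝓕 k ξ) * g ξ ≠ 0 → 𝓕 k ξ ≠ 1 := by
    intro ξ h h'; exact h (by simp [h'])
  refine ⟨fun ξ => (1 - 𝓕 k ξ) * g ξ, (aestronglyMeasurable_const.sub hF).mul a,
    ⟨(1 + ∫ x, ‖k x‖) * C, fun ξ => ?_⟩, c.subset ?_, ?_, ?_⟩
  · rw [norm_mul]
    have h1 : ‖1 - 𝓕 k ξ‖ ≤ 1 + ∫ x, ‖k x‖ := by
      refine (norm_sub_le _ _).trans ?_
      rw [norm_one]; gcongr; exact norm_fourier_le k ξ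
    exact mul_le_mul h1 (b ξ) (norm_nonneg _) ((norm_nonneg _).trans h1)
  · intro ξ h; exact right_ne_zero_of_mul h
  · intro ξ h; exact ⟨d (right_ne_zero_of_mul h), hE ξ h⟩
  · ext x
    have hkg : Integrable fun ξ => 𝓕 k ξ * g ξ := hi.bdd_mul hF
      (Filter.Eventually.of_forall (norm_fourier_le k))
    have e : (fun ξ => (1 - 𝓕 k ξ) * g ξ) = g + fun ξ => (-1) * (𝓕 k ξ * g ξ) := by
      ext ξ; simp; ring
    rw [cnv_fourierInv hk hi, e, fourierInv_add' hi (hkg.const_mul _), fourierInv_const_mul]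
    simp [sub_eq_add_neg]

lemma eq_zero_of_empty (h : BL ∅ f) (x : E2) : f x = 0 := by
  obtain ⟨g, a, ⟨C, b⟩, c, d, rfl⟩ := h
  have : g = 0 := Function.support_eq_empty_iff.1 (subset_empty_iff.1 d)
  subst this
  simp [Real.fourierInv_eq]

lemma conv_eq_self (hk : Integrable k) (h : BL S f) (h1 : ∀ ξ ∈ S, 𝓕 k ξ = 1) (x : E2) :
    cnv k f x = f x := by
  have := eq_zero_of_empty ((sub_conv hk h).mono (T := ∅) fun ξ hξ => hξ.2 (h1 ξ hξ.1)) x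
  exact (sub_eq_zero.1 this).symm

lemma conv_eq_zero (hk : Integrable k) (h : BL S f) (h1 : ∀ ξ ∈ S, 𝓕 k ξ = 0) (x : E2) :
    cnv k f x = 0 :=
  eq_zero_of_empty ((conv hk h).mono (T := ∅) fun ξ hξ => hξ.2 (h1 ξ hξ.1)) x

end BL

end

/-- The linear map `x ↦ (A (x₀ + s x₁), B x₁)`. -/
def shear (s A B : ℝ) : E2 →ₗ[ℝ] E2 :=
  Matrix.toLin (EuclideanSpace.basisFun (Fin 2) ℝ).toBasis
    (EuclideanSpace.basisFun (Fin 2) ℝ).toBasis !![A, A * s; 0, B]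

lemma shear_zero (s A B : ℝ) (x : E2) : shear s A B x 0 = A * (x 0 + s * x 1) := by
  simp [shear, Matrix.toLin_apply, Fin.sum_univ_two, Matrix.mulVec, dotProduct]; ring

lemma shear_one (s A B : ℝ) (x : E2) : shear s A B x 1 = B * x 1 := by
  simp [shear, Matrix.toLin_apply, Fin.sum_univ_two, Matrix.mulVec, dotProduct]

lemma det_shear (s A B : ℝ) : LinearMap.det (shear s A B) = A * B := by
  simp [shear, LinearMap.det_toLin, Matrix.det_fin_two]

lemma continuous_shear (s A B : ℝ) : Continuous (shear s A B) :=
  LinearMap.continuous_of_finiteDimensional _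

lemma map_shear {s A B : ℝ} (hA : 0 < A) (hB : 0 < B) :
    ENNReal.ofReal (A * B) • Measure.map (shear s A B) volume = volume := by
  have hd : LinearMap.det (shear s A B) ≠ 0 := by rw [det_shear]; positivity
  rw [Measure.map_linearMap_addHaar_eq_smul_addHaar _ hd, det_shear, smul_smul,
    ← ENNReal.ofReal_mul (by positivity), abs_of_pos (by positivity),
    mul_inv_cancel₀ (by positivity)]
  simp

lemma lintegral_shear {s A B : ℝ} (hA : 0 < A) (hB : 0 < B) {F : E2 → ℝ≥0∞} (hF : Measurable F) :
    ∫⁻ x, ENNReal.ofReal (A * B) * F (shear s A B x) = ∫⁻ x, F x := by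
  conv_rhs => rw [← map_shear (s := s) hA hB]
  rw [lintegral_smul_measure, lintegral_map hF (continuous_shear s A B).measurable]
  exact lintegral_const_mul _ (hF.comp (continuous_shear s A B).measurable)

lemma integral_shear {s A B : ℝ} (hA : 0 < A) (hB : 0 < B) {F : E2 → ℂ} (hF : Continuous F) :
    ∫ x, ((A * B : ℝ) : ℂ) * F (shear s A B x) = ∫ x, F x := by
  conv_rhs => rw [← map_shear (s := s) hA hB]
  rw [integral_smul_measure, integral_map (continuous_shear s A B).aemeasurable
    hF.aestronglyMeasurable, integral_const_mul, ENNReal.toReal_ofReal (by positivity)]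
  simp

/-- The gauge `1 + |A (x₀ + s x₁)| + |B x₁|`. -/
def rho (s A B : ℝ) (x : E2) : ℝ := 1 + |A * (x 0 + s * x 1)| + |B * x 1|

lemma one_le_rho (s A B : ℝ) (x : E2) : 1 ≤ rho s A B x := by
  unfold rho; linarith [abs_nonneg (A * (x 0 + s * x 1)), abs_nonneg (B * x 1)]

lemma rho_pos (s A B : ℝ) (x : E2) : 0 < rho s A B x :=
  zero_lt_one.trans_le (one_le_rho s A B x)

lemma continuous_rho (s A B : ℝ) : Continuous (rho s A B) := by
  unfold rho; fun_prop

lemma rho_add_le (s A B : ℝ) (x y : E2) :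
    rho s A B (x + y) ≤ rho s A B x * rho s A B y := by
  have h1 : |A * ((x + y) 0 + s * (x + y) 1)| ≤
      |A * (x 0 + s * x 1)| + |A * (y 0 + s * y 1)| := by
    refine le_trans (le_of_eq ?_) (abs_add_le _ _)
    congr 1; simp only [PiLp.add_apply]; ring
  have h2 : |B * (x + y) 1| ≤ |B * x 1| + |B * y 1| := by
    refine le_trans (le_of_eq ?_) (abs_add_le _ _)
    congr 1; simp only [PiLp.add_apply]; ring
  unfold rho
  nlinarith [abs_nonneg (A * (x 0 + s * x 1)), abs_nonneg (B * x 1),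
    abs_nonneg (A * (y 0 + s * y 1)), abs_nonneg (B * y 1),
    mul_nonneg (add_nonneg (abs_nonneg (A * (x 0 + s * x 1))) (abs_nonneg (B * x 1)))
      (add_nonneg (abs_nonneg (A * (y 0 + s * y 1))) (abs_nonneg (B * y 1)))]

lemma rho_neg (s A B : ℝ) (x : E2) : rho s A B (-x) = rho s A B x := by
  have h1 : |A * ((-x) 0 + s * (-x) 1)| = |A * (x 0 + s * x 1)| := by
    rw [← abs_neg]; congr 1; simp only [PiLp.neg_apply]; ring
  have h2 : |B * (-x) 1| = |B * x 1| := by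
    rw [← abs_neg]; congr 1; simp only [PiLp.neg_apply]; ring
  rw [rho, rho, h1, h2]

lemma rho_shear (s A B : ℝ) (x : E2) : rho 0 1 1 (shear s A B x) = rho s A B x := by
  simp [rho, shear_zero, shear_one]

lemma rho_mono {s A B A' B' : ℝ} (hA : 0 ≤ A) (hB : 0 ≤ B) (hAA : A ≤ A') (hBB : B ≤ B')
    (x : E2) : rho s A B x ≤ rho s A' B' x := by
  unfold rho
  simp only [abs_mul, abs_of_nonneg hA, abs_of_nonneg hB, abs_of_nonneg (hA.trans hAA),
    abs_of_nonneg (hB.trans hBB)]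
  gcongr

/-- The weight `A B (gauge)^{-N}`. -/
def wt (s A B : ℝ) (N : ℕ) (x : E2) : ℝ≥0∞ := ENNReal.ofReal (A * B / rho s A B x ^ N)

lemma measurable_wt (s A B : ℝ) (N : ℕ) : Measurable (wt s A B N) := by
  refine ENNReal.measurable_ofReal.comp (Continuous.measurable ?_)
  exact continuous_const.div ((continuous_rho s A B).pow N)
    fun x => (pow_pos (rho_pos s A B x) N).ne'

/-- The mass of the unit weight. -/
def wtMass : ℝ≥0∞ := ∫⁻ x, wt 0 1 1 3 x

lemma norm_le_abs_add_abs (x : E2) : ‖x‖ ≤ |x 0| + |x 1| := by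
  rw [EuclideanSpace.norm_eq, Fin.sum_univ_two]
  refine Real.sqrt_le_iff.2 ⟨by positivity, ?_⟩
  simp only [Real.norm_eq_abs]
  nlinarith [mul_nonneg (abs_nonneg (x 0)) (abs_nonneg (x 1))]

lemma wtMass_lt_top : wtMass < ⊤ := by
  have h := integrable_one_add_norm (E := E2) (μ := volume) (r := 3) (by simp; norm_num)
  refine lt_of_le_of_lt ?_ h.lintegral_lt_top
  refine lintegral_mono fun x => ENNReal.ofReal_le_ofReal ?_
  rw [Real.rpow_neg (by positivity), ← one_div]
  norm_num [rho]
  rw [← one_div, ← one_div]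
  have := norm_le_abs_add_abs x
  have h0 := norm_nonneg x
  apply one_div_le_one_div_of_le (by positivity)
  have : 1 + ‖x‖ ≤ 1 + |x 0| + |x 1| := by linarith
  gcongr

lemma lintegral_wt_le {s A B : ℝ} (hA : 0 < A) (hB : 0 < B) {N : ℕ} (hN : 3 ≤ N) :
    ∫⁻ x, wt s A B N x ≤ wtMass := by
  rw [wtMass, ← lintegral_shear (s := s) hA hB (measurable_wt 0 1 1 3)]
  refine lintegral_mono fun x => ?_
  unfold wt
  rw [← ENNReal.ofReal_mul (by positivity), rho_shear]
  refine ENNReal.ofReal_le_ofReal ?_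
  rw [one_mul, mul_one_div]
  have := rho_pos s A B x
  gcongr
  exact one_le_rho s A B x

lemma wt_neg (s A B : ℝ) (N : ℕ) (x : E2) : wt s A B N (-x) = wt s A B N x := by
  simp only [wt, rho_neg]

/-- A power of the gauge lowers the exponent of the weight. -/
lemma rho_pow_mul_wt (s A B : ℝ) (N N' : ℕ) (x : E2) :
    ENNReal.ofReal (rho s A B x) ^ N' * wt s A B (N + N') x = wt s A B N x := by
  unfold wt
  have h := rho_pos s A B x
  rw [← ENNReal.ofReal_pow h.le, ← ENNReal.ofReal_mul (by positivity)]
  congr 1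
  rw [pow_add]
  field_simp

/-- The weights vary slowly. -/
lemma wt_sub_le {s A B : ℝ} (hA : 0 < A) (hB : 0 < B) (N : ℕ) (x y z : E2) :
    wt s A B N (x - z) ≤ ENNReal.ofReal (rho s A B (x - y)) ^ N * wt s A B N (y - z) := by
  unfold wt
  have h := rho_pos s A B (x - y)
  rw [← ENNReal.ofReal_pow h.le, ← ENNReal.ofReal_mul (by positivity)]
  refine ENNReal.ofReal_le_ofReal ?_
  have h1 := rho_pos s A B (y - z)
  have h2 := rho_pos s A B (x - z)
  have h3 : rho s A B (y - z) ≤ rho s A B (x - y) * rho s A B (x - z) := by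
    have := rho_add_le s A B (-(x - y)) (x - z)
    rw [rho_neg] at this
    convert this using 2
    abel
  rw [← mul_div_assoc, div_le_div_iff₀ (by positivity) (by positivity)]
  calc A * B * rho s A B (y - z) ^ N
      ≤ A * B * (rho s A B (x - y) * rho s A B (x - z)) ^ N := by gcongr
    _ = _ := by rw [mul_pow]; ring

/-- Convolution of nonnegative functions. -/
def cv (w g : E2 → ℝ≥0∞) (x : E2) : ℝ≥0∞ := ∫⁻ y, w (x - y) * g y

lemma cv_wt_le {s A B : ℝ} (hA : 0 < A) (hB : 0 < B) (N : ℕ) (g : E2 → ℝ≥0∞) (x y : E2) :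
    cv (wt s A B N) g x ≤ ENNReal.ofReal (rho s A B (x - y)) ^ N * cv (wt s A B N) g y := by
  unfold cv
  rw [← lintegral_const_mul' _ _ (by simp)]
  refine lintegral_mono fun z => ?_
  rw [← mul_assoc]
  gcongr
  exact wt_sub_le hA hB N x y z

lemma lintegral_cv {w g : E2 → ℝ≥0∞} (hw : Measurable w) (hg : Measurable g) :
    ∫⁻ x, cv w g x = (∫⁻ x, w x) * ∫⁻ x, g x := by
  unfold cv
  rw [lintegral_lintegral_swap (by fun_prop)]
  rw [← lintegral_const_mul _ hg]
  refine lintegral_congr fun y => ?_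
  rw [lintegral_mul_const _ (by fun_prop), lintegral_sub_right_eq_self w y]

lemma measurable_cv {w g : E2 → ℝ≥0∞} (hw : Measurable w) (hg : Measurable g) :
    Measurable (cv w g) := by
  unfold cv
  exact Measurable.lintegral_prod_right' (f := fun p : E2 × E2 => w (p.1 - p.2) * g p.2)
    (by fun_prop)

/-- The parallelogram centred at `P` with slope `s` and half-dimensions `A`, `B`. -/
def box (P : E2) (s A B : ℝ) : Set E2 :=
  {ξ | |ξ 0 - P 0| ≤ A ∧ |ξ 1 - P 1 - s * (ξ 0 - P 0)| ≤ B}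

/-- A smooth bump function on the plane. -/
def bumpE2 : ContDiffBump (0 : E2) := ⟨2, 4, by norm_num, by norm_num⟩

/-- The bump function as a complex Schwartz function. -/
def bumpS : SchwartzMap E2 ℂ :=
  (show HasCompactSupport (fun x => (bumpE2 x : ℂ)) from
    bumpE2.hasCompactSupport.comp_left (g := fun t : ℝ => (t : ℂ)) rfl).toSchwartzMap
    (Complex.ofRealCLM.contDiff.comp bumpE2.contDiff)

lemma bumpS_apply (x : E2) : bumpS x = (bumpE2 x : ℂ) := rfl

/-- The inverse Fourier transform of the bump function. -/
def phi0 : SchwartzMap E2 ℂ := 𝓕⁻ bumpS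

lemma fourier_phi0 : 𝓕 (phi0 : E2 → ℂ) = bumpS := by
  rw [← SchwartzMap.fourier_coe, phi0, FourierTransform.fourier_fourierInv_eq]

/-- The modulated kernel adapted to a parallelogram. -/
def ker (P : E2) (s A B : ℝ) (x : E2) : ℂ :=
  (Real.fourierChar (inner ℝ P x) : ℂ) * (((A * B : ℝ) : ℂ) * phi0 (shear s A B x))

/-- The transposed inverse of `shear`. -/
def shearDual (s A B : ℝ) (ξ : E2) : E2 := !₂[ξ 0 / A, (ξ 1 - s * ξ 0) / B]

lemma inner_shear {s A B : ℝ} (hA : A ≠ 0) (hB : B ≠ 0) (x ξ : E2) :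
    inner ℝ (shear s A B x) (shearDual s A B ξ) = (inner ℝ x ξ : ℝ) := by
  simp only [PiLp.inner_apply, Fin.sum_univ_two, shear_zero, shear_one, shearDual]
  simp
  field_simp
  ring

lemma continuous_ker (P : E2) (s A B : ℝ) : Continuous (ker P s A B) := by
  have h1 := continuous_shear s A B
  have h2 := phi0.continuous
  have h3 : Continuous fun x : E2 => (Real.fourierChar (inner ℝ P x) : ℂ) :=
    continuous_subtype_val.comp (Real.continuous_fourierChar.comp
      (continuous_const.inner continuous_id))
  exact h3.mul (continuous_const.mul (h2.comp h1))

lemma fourier_ker {P : E2} {s A B : ℝ} (hA : 0 < A) (hB : 0 < B) (ξ : E2) :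
    𝓕 (ker P s A B) ξ = bumpS (shearDual s A B (ξ - P)) := by
  have hcont : Continuous fun y : E2 =>
      Real.fourierChar (-(inner ℝ y (shearDual s A B (ξ - P)))) • phi0 y := by
    refine Continuous.smul ?_ phi0.continuous
    have h : Continuous fun y : E2 => -(inner ℝ y (shearDual s A B (ξ - P)) : ℝ) :=
      (continuous_id.inner continuous_const).neg
    exact continuous_subtype_val.comp (Real.continuous_fourierChar.comp h)
  rw [← fourier_phi0, Real.fourier_eq, Real.fourier_eq, ← integral_shear (s := s) hA hB hcont]
  congr 1; ext x
  rw [inner_shear hA.ne' hB.ne', ker, inner_sub_right, neg_sub, sub_eq_add_neg,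
    AddChar.map_add_eq_mul, real_inner_comm x P]
  simp only [Circle.smul_def, smul_eq_mul, Circle.coe_mul]
  ring

lemma fourier_ker_eq_one {P : E2} {s A B : ℝ} (hA : 0 < A) (hB : 0 < B) {ξ : E2}
    (h : ξ ∈ box P s A B) : 𝓕 (ker P s A B) ξ = 1 := by
  rw [fourier_ker hA hB, bumpS_apply]
  have : shearDual s A B (ξ - P) ∈ Metric.closedBall (0 : E2) bumpE2.rIn := by
    rw [mem_closedBall_zero_iff]
    refine (norm_le_abs_add_abs _).trans ?_
    have h1 : |shearDual s A B (ξ - P) 0| ≤ 1 := by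
      simp [shearDual, abs_div, abs_of_pos hA, div_le_one hA]; exact h.1
    have h2 : |shearDual s A B (ξ - P) 1| ≤ 1 := by
      simp [shearDual, abs_div, abs_of_pos hB, div_le_one hB]; exact h.2
    show _ ≤ (2:ℝ)
    linarith
  rw [bumpE2.one_of_mem_closedBall this]; simp

lemma mem_box_of_fourier_ker_ne_zero {P : E2} {s A B : ℝ} (hA : 0 < A) (hB : 0 < B) {ξ : E2}
    (h : 𝓕 (ker P s A B) ξ ≠ 0) : ξ ∈ box P s (4 * A) (4 * B) := by
  rw [fourier_ker hA hB, bumpS_apply] at h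
  have h4 : ‖shearDual s A B (ξ - P)‖ < 4 := by
    by_contra hc
    refine h ?_
    rw [bumpE2.zero_of_le_dist (by rw [dist_zero_right]; exact not_lt.1 hc)]; simp
  have h1 := (PiLp.norm_apply_le (shearDual s A B (ξ - P)) 0).trans h4.le
  have h2 := (PiLp.norm_apply_le (shearDual s A B (ξ - P)) 1).trans h4.le
  simp [shearDual, abs_of_pos hA, div_le_iff₀ hA] at h1
  simp [shearDual, abs_of_pos hB, div_le_iff₀ hB] at h2
  exact ⟨h1, h2⟩

/-- Rapid decay of the kernel. -/
lemma exists_ker_le (N : ℕ) : ∃ C : ℝ≥0, ∀ (P : E2) (s A B : ℝ), 0 < A → 0 < B → ∀ x,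
    ‖ker P s A B x‖ₑ ≤ C * wt s A B N x := by
  obtain ⟨C, hC⟩ : ∃ C : ℝ, ∀ x, (1 + ‖x‖) ^ N * ‖phi0 x‖ ≤ C := by
    have := fun x => SchwartzMap.one_add_le_sup_seminorm_apply (𝕜 := ℝ) (m := (N, 0))
      (k := N) (n := 0) le_rfl le_rfl phi0 x
    refine ⟨2 ^ N * ((Finset.Iic (N, 0)).sup fun m => SchwartzMap.seminorm ℝ m.1 m.2) phi0,
      fun x => ?_⟩
    have h := this x
    rw [norm_iteratedFDeriv_zero] at h
    exact h
  have hC0 : 0 ≤ C := le_trans (by positivity) (hC 0)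
  refine ⟨(2 ^ N * C).toNNReal, fun P s A B hA hB x => ?_⟩
  have hρ := rho_pos s A B x
  have h1 : rho s A B x ≤ 2 * (1 + ‖shear s A B x‖) := by
    rw [← rho_shear, rho]
    have a := PiLp.norm_apply_le (shear s A B x) 0
    have b := PiLp.norm_apply_le (shear s A B x) 1
    rw [Real.norm_eq_abs] at a b
    simp only [one_mul, zero_mul, add_zero]
    linarith
  have h2 : ‖ker P s A B x‖ ≤ 2 ^ N * C * (A * B / rho s A B x ^ N) := by
    rw [ker, norm_mul, Circle.norm_coe, one_mul, norm_mul, Complex.norm_real, Real.norm_eq_abs,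
      abs_of_pos (by positivity), mul_div_assoc', le_div_iff₀ (by positivity)]
    calc A * B * ‖phi0 (shear s A B x)‖ * rho s A B x ^ N
        ≤ A * B * ‖phi0 (shear s A B x)‖ * (2 * (1 + ‖shear s A B x‖)) ^ N := by gcongr
      _ = A * B * 2 ^ N * ((1 + ‖shear s A B x‖) ^ N * ‖phi0 (shear s A B x)‖) := by
          rw [mul_pow]; ring
      _ ≤ A * B * 2 ^ N * C := by gcongr; exact hC _
      _ = _ := by ring
  rw [← ofReal_norm]
  refine (ENNReal.ofReal_le_ofReal h2).trans ?_
  rw [ENNReal.ofReal_mul (by positivity)]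
  rfl

lemma integrable_ker (P : E2) {s A B : ℝ} (hA : 0 < A) (hB : 0 < B) :
    Integrable (ker P s A B) := by
  refine ⟨(continuous_ker P s A B).aestronglyMeasurable, ?_⟩
  obtain ⟨C, hC⟩ := exists_ker_le 3
  calc ∫⁻ x, ‖ker P s A B x‖ₑ ≤ ∫⁻ x, C * wt s A B 3 x := lintegral_mono (hC P s A B hA hB)
    _ = C * ∫⁻ x, wt s A B 3 x := lintegral_const_mul' _ _ (by simp)
    _ ≤ C * wtMass := by gcongr; exact lintegral_wt_le hA hB le_rfl
    _ < ⊤ := ENNReal.mul_lt_top (by simp) wtMass_lt_top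

lemma enorm_cnv_le (k f : E2 → ℂ) (x : E2) :
    ‖cnv k f x‖ₑ ≤ cv (fun y => ‖k y‖ₑ) (fun y => ‖f y‖ₑ) x := by
  refine (enorm_integral_le_lintegral_enorm _).trans (le_of_eq ?_)
  simp [cv, enorm_mul]

lemma box_mono {P : E2} {s A B A' B' : ℝ} (hA : A ≤ A') (hB : B ≤ B') :
    box P s A B ⊆ box P s A' B' := fun _ h => ⟨h.1.trans hA, h.2.trans hB⟩

lemma BL_ker {s A B : ℝ} (hA : 0 < A) (hB : 0 < B) :
    BL (box 0 s (4 * A) (4 * B)) (ker 0 s A B) := by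
  have hi := integrable_ker 0 (s := s) hA hB
  have hc := continuous_fourier' hi
  have hsupp : Function.support (𝓕 (ker 0 s A B)) ⊆ box 0 s (4 * A) (4 * B) :=
    fun ξ h => mem_box_of_fourier_ker_ne_zero hA hB h
  have hbd : Bornology.IsBounded (box 0 s (4 * A) (4 * B)) := by
    refine (Metric.isBounded_closedBall (x := (0 : E2)) (r := 4 * A + (4 * B + |s| * (4 * A)))).subset ?_
    rintro ξ ⟨h1, h2⟩
    rw [mem_closedBall_zero_iff]
    refine (norm_le_abs_add_abs _).trans ?_
    simp only [PiLp.zero_apply, sub_zero] at h1 h2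
    have h3 : |ξ 1| ≤ |ξ 1 - s * ξ 0| + |s * ξ 0| := by
      simpa using abs_add_le (ξ 1 - s * ξ 0) (s * ξ 0)
    rw [abs_mul] at h3
    have := mul_le_mul_of_nonneg_left h1 (abs_nonneg s)
    linarith
  refine ⟨𝓕 (ker 0 s A B), hc.aestronglyMeasurable, ⟨_, norm_fourier_le _⟩, hbd.subset hsupp,
    hsupp, ?_⟩
  have hi' : Integrable (𝓕 (ker 0 s A B)) :=
    memLp_one_iff_integrable.1 (memLp_of_bounded_of_support hc.aestronglyMeasurable
      (norm_fourier_le _) (hbd.subset hsupp) 1)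
  exact ((continuous_ker 0 s A B).fourierInv_fourier_eq hi hi').symm

/-- Cauchy–Schwarz against a weight. -/
lemma sq_cv_le {w g : E2 → ℝ≥0∞} (hw : Measurable w) (hg : Measurable g) (x : E2) :
    cv w g x ^ 2 ≤ (∫⁻ y, w y) * cv w (fun y => g y ^ 2) x := by
  unfold cv
  have h := ENNReal.lintegral_mul_le_Lp_mul_Lq volume (Real.HolderConjugate.two_two)
    (f := fun y => w (x - y) ^ (1 / 2 : ℝ)) (g := fun y => w (x - y) ^ (1 / 2 : ℝ) * g y)
    (by fun_prop) (by fun_prop)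
  have e1 : ∀ a : ℝ≥0∞, a ^ (1 / 2 : ℝ) * a ^ (1 / 2 : ℝ) = a := fun a => by
    rw [← ENNReal.rpow_add_of_nonneg _ _ (by norm_num) (by norm_num)]; norm_num
  have e2 : ∀ a : ℝ≥0∞, (a ^ (1 / 2 : ℝ)) ^ 2 = a := fun a => by rw [sq, e1]
  simp only [Pi.mul_apply, ← mul_assoc, e1] at h
  have h3 := pow_le_pow_left' h 2
  rw [mul_pow, e2, e2] at h3
  refine h3.trans (le_of_eq ?_)
  congr 1
  · rw [← lintegral_sub_left_eq_self (μ := volume) w x]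
    congr 1; ext y
    rw [ENNReal.rpow_two, e2]
  · congr 1; ext y
    rw [ENNReal.rpow_two, mul_pow, e2]

lemma cv_mono {w w' g g' : E2 → ℝ≥0∞} (hw : ∀ x, w x ≤ w' x) (hg : ∀ x, g x ≤ g' x) (x : E2) :
    cv w g x ≤ cv w' g' x := lintegral_mono fun _ => mul_le_mul' (hw _) (hg _)

lemma cv_const_mul {w g : E2 → ℝ≥0∞} {C : ℝ≥0∞} (hC : C ≠ ⊤) (x : E2) :
    cv (fun y => C * w y) g x = C * cv w g x := by
  unfold cv
  rw [← lintegral_const_mul' _ _ hC]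
  simp [mul_assoc]

lemma wt_scale_le {s A B a : ℝ} (hA : 0 < A) (hB : 0 < B) (ha : 1 ≤ a) (N : ℕ) (x : E2) :
    wt s (a * A) (a * B) N x ≤ ENNReal.ofReal (a ^ 2) * wt s A B N x := by
  unfold wt
  rw [← ENNReal.ofReal_mul (by positivity)]
  refine ENNReal.ofReal_le_ofReal ?_
  have h1 := rho_pos s A B x
  have h2 : rho s A B x ≤ rho s (a * A) (a * B) x :=
    rho_mono hA.le hB.le (le_mul_of_one_le_left hA.le ha) (le_mul_of_one_le_left hB.le ha) x
  rw [mul_div_assoc']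
  have : a ^ 2 * (A * B) = a * A * (a * B) := by ring
  rw [this]
  gcongr

/-- Local constancy: a function with spectrum in a parallelogram is controlled by its
averages at the dual scale. -/
lemma exists_reproducing {a : ℝ} (ha : 1 ≤ a) {N : ℕ} (hN : 3 ≤ N) :
    ∃ C : ℝ≥0, ∀ (P : E2) (s A B : ℝ), 0 < A → 0 < B → ∀ U : E2 → ℂ,
      BL (box P s (a * A) (a * B)) U → ∀ x,
      ‖U x‖ₑ ^ 2 ≤ C * cv (wt s A B N) (fun y => ‖U y‖ₑ ^ 2) x := by
  obtain ⟨C, hC⟩ := exists_ker_le N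
  obtain ⟨C', hC'⟩ : ∃ C' : ℝ≥0, C' = C * (a ^ 2).toNNReal := ⟨_, rfl⟩
  have hM := wtMass_lt_top.ne
  refine ⟨C' ^ 2 * wtMass.toNNReal, fun P s A B hA hB U hU x => ?_⟩
  have ha0 : 0 < a := by linarith
  have hk := integrable_ker P (s := s) (mul_pos ha0 hA) (mul_pos ha0 hB)
  have h1 := BL.conv_eq_self hk hU
    (fun ξ hξ => fourier_ker_eq_one (mul_pos ha0 hA) (mul_pos ha0 hB) hξ) x
  have h2 : ‖U x‖ₑ ≤ C' * cv (wt s A B N) (fun y => ‖U y‖ₑ) x := by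
    rw [← cv_const_mul (by simp)]
    conv_lhs => rw [← h1]
    refine (enorm_cnv_le _ _ x).trans (cv_mono (fun y => ?_) (fun _ => le_rfl) x)
    refine (hC P s _ _ (mul_pos ha0 hA) (mul_pos ha0 hB) y).trans ?_
    refine (mul_le_mul_right (wt_scale_le hA hB ha N y) _).trans ?_
    rw [← mul_assoc, hC', ENNReal.coe_mul]
    rfl
  calc ‖U x‖ₑ ^ 2 ≤ (C' * cv (wt s A B N) (fun y => ‖U y‖ₑ) x) ^ 2 := by gcongr
    _ = C' ^ 2 * cv (wt s A B N) (fun y => ‖U y‖ₑ) x ^ 2 := by rw [mul_pow]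
    _ ≤ C' ^ 2 * (wtMass * cv (wt s A B N) (fun y => ‖U y‖ₑ ^ 2) x) := by
        gcongr
        refine (sq_cv_le (measurable_wt _ _ _ _) hU.continuous.measurable.enorm x).trans ?_
        gcongr
        exact lintegral_wt_le hA hB hN
    _ = _ := by
        rw [ENNReal.coe_mul, ENNReal.coe_toNNReal hM, mul_assoc, ENNReal.coe_pow]

/-- Smooth version of the indicator of `S` at the scale dual to a parallelogram. -/
def cut (s A B : ℝ) (S : Set E2) (x : E2) : ℂ := cnv (ker 0 s A B) (S.indicator 1) x

lemma BL_cut {s A B : ℝ} (hA : 0 < A) (hB : 0 < B) {S : Set E2} (hS : MeasurableSet S)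
    (hv : volume S < ⊤) : BL (box 0 s (4 * A) (4 * B)) (cut s A B S) := by
  have h1 : Integrable (S.indicator (1 : E2 → ℂ)) :=
    (integrable_indicator_iff hS).2 (integrableOn_const hv.ne)
  have := (BL.conv h1 (BL_ker (s := s) hA hB)).mono inter_subset_left
  convert this using 1
  ext x
  rw [cut, cnv_comm]

lemma integral_ker {s A B : ℝ} (hA : 0 < A) (hB : 0 < B) : ∫ x, ker 0 s A B x = 1 := by
  have h := fourier_ker_eq_one (P := 0) (s := s) (ξ := 0) hA hB
    ⟨by simpa using hA.le, by simpa using hB.le⟩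
  rw [Real.fourier_eq] at h
  simpa using h

lemma cut_add_cut_compl {s A B : ℝ} (hA : 0 < A) (hB : 0 < B) {S : Set E2}
    (hS : MeasurableSet S) (x : E2) : cut s A B S x + cut s A B Sᶜ x = 1 := by
  have hi : Integrable fun y => ker 0 s A B (x - y) :=
    (integrable_ker 0 hA hB).comp_sub_left x
  have h : ∀ T : Set E2, (fun y => ker 0 s A B (x - y) * T.indicator 1 y) =
      T.indicator fun y => ker 0 s A B (x - y) := fun T => by
    ext y; by_cases hy : y ∈ T <;> simp [hy]
  unfold cut cnv
  rw [h, h, integral_indicator hS, integral_indicator hS.compl, integral_add_compl hS hi,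
    integral_sub_left_eq_self (ker 0 s A B), integral_ker hA hB]

lemma enorm_cut_le (s A B : ℝ) {S : Set E2} (hS : MeasurableSet S) (x : E2) :
    ‖cut s A B S x‖ₑ ≤ ∫⁻ y in S, ‖ker 0 s A B (x - y)‖ₑ := by
  refine (enorm_cnv_le _ _ x).trans (le_of_eq ?_)
  rw [cv, ← lintegral_indicator hS]
  congr 1; ext y; by_cases hy : y ∈ S <;> simp [hy]

lemma lintegral_wt_sub_le {s A B : ℝ} (hA : 0 < A) (hB : 0 < B) {N : ℕ} (hN : 3 ≤ N) (x : E2) :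
    ∫⁻ y, wt s A B N (x - y) ≤ wtMass := by
  rw [lintegral_sub_left_eq_self (μ := volume) (wt s A B N) x]
  exact lintegral_wt_le hA hB hN

/-- Main tool for estimating products with `cut`. -/
lemma exists_mul_cut_le (N : ℕ) : ∃ C : ℝ≥0, ∀ (s A B : ℝ), 0 < A → 0 < B → ∀ S : Set E2,
    MeasurableSet S → ∀ (x : E2) (v w : ℝ≥0∞),
    (∀ y ∈ S, v ≤ ENNReal.ofReal (rho s A B (x - y)) ^ N * w) →
    v * ‖cut s A B S x‖ₑ ≤ C * w := by
  obtain ⟨C, hC⟩ := exists_ker_le (3 + N)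
  refine ⟨C * wtMass.toNNReal, fun s A B hA hB S hS x v w h => ?_⟩
  calc v * ‖cut s A B S x‖ₑ ≤ v * ∫⁻ y in S, ‖ker 0 s A B (x - y)‖ₑ := by
        gcongr; exact enorm_cut_le s A B hS x
    _ = ∫⁻ y in S, v * ‖ker 0 s A B (x - y)‖ₑ := by
        rw [lintegral_const_mul]
        exact ((continuous_ker 0 s A B).measurable.comp (measurable_const.sub measurable_id)).enorm
    _ ≤ ∫⁻ y in S, C * w * wt s A B 3 (x - y) := by
        refine setLIntegral_mono' hS fun y hy => ?_
        calc v * ‖ker 0 s A B (x - y)‖ₑ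
            ≤ (ENNReal.ofReal (rho s A B (x - y)) ^ N * w) * (C * wt s A B (3 + N) (x - y)) :=
              mul_le_mul' (h y hy) (hC _ _ _ _ hA hB _)
          _ = C * w * (ENNReal.ofReal (rho s A B (x - y)) ^ N * wt s A B (3 + N) (x - y)) := by ring
          _ = _ := by rw [rho_pow_mul_wt]
    _ ≤ ∫⁻ y, C * w * wt s A B 3 (x - y) := setLIntegral_le_lintegral _ _
    _ = C * w * ∫⁻ y, wt s A B 3 (x - y) := by
        rw [lintegral_const_mul]
        exact (measurable_wt s A B 3).comp (measurable_const.sub measurable_id)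
    _ ≤ C * w * wtMass := by gcongr; exact lintegral_wt_sub_le hA hB le_rfl x
    _ = _ := by
      rw [ENNReal.coe_mul, ENNReal.coe_toNNReal wtMass_lt_top.ne]; ring

lemma exists_cut_le : ∃ C : ℝ≥0, ∀ (s A B : ℝ), 0 < A → 0 < B → ∀ S : Set E2,
    MeasurableSet S → ∀ x : E2, ‖cut s A B S x‖ₑ ≤ C := by
  obtain ⟨C, hC⟩ := exists_mul_cut_le 0
  exact ⟨C, fun s A B hA hB S hS x => by simpa using hC s A B hA hB S hS x 1 1 (by simp)⟩

lemma lintegral_cv_wt_le {s A B : ℝ} (hA : 0 < A) (hB : 0 < B) {N : ℕ} (hN : 3 ≤ N)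
    {g : E2 → ℝ≥0∞} (hg : Measurable g) :
    ∫⁻ x, cv (wt s A B N) g x ≤ wtMass * ∫⁻ x, g x := by
  rw [lintegral_cv (measurable_wt _ _ _ _) hg]
  gcongr
  exact lintegral_wt_le hA hB hN

lemma exists_lintegral_mul_cut_le (N : ℕ) : ∃ C : ℝ≥0, ∀ (s A B : ℝ), 0 < A →
    0 < B → ∀ S : Set E2, MeasurableSet S → ∀ g : E2 → ℝ≥0∞, Measurable g →
    ∫⁻ x, g x * ‖cut s A B S x‖ₑ ^ 2 ≤ C * ∫⁻ y in S, cv (wt s A B N) g y := by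
  obtain ⟨C, hC⟩ := exists_cut_le
  obtain ⟨C', hC'⟩ := exists_ker_le N
  refine ⟨C * C', fun s A B hA hB S hS g hg => ?_⟩
  have hw := measurable_wt s A B N
  calc ∫⁻ x, g x * ‖cut s A B S x‖ₑ ^ 2
      ≤ ∫⁻ x, C * C' * ∫⁻ y in S, wt s A B N (x - y) * g x := by
        refine lintegral_mono fun x => ?_
        calc g x * ‖cut s A B S x‖ₑ ^ 2
            ≤ g x * (C * ∫⁻ y in S, ‖ker 0 s A B (x - y)‖ₑ) := by
              rw [sq]; gcongr
              · exact hC s A B hA hB S hS x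
              · exact enorm_cut_le s A B hS x
          _ ≤ g x * (C * ∫⁻ y in S, C' * wt s A B N (x - y)) := by
              gcongr; exact hC' _ _ _ _ hA hB _
          _ = C * C' * ∫⁻ y in S, wt s A B N (x - y) * g x := by
              rw [lintegral_const_mul' _ _ (by simp), lintegral_mul_const]
              · ring
              · exact hw.comp (measurable_const.sub measurable_id)
    _ = C * C' * ∫⁻ x, ∫⁻ y in S, wt s A B N (x - y) * g x := by
        rw [lintegral_const_mul' _ _ (ENNReal.mul_ne_top (by simp) (by simp))]
    _ = C * C' * ∫⁻ y in S, ∫⁻ x, wt s A B N (x - y) * g x := by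
        rw [lintegral_lintegral_swap]
        exact ((hw.comp (measurable_fst.sub measurable_snd)).mul
          (hg.comp measurable_fst)).aemeasurable
    _ = _ := by
        rw [ENNReal.coe_mul]
        congr 2; ext y
        unfold cv
        congr 1; ext x
        rw [← wt_neg, neg_sub]

lemma exists_cutoff {a : ℝ} (ha : 1 ≤ a) {N : ℕ} (hN : 3 ≤ N) :
    ∃ C : ℝ≥0, ∀ (P : E2) (s A B : ℝ), 0 < A → 0 < B → ∀ U : E2 → ℂ,
      BL (box P s (a * A) (a * B)) U → ∀ S : Set E2, MeasurableSet S →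
      (∀ l : ℝ≥0∞, (∀ y ∈ S, cv (wt s A B N) (fun y => ‖U y‖ₑ ^ 2) y ≤ l ^ 2) →
        ∀ x, ‖U x * cut s A B S x‖ₑ ≤ C * l) ∧
      (∀ l : ℝ≥0∞, (∀ y ∈ S, l ^ 2 ≤ cv (wt s A B N) (fun y => ‖U y‖ₑ ^ 2) y) →
        ∀ x, l * ‖U x * cut s A B S x‖ₑ ≤ C * cv (wt s A B N) (fun y => ‖U y‖ₑ ^ 2) x) ∧
      (∀ x, ‖U x * cut s A B S x‖ₑ ≤ C * ‖U x‖ₑ) ∧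
      ∫⁻ x, ‖U x * cut s A B S x‖ₑ ^ 2 ≤
        C * ∫⁻ y in S, cv (wt s A B N) (fun y => ‖U y‖ₑ ^ 2) y := by
  obtain ⟨C1, h1⟩ := exists_reproducing ha hN
  obtain ⟨C2, h2⟩ := exists_mul_cut_le N
  obtain ⟨C3, h3⟩ := exists_cut_le
  obtain ⟨C4, h4⟩ := exists_lintegral_mul_cut_le N
  set D : ℝ≥0 := C1 + 1
  have hD : (C1 : ℝ≥0∞) ≤ (D : ℝ≥0∞) ^ 2 := by
    norm_cast
    have : (1 : ℝ≥0) ≤ D := by simp [D]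
    calc C1 ≤ D := by simp [D]
      _ ≤ D ^ 2 := le_self_pow₀ this two_ne_zero
  refine ⟨C2 * D + C3 + C4, fun P s A B hA hB U hU S hS => ?_⟩
  set G := cv (wt s A B N) (fun y => ‖U y‖ₑ ^ 2) with hG
  have hr : ∀ x, 1 ≤ ENNReal.ofReal (rho s A B x) ^ N := fun x => by
    refine one_le_pow₀ ?_
    rw [ENNReal.one_le_ofReal]; exact one_le_rho _ _ _ _
  have hsq : ∀ {u v : ℝ≥0∞}, u ^ 2 ≤ v ^ 2 → u ≤ v := fun h =>
    (ENNReal.pow_le_pow_left_iff two_ne_zero).1 h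
  have c1 : ((C2 * D : ℝ≥0) : ℝ≥0∞) ≤ (C2 * D + C3 + C4 : ℝ≥0) := by
    norm_cast; rw [add_assoc]; exact le_self_add
  refine ⟨fun l hl x => ?_, fun l hl x => ?_, fun x => ?_, ?_⟩
  · rw [enorm_mul]
    refine (h2 s A B hA hB S hS x ‖U x‖ₑ (D * l) fun y hy => hsq ?_).trans ?_
    · have hh := hr (x - y)
      calc ‖U x‖ₑ ^ 2 ≤ C1 * G x := h1 P s A B hA hB U hU x
        _ ≤ D ^ 2 * (ENNReal.ofReal (rho s A B (x - y)) ^ N * l ^ 2) := by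
            gcongr
            refine (cv_wt_le hA hB N _ x y).trans ?_
            gcongr; exact hl y hy
        _ ≤ D ^ 2 * ((ENNReal.ofReal (rho s A B (x - y)) ^ N) ^ 2 * l ^ 2) := by
            exact mul_le_mul_right (mul_le_mul_left (le_self_pow₀ hh two_ne_zero) _) _
        _ = _ := by ring
    · rw [← mul_assoc, ← ENNReal.coe_mul]
      gcongr
  · rw [enorm_mul, ← mul_assoc]
    refine (h2 s A B hA hB S hS x (l * ‖U x‖ₑ) (D * G x) fun y hy => hsq ?_).trans ?_
    · have hh := hr (x - y)
      calc (l * ‖U x‖ₑ) ^ 2 = l ^ 2 * ‖U x‖ₑ ^ 2 := mul_pow _ _ _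
        _ ≤ (ENNReal.ofReal (rho s A B (x - y)) ^ N * G x) * (D ^ 2 * G x) := by
            gcongr
            · refine (hl y hy).trans ?_
              refine (cv_wt_le hA hB N _ y x).trans ?_
              rw [← rho_neg, neg_sub]
            · exact (h1 P s A B hA hB U hU x).trans (by gcongr)
        _ ≤ ((ENNReal.ofReal (rho s A B (x - y)) ^ N) ^ 2 * G x) * (D ^ 2 * G x) := by
            exact mul_le_mul_left (mul_le_mul_left (le_self_pow₀ hh two_ne_zero) _) _
        _ = _ := by ring
    · rw [← mul_assoc, ← ENNReal.coe_mul]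
      gcongr
  · rw [enorm_mul, mul_comm]
    refine mul_le_mul_left ((h3 s A B hA hB S hS x).trans ?_) _
    norm_cast
    rw [add_right_comm]; exact le_add_self
  · simp only [enorm_mul, mul_pow]
    refine (h4 s A B hA hB S hS _ (hU.continuous.measurable.enorm.pow_const 2)).trans ?_
    gcongr
    exact le_add_self

/-- The kernel is bounded below near the origin. -/
lemma exists_le_ker : ∃ η : ℝ, 0 < η ∧ ∃ c : ℝ≥0, 0 < c ∧ ∀ (s A B : ℝ), 0 < A → 0 < B →
    ∀ x, rho s A B x ≤ 1 + η → c * ENNReal.ofReal (A * B) ≤ ‖ker 0 s A B x‖ₑ := by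
  have h0 : phi0 0 ≠ 0 := by
    have : phi0 0 = ∫ x, (bumpE2 x : ℂ) := by
      rw [phi0, SchwartzMap.fourierInv_coe, Real.fourierInv_eq]
      simp [bumpS_apply]
    have h1 : ∫ x, (bumpE2 x : ℂ) = ((∫ x, bumpE2 x : ℝ) : ℂ) := integral_ofReal
    rw [this, h1]
    exact_mod_cast (bumpE2.integral_pos (μ := volume)).ne'
  have hc : ∀ᶠ x in nhds (0 : E2), ‖phi0 0‖ / 2 < ‖phi0 x‖ :=
    phi0.continuous.norm.continuousAt.eventually (lt_mem_nhds (half_lt_self (norm_pos_iff.2 h0)))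
  obtain ⟨η, hη, h⟩ := Metric.eventually_nhds_iff.1 hc
  refine ⟨η / 2, by positivity, ‖phi0 0‖₊ / 2, by simpa using h0, fun s A B hA hB x hx => ?_⟩
  have hd : dist (shear s A B x) 0 < η := by
    rw [dist_zero_right]
    refine (norm_le_abs_add_abs _).trans_lt ?_
    rw [shear_zero, shear_one]
    unfold rho at hx
    linarith
  have := (h hd).le
  rw [← ofReal_norm, ker, norm_mul, Circle.norm_coe, one_mul, norm_mul, Complex.norm_real,
    Real.norm_eq_abs, abs_of_pos (by positivity)]
  have e : ((‖phi0 0‖₊ / 2 : ℝ≥0) : ℝ≥0∞) = ENNReal.ofReal (‖phi0 0‖ / 2) := by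
    rw [← ENNReal.ofReal_coe_nnreal]; simp
  rw [e, ← ENNReal.ofReal_mul (by positivity)]
  refine ENNReal.ofReal_le_ofReal ?_
  nlinarith [mul_pos hA hB]

section

/-- Points `(a i, y i)` on a convex curve with tangent slopes `s i`, which are separated by
`K ^ (-m - 1)` and have quantitatively increasing slopes. -/
structure Conf {ι : Type} (a y s : ι → ℝ) (K m M : ℕ) (δ : ℝ) : Prop where
  two_le : 2 ≤ K
  m_le : m ≤ M
  delta_pos : 0 < δ
  delta_le : δ ≤ 1
  le_delta : 1 ≤ δ * (K : ℝ) ^ M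
  a_nonneg : ∀ i, 0 ≤ a i
  a_lt : ∀ i, a i < 1
  s_nonneg : ∀ i, 0 ≤ s i
  s_le : ∀ i, s i ≤ 1
  low : ∀ i j, a i ≤ a j → s i * (a j - a i) ≤ y j - y i
  up : ∀ i j, a i ≤ a j → y j - y i ≤ s j * (a j - a i)
  mono : ∀ i j, a i ≤ a j → s i ≤ s j
  sep : ∀ i j, i ≠ j → 1 < |a i - a j| * (K : ℝ) ^ (m + 1)
  three : ∀ i j k, a i < a j → a j < a k → δ * (K : ℝ) ^ m ≤ s k - s i

namespace Conf
variable {ι : Type} {a y s : ι → ℝ} {K m M : ℕ} {δ : ℝ}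

lemma comp (h : Conf a y s K m M δ) {ι' : Type} {f : ι' → ι} (hf : Function.Injective f) :
    Conf (a ∘ f) (y ∘ f) (s ∘ f) K m M δ where
  two_le := h.two_le
  m_le := h.m_le
  delta_pos := h.delta_pos
  delta_le := h.delta_le
  le_delta := h.le_delta
  a_nonneg _ := h.a_nonneg _
  a_lt _ := h.a_lt _
  s_nonneg _ := h.s_nonneg _
  s_le _ := h.s_le _
  low _ _ := h.low _ _
  up _ _ := h.up _ _
  mono _ _ := h.mono _ _
  sep _ _ hij := h.sep _ _ (hf.ne hij)
  three _ _ _ := h.three _ _ _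

lemma K_pos (h : Conf a y s K m M δ) : (0 : ℝ) < K := by
  have := h.two_le; positivity

lemma injective (h : Conf a y s K m M δ) : Function.Injective a := fun i j hij => by
  by_contra hne
  have := h.sep i j hne
  simp [hij] at this
  linarith

/-- The chord slope between two points lies between the tangent slopes. -/
lemma exists_slope (h : Conf a y s K m M δ) (i j : ι) : ∃ σ, y j - y i = σ * (a j - a i) ∧
    (∃ k, s k ≤ σ ∧ (k = i ∨ k = j)) ∧ (∃ k, σ ≤ s k ∧ (k = i ∨ k = j)) := by
  rcases lt_trichotomy (a i) (a j) with hij | hij | hij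
  · have h0 : 0 < a j - a i := by linarith
    refine ⟨(y j - y i) / (a j - a i), by field_simp, ⟨i, ?_, .inl rfl⟩, ⟨j, ?_, .inr rfl⟩⟩
    · rw [le_div_iff₀ h0]; exact h.low i j hij.le
    · rw [div_le_iff₀ h0]; exact h.up i j hij.le
  · have := h.injective hij
    subst this
    exact ⟨s i, by simp, ⟨i, le_rfl, .inl rfl⟩, ⟨i, le_rfl, .inl rfl⟩⟩
  · have h0 : 0 < a i - a j := by linarith
    have h1 : a j - a i ≠ 0 := by linarith
    refine ⟨(y i - y j) / (a i - a j), ?_, ⟨j, ?_, .inr rfl⟩, ⟨i, ?_, .inl rfl⟩⟩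
    · rw [div_mul_eq_mul_div, eq_div_iff h0.ne']; ring
    · rw [le_div_iff₀ h0]; exact h.low j i hij.le
    · rw [div_le_iff₀ h0]; exact h.up j i hij.le

end Conf

/-- The length scale `K ^ (t - m)`. -/
def scl (K m t : ℕ) : ℝ := (K : ℝ) ^ t / (K : ℝ) ^ m

lemma scl_pos {K : ℕ} (hK : 2 ≤ K) (m t : ℕ) : 0 < scl K m t := by unfold scl; positivity

lemma scl_succ (K m t : ℕ) : scl K m (t + 1) = scl K m t * K := by unfold scl; ring

lemma scl_self {K : ℕ} (hK : 2 ≤ K) (m : ℕ) : scl K m m = 1 := by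
  unfold scl; rw [div_self]; positivity

/-- A choice of leftmost representatives `r` for the partition into groups and intervals of
length `A`, together with the slope oscillations `Δ`. -/
structure Pieces {ι : Type} (a s : ι → ℝ) (g : ι → Bool) (A : ℝ) (r : ι → ι) (Δ : ι → ℝ) :
    Prop where
  g_rep : ∀ i, g (r i) = g i
  floor_rep : ∀ i, ⌊a (r i) / A⌋₊ = ⌊a i / A⌋₊
  rep_le : ∀ i, a (r i) ≤ a i
  rep_eq : ∀ i j, g i = g j → ⌊a i / A⌋₊ = ⌊a j / A⌋₊ → r i = r j
  s_le : ∀ i, s i ≤ s (r i) + Δ (r i)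
  top : ∀ i, ∃ k, r k = r i ∧ s k = s (r i) + Δ (r i)
  nonneg : ∀ i, 0 ≤ Δ i

lemma exists_pieces {ι : Type} [Finite ι] (a s : ι → ℝ) (g : ι → Bool) (A : ℝ) :
    ∃ r Δ, Pieces a s g A r Δ := by
  classical
  have := Fintype.ofFinite ι
  let c : ι → Bool × ℕ := fun i => (g i, ⌊a i / A⌋₊)
  have h1 : ∀ b : Bool × ℕ, ∃ o : Option ι, ∀ i, c i = b →
      ∃ j, o = some j ∧ c j = b ∧ ∀ k, c k = b → a j ≤ a k := fun b => by
    by_cases h : ∃ i, c i = b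
    · obtain ⟨i, hi⟩ := h
      obtain ⟨j, hj, hj'⟩ := (Finset.univ.filter fun k => c k = b).exists_min_image a
        ⟨i, by simpa using hi⟩
      exact ⟨some j, fun _ _ => ⟨j, rfl, by simpa using hj, fun k hk => hj' k (by simpa using hk)⟩⟩
    · exact ⟨none, fun i hi => (h ⟨i, hi⟩).elim⟩
  have h2 : ∀ b : Bool × ℕ, ∃ o : Option ι, ∀ i, c i = b →
      ∃ j, o = some j ∧ c j = b ∧ ∀ k, c k = b → s k ≤ s j := fun b => by
    by_cases h : ∃ i, c i = b
    · obtain ⟨i, hi⟩ := h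
      obtain ⟨j, hj, hj'⟩ := (Finset.univ.filter fun k => c k = b).exists_max_image s
        ⟨i, by simpa using hi⟩
      exact ⟨some j, fun _ _ => ⟨j, rfl, by simpa using hj, fun k hk => hj' k (by simpa using hk)⟩⟩
    · exact ⟨none, fun i hi => (h ⟨i, hi⟩).elim⟩
  choose o ho using h1
  choose p hp using h2
  choose r hr1 hr2 hr3 using fun i => ho (c i) i rfl
  choose q hq1 hq2 hq3 using fun i => hp (c i) i rfl
  have hreq : ∀ i j, c i = c j → r i = r j := fun i j h => by
    have := (hr1 i).symm.trans ((congrArg o h).trans (hr1 j))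
    simpa using this
  have hqeq : ∀ i j, c i = c j → q i = q j := fun i j h => by
    have := (hq1 i).symm.trans ((congrArg p h).trans (hq1 j))
    simpa using this
  have hrr : ∀ i, r (r i) = r i := fun i => hreq _ _ (hr2 i)
  refine ⟨r, fun i => s (q i) - s (r i), fun i => congrArg Prod.fst (hr2 i),
    fun i => congrArg Prod.snd (hr2 i), fun i => hr3 i i rfl,
    fun i j h h' => hreq i j (Prod.ext h h'), fun i => ?_, fun i => ⟨q i, hreq _ _ (hq2 i), ?_⟩,
    fun i => sub_nonneg.2 (hq3 i _ (hr2 i))⟩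
  · rw [hrr, hqeq _ _ (hr2 i)]
    have := hq3 i i rfl
    linarith
  · rw [hrr, hqeq _ _ (hr2 i)]; ring

namespace Pieces
variable {ι : Type} {a y s : ι → ℝ} {K m M : ℕ} {δ A : ℝ} {g : ι → Bool} {r : ι → ι} {Δ : ι → ℝ}

lemma rep_rep (h : Pieces a s g A r Δ) (i : ι) : r (r i) = r i :=
  h.rep_eq _ _ (h.g_rep i) (h.floor_rep i)

lemma Δ_nonneg (h : Pieces a s g A r Δ) {j : ι} (hj : r j = j) : 0 ≤ Δ j := by
  have := h.s_le j
  rw [hj] at this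
  linarith

lemma sub_lt (h : Pieces a s g A r Δ) (hA : 0 < A) (ha : ∀ i, 0 ≤ a i) (i : ι) :
    a i - a (r i) < A := by
  have h1 := Nat.lt_floor_add_one (a i / A)
  have h2 := Nat.floor_le (div_nonneg (ha (r i)) hA.le)
  rw [h.floor_rep] at h2
  have : a i / A - a (r i) / A < 1 := by linarith
  rw [← sub_div, div_lt_one hA] at this
  exact this

end Pieces

/-- Counting through the fibres of `i ↦ ⌊f i / h⌋`. -/
lemma card_le_of_floor {ι : Type} (t : Finset ι) (f : ι → ℝ) {h : ℝ} (hh : 0 < h) (c k : ℕ)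
    (hc : ∀ i ∈ t, ∀ j ∈ t, |f i - f j| ≤ c * h)
    (hk : ∀ b : ℤ, ∀ u ⊆ t, (∀ i ∈ u, ⌊f i / h⌋ = b) → u.card ≤ k) :
    t.card ≤ k * (2 * c + 3) := by
  classical
  rcases t.eq_empty_or_nonempty with rfl | ⟨i₀, hi₀⟩
  · simp
  have := Finset.card_le_mul_card_image_of_maps_to (s := t) (f := fun i => ⌊f i / h⌋)
    (t := Finset.Icc (⌊f i₀ / h⌋ - (c + 1)) (⌊f i₀ / h⌋ + (c + 1))) (fun i hi => ?_) k
    (fun b _ => hk b _ (Finset.filter_subset _ _) fun i hi => (Finset.mem_filter.1 hi).2)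
  · refine this.trans (le_of_eq ?_)
    rw [Int.card_Icc]
    congr 1
    omega
  · have h1 := hc i hi i₀ hi₀
    have h2 : |f i / h - f i₀ / h| ≤ c := by
      rw [← sub_div, abs_div, abs_of_pos hh, div_le_iff₀ hh]; exact h1
    rw [abs_le] at h2
    rw [Finset.mem_Icc]
    constructor
    · rw [Int.le_floor]; push_cast
      have := Int.floor_le (f i₀ / h)
      linarith
    · have h3 := Int.lt_floor_add_one (f i₀ / h)
      have : (⌊f i / h⌋ : ℝ) < ⌊f i₀ / h⌋ + (c + 1) + 1 := by
        have := Int.floor_le (f i / h)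
        linarith
      have : ⌊f i / h⌋ < ⌊f i₀ / h⌋ + (c + 1) + 1 := by exact_mod_cast this
      omega

lemma abs_sub_lt_of_floor_eq {x z h : ℝ} (hh : 0 < h) (e : ⌊x / h⌋ = ⌊z / h⌋) : |x - z| < h := by
  have := Int.abs_sub_lt_one_of_floor_eq_floor e
  rwa [← sub_div, abs_div, abs_of_pos hh, div_lt_one hh] at this

lemma card_le_two_mul_of_bool {ι : Type} (g : ι → Bool) (u : Finset ι) (k : ℕ)
    (h : ∀ b, ∀ v ⊆ u, (∀ i ∈ v, g i = b) → v.card ≤ k) : u.card ≤ k * 2 := by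
  classical
  refine (Finset.card_le_mul_card_image_of_maps_to (s := u) (f := g) (t := Finset.univ)
    (fun i _ => Finset.mem_univ _) k (fun b _ => h b _ (Finset.filter_subset _ _)
      fun i hi => (Finset.mem_filter.1 hi).2)).trans (by simp)

/-- Representatives whose abscissae lie within `c A` of each other are few. -/
lemma Pieces.card_le {ι : Type} {a s : ι → ℝ} {A : ℝ} {g : ι → Bool} {r : ι → ι} {Δ : ι → ℝ}
    (h : Pieces a s g A r Δ) (hA : 0 < A) (t : Finset ι)
    (ht : ∀ i ∈ t, r i = i) (c : ℕ)
    (hc : ∀ i ∈ t, ∀ j ∈ t, |a i - a j| ≤ c * A) : t.card ≤ 2 * (2 * c + 3) := by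
  refine card_le_of_floor t a hA c 2 hc fun b u hu hb => ?_
  refine card_le_two_mul_of_bool g u 1 fun β v hv hβ => Finset.card_le_one.2 fun i hi j hj => ?_
  rw [← ht i (hu (hv hi)), ← ht j (hu (hv hj))]
  refine h.rep_eq i j ((hβ i hi).trans (hβ j hj).symm) ?_
  have e := (hb i (hv hi)).trans (hb j (hv hj)).symm
  rw [← Int.floor_toNat, ← Int.floor_toNat, e]

end

section

/-- The point `(a i, y i)`. -/
def pt {ι : Type} (a y : ι → ℝ) (i : ι) : E2 := !₂[a i, y i]

@[simp] lemma pt_zero {ι : Type} (a y : ι → ℝ) (i : ι) : pt a y i 0 = a i := rfl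
@[simp] lemma pt_one {ι : Type} (a y : ι → ℝ) (i : ι) : pt a y i 1 = y i := rfl

lemma box_subset_box {P P' : E2} {s s' A A' B B' D u v u' v' : ℝ}
    (h0 : |P' 0 - P 0| ≤ u) (h1 : |P' 1 - P 1 - s * (P' 0 - P 0)| ≤ v) (hs : |s' - s| ≤ D)
    (hu : u + A' ≤ u') (hv : v + B' + D * A' ≤ v') (hA : u' ≤ A) (hB : v' ≤ B) :
    box P' s' A' B' ⊆ box P s A B := by
  rintro ξ ⟨a, b⟩
  refine ⟨?_, ?_⟩
  · have : |ξ 0 - P 0| ≤ |ξ 0 - P' 0| + |P' 0 - P 0| := by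
      simpa using abs_add_le (ξ 0 - P' 0) (P' 0 - P 0)
    linarith
  · have e : ξ 1 - P 1 - s * (ξ 0 - P 0) = (ξ 1 - P' 1 - s' * (ξ 0 - P' 0)) +
        ((P' 1 - P 1 - s * (P' 0 - P 0)) + (s' - s) * (ξ 0 - P' 0)) := by ring
    have h2 : |(s' - s) * (ξ 0 - P' 0)| ≤ D * A' := by
      rw [abs_mul]; exact mul_le_mul hs a (abs_nonneg _) ((abs_nonneg _).trans hs)
    rw [e]
    refine (abs_add_le _ _).trans ?_
    have := abs_add_le (P' 1 - P 1 - s * (P' 0 - P 0)) ((s' - s) * (ξ 0 - P' 0))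
    linarith

lemma box_add_box_zero {P : E2} {s A B A' B' : ℝ} :
    box P s A B + box 0 s A' B' ⊆ box P s (A + A') (B + B') := by
  rintro _ ⟨ξ, ⟨a, b⟩, η, ⟨a', b'⟩, rfl⟩
  simp only [PiLp.zero_apply, sub_zero] at a' b'
  refine ⟨?_, ?_⟩
  · have e : (ξ + η) 0 - P 0 = (ξ 0 - P 0) + η 0 := by simp; ring
    show |(ξ + η) 0 - P 0| ≤ _
    rw [e]; exact (abs_add_le _ _).trans (add_le_add a a')
  · have e : (ξ + η) 1 - P 1 - s * ((ξ + η) 0 - P 0) =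
        (ξ 1 - P 1 - s * (ξ 0 - P 0)) + (η 1 - s * η 0) := by simp; ring
    show |(ξ + η) 1 - P 1 - s * ((ξ + η) 0 - P 0)| ≤ _
    rw [e]; exact (abs_add_le _ _).trans (add_le_add b b')

lemma box_add_box {P P' : E2} {s A B A' B' : ℝ} :
    box P s A B + box P' s A' B' ⊆ box (P + P') s (A + A') (B + B') := by
  rintro _ ⟨ξ, ⟨a, b⟩, η, ⟨a', b'⟩, rfl⟩
  refine ⟨?_, ?_⟩
  · have e : (ξ + η) 0 - (P + P') 0 = (ξ 0 - P 0) + (η 0 - P' 0) := by simp; ring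
    show |(ξ + η) 0 - (P + P') 0| ≤ _
    rw [e]; exact (abs_add_le _ _).trans (add_le_add a a')
  · have e : (ξ + η) 1 - (P + P') 1 - s * ((ξ + η) 0 - (P + P') 0) =
        (ξ 1 - P 1 - s * (ξ 0 - P 0)) + (η 1 - P' 1 - s * (η 0 - P' 0)) := by simp; ring
    show |(ξ + η) 1 - (P + P') 1 - s * ((ξ + η) 0 - (P + P') 0)| ≤ _
    rw [e]; exact (abs_add_le _ _).trans (add_le_add b b')

lemma neg_box (P : E2) (s A B : ℝ) : -box P s A B = box (-P) s A B := by
  ext ξ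
  simp only [Set.mem_neg, box, Set.mem_ofPred_eq, PiLp.neg_apply]
  rw [show -ξ 0 - P 0 = -(ξ 0 - -P 0) by ring, abs_neg,
    show -ξ 1 - P 1 - s * (-(ξ 0 - -P 0)) = -(ξ 1 - -P 1 - s * (ξ 0 - -P 0)) by ring, abs_neg]

namespace Pieces
variable {ι : Type} {a y s : ι → ℝ} {K m M : ℕ} {δ A : ℝ} {g : ι → Bool} {r : ι → ι} {Δ : ι → ℝ}

lemma slope_sub (h : Pieces a s g A r Δ) (hc : Conf a y s K m M δ) (i : ι) :
    0 ≤ s i - s (r i) ∧ s i - s (r i) ≤ Δ (r i) := by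
  have := h.s_le i
  have := hc.mono _ _ (h.rep_le i)
  constructor <;> linarith

lemma pt_sub (h : Pieces a s g A r Δ) (hc : Conf a y s K m M δ) (hA : 0 < A) (i : ι) :
    |a i - a (r i)| ≤ A ∧ |y i - y (r i) - s (r i) * (a i - a (r i))| ≤ A * Δ (r i) := by
  have h1 := h.sub_lt hA hc.a_nonneg i
  have h2 := h.rep_le i
  have h3 := hc.low _ _ h2
  have h4 := hc.up _ _ h2
  obtain ⟨h5, h6⟩ := h.slope_sub hc i
  rw [abs_of_nonneg (by linarith), abs_of_nonneg (by linarith)]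
  refine ⟨h1.le, ?_⟩
  nlinarith [mul_le_mul h6 h1.le (by linarith) (h5.trans h6)]

/-- Base inclusion of parallelograms. -/
lemma box_subset_zero (h : Pieces a s g A r Δ) (hc : Conf a y s K m M δ) (hA : 0 < A)
    {c : ℝ} (i : ι) :
    box (pt a y i) (s i) (c * A) (c * δ) ⊆
      box (pt a y (r i)) (s (r i)) ((c + 1) * A) ((c + 1) * (A * Δ (r i) + δ)) := by
  obtain ⟨h1, h2⟩ := h.pt_sub hc hA i
  obtain ⟨h3, h4⟩ := h.slope_sub hc i
  have hδ := hc.delta_pos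
  exact box_subset_box (D := Δ (r i)) h1 h2 (by rwa [abs_of_nonneg h3]) le_rfl le_rfl
    (by linarith) (by linarith)

variable {A' : ℝ} {r' : ι → ι} {Δ' : ι → ℝ}

lemma osc_le (h : Pieces a s g A r Δ) (hc : Conf a y s K m M δ)
    (h' : Pieces a s g A' r' Δ') (hrr : ∀ i, r (r' i) = r i) {j : ι} (hj : r' j = j) :
    Δ' j ≤ Δ (r j) := by
  obtain ⟨k, hk, hk'⟩ := h'.top j
  rw [hj] at hk hk'
  have h1 := h.s_le k
  rw [← hrr k, hk] at h1
  have h2 := hc.mono _ _ (h.rep_le j)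
  linarith

lemma box_subset_succ (h : Pieces a s g A r Δ) (hc : Conf a y s K m M δ) (hA : 0 < A)
    (h' : Pieces a s g A' r' Δ') (hrr : ∀ i, r (r' i) = r i) (hA' : 0 < A') (hAA : 2 * A' ≤ A)
    {c : ℝ} (hc0 : 0 ≤ c) {j : ι} (hj : r' j = j) :
    box (pt a y j) (s j) (c * A') (c * (A' * Δ' j + δ)) ⊆
      box (pt a y (r j)) (s (r j)) ((c + 1) * A) ((c + 1) * (A * Δ (r j) + δ)) := by
  obtain ⟨h1, h2⟩ := h.pt_sub hc hA j
  obtain ⟨h3, h4⟩ := h.slope_sub hc j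
  have hδ := hc.delta_pos
  have h5 := h.osc_le hc h' hrr hj
  have h6 : 0 ≤ Δ (r j) := h3.trans h4
  have h7 : c * A' ≤ c * A := by nlinarith
  have h8 : A' * Δ' j ≤ A' * Δ (r j) := by gcongr
  refine box_subset_box (D := Δ (r j)) h1 h2 (by rwa [abs_of_nonneg h3]) le_rfl le_rfl
    (by linarith) ?_
  nlinarith [mul_le_mul_of_nonneg_left h8 hc0, mul_le_mul_of_nonneg_left hAA (mul_nonneg hc0 h6)]

/-- Overlap of pieces of the same scale: only finitely many contain a given frequency. -/
lemma card_box_le (h : Pieces a s g A r Δ) (hA : 0 < A) {B : ι → ℝ} (c : ℕ) (t : Finset ι)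
    (ht : ∀ i ∈ t, r i = i) (ξ : E2)
    (hξ : ∀ i ∈ t, ξ ∈ box (pt a y i) (s i) (c * A) (B i)) : t.card ≤ 2 * (2 * (2 * c) + 3) := by
  have := h.card_le hA t ht (2 * c) fun i hi j hj => by
    have h1 := (hξ i hi).1
    have h2 := (hξ j hj).1
    rw [pt_zero] at h1 h2
    rw [abs_le] at *
    push_cast
    constructor <;> linarith [h1.1, h1.2, h2.1, h2.2]
  simpa using this

end Pieces

/-- Overlap of the initial parallelograms. -/
lemma Conf.card_box_le {ι : Type} {a y s : ι → ℝ} {K m M : ℕ} {δ : ℝ}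
    (hc : Conf a y s K m M δ) {B : ι → ℝ} (c : ℕ) (t : Finset ι) (ξ : E2)
    (hξ : ∀ i ∈ t, ξ ∈ box (pt a y i) (s i) (c * scl K m 0) (B i)) :
    t.card ≤ (4 * c + 3) * K := by
  have hA := scl_pos hc.two_le m 0
  have hK := hc.K_pos
  have h := card_le_of_floor t a (h := scl K m 0 / K) (by positivity) (2 * c * K) 1
    (fun i hi j hj => ?_) (fun b u hu hb => Finset.card_le_one.2 fun i hi j hj => ?_)
  · refine h.trans ?_
    have := hc.two_le
    nlinarith
  · have h1 := (hξ i hi).1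
    have h2 := (hξ j hj).1
    rw [pt_zero] at h1 h2
    have e : ((2 * c * K : ℕ) : ℝ) * (scl K m 0 / K) = 2 * (c * scl K m 0) := by
      push_cast; field_simp
    rw [e]
    rw [abs_le] at *
    constructor <;> linarith [h1.1, h1.2, h2.1, h2.2]
  · by_contra hne
    have h1 := abs_sub_lt_of_floor_eq (by positivity) ((hb i hi).trans (hb j hj).symm)
    have h2 := hc.sep i j hne
    have e : scl K m 0 / K = 1 / (K : ℝ) ^ (m + 1) := by
      unfold scl; field_simp; ring
    rw [e, lt_div_iff₀ (by positivity)] at h1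
    linarith

end

section

namespace Pieces
variable {ι : Type} {a y s : ι → ℝ} {K m M : ℕ} {δ A : ℝ} {g : ι → Bool} {r : ι → ι} {Δ : ι → ℝ}

lemma osc_le_of_range (h : Pieces a s g A r Δ) {s₀ κ : ℝ} (hs : ∀ i, s₀ ≤ s i ∧ s i ≤ s₀ + κ)
    {j : ι} (hj : r j = j) : Δ j ≤ κ := by
  obtain ⟨k, -, hk⟩ := h.top j
  rw [hj] at hk
  linarith [(hs k).2, (hs j).1]

/-- All parallelograms of one scale sit in parallelograms with a common slope. -/
lemma box_subset_common (h : Pieces a s g A r Δ) (hA : 0 < A) {s₀ κ : ℝ}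
    (hs : ∀ i, s₀ ≤ s i ∧ s i ≤ s₀ + κ) (hδ : δ ≤ 2 * (κ * A)) {c : ℝ} (hc : 0 ≤ c) {j : ι}
    (hj : r j = j) :
    box (pt a y j) (s j) (c * A) (c * (A * Δ j + δ)) ⊆
      box (pt a y j) s₀ (c * A) (4 * c * (κ * A)) := by
  have h1 := h.osc_le_of_range hs hj
  have h2 : A * Δ j ≤ A * κ := by gcongr
  refine box_subset_box (D := κ) (u := 0) (v := 0) (by simp) (by simp) ?_ (by simp) le_rfl le_rfl ?_
  · rw [abs_of_nonneg (by linarith [(hs j).1])]; linarith [(hs j).2]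
  · nlinarith [mul_le_mul_of_nonneg_left h2 hc, mul_le_mul_of_nonneg_left hδ hc]

/-- Bilinear overlap: sums of frequencies from slope-separated groups determine both pieces. -/
lemma card_pairs_le (h : Pieces a s g A r Δ) (hc : Conf a y s K m M δ) (hA : 0 < A)
    {s₀ κ b : ℝ} (hκ : 0 < κ) (hs : ∀ i, s₀ ≤ s i ∧ s i ≤ s₀ + κ)
    (ht : ∀ i, g i = true → s i ≤ b) (hf : ∀ i, g i = false → b + κ / K ≤ s i)
    (c : ℕ) (t : Finset (ι × ι)) (htt : ∀ p ∈ t, r p.1 = p.1 ∧ r p.2 = p.2 ∧ g p.1 = true ∧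
      g p.2 = false) (ξ : E2)
    (hξ : ∀ p ∈ t, ξ ∈ box (pt a y p.1 + pt a y p.2) s₀ (c * A) (c * (κ * A))) :
    t.card ≤ (4 * (6 * c) + 6) ^ 2 * K ^ 2 := by
  classical
  have hK := hc.K_pos
  have key : ∀ p ∈ t, ∀ q ∈ t, |a p.1 - a q.1| ≤ ((6 * c * K : ℕ) : ℝ) * A ∧
      |a p.2 - a q.2| ≤ ((6 * c * K : ℕ) : ℝ) * A := by
    intro p hp q hq
    obtain ⟨p0, p1⟩ := hξ p hp
    obtain ⟨q0, q1⟩ := hξ q hq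
    simp only [PiLp.add_apply, pt_zero, pt_one] at p0 p1 q0 q1
    obtain ⟨σ, e1, ⟨k', hk1, -⟩, k, hk, hk'⟩ := hc.exists_slope p.1 q.1
    obtain ⟨τ, e2, ⟨l, hl, hl'⟩, -⟩ := hc.exists_slope p.2 q.2
    have hσ : σ ≤ b := hk.trans (ht k (by
      rcases hk' with rfl | rfl
      · exact (htt p hp).2.2.1
      · exact (htt q hq).2.2.1))
    have hτ : b + κ / K ≤ τ := (hf l (by
      rcases hl' with rfl | rfl
      · exact (htt p hp).2.2.2
      · exact (htt q hq).2.2.2)).trans hl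
    set d := a q.1 - a p.1 with hd
    set e := a q.2 - a p.2 with he
    have hK1 : (1 : ℝ) ≤ K := by exact_mod_cast one_le_two.trans hc.two_le
    have h1 : |d + e| ≤ 2 * c * A := by
      have : d + e = (ξ 0 - (a p.1 + a p.2)) - (ξ 0 - (a q.1 + a q.2)) := by rw [hd, he]; ring
      rw [this]
      refine (abs_sub _ _).trans ?_
      linarith
    have h2 : |(σ - s₀) * d + (τ - s₀) * e| ≤ 2 * c * (κ * A) := by
      have : (σ - s₀) * d + (τ - s₀) * e =
          (ξ 1 - (y p.1 + y p.2) - s₀ * (ξ 0 - (a p.1 + a p.2))) -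
          (ξ 1 - (y q.1 + y q.2) - s₀ * (ξ 0 - (a q.1 + a q.2))) := by
        have : (σ - s₀) * d + (τ - s₀) * e = (y q.1 - y p.1) + (y q.2 - y p.2) - s₀ * (d + e) := by
          rw [e1, e2]; ring
        rw [this, hd, he]; ring
      rw [this]
      refine (abs_sub _ _).trans ?_
      linarith
    have hb : b - s₀ ≤ κ := by
      have := hf p.2 (htt p hp).2.2.2
      have h3 : 0 < κ / K := by positivity
      linarith [(hs p.2).2]
    have hgap : κ / K ≤ τ - σ := by linarith
    have h3 : |(τ - σ) * e| ≤ 2 * c * (κ * A) + |σ - s₀| * (2 * c * A) := by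
      have : (τ - σ) * e = ((σ - s₀) * d + (τ - s₀) * e) - (σ - s₀) * (d + e) := by ring
      rw [this]
      refine (abs_sub _ _).trans (add_le_add h2 ?_)
      rw [abs_mul]
      gcongr
    have h4 : |σ - s₀| ≤ κ := by
      rw [abs_of_nonneg (by linarith [(hs k').1])]; linarith
    have h5 : κ / K * |e| ≤ 4 * c * (κ * A) := by
      rw [abs_mul, abs_of_nonneg (by linarith [div_pos hκ hK])] at h3
      have h6 := mul_le_mul_of_nonneg_right hgap (abs_nonneg e)
      have h7 := mul_le_mul_of_nonneg_right h4 (show 0 ≤ 2 * c * A by positivity)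
      linarith
    have h6 : |e| ≤ 4 * c * K * A := by
      rw [div_mul_eq_mul_div, div_le_iff₀ hK] at h5
      have : κ * |e| ≤ κ * (4 * c * K * A) := by linarith
      exact le_of_mul_le_mul_left this hκ
    have h7 : |d| ≤ 2 * c * A + 4 * c * K * A := by
      have : d = (d + e) - e := by ring
      rw [this]
      exact (abs_sub _ _).trans (add_le_add h1 h6)
    have h8 : 0 ≤ (c : ℝ) * A := by positivity
    have h9 := mul_le_mul_of_nonneg_left hK1 h8
    have h10 : 0 ≤ (c : ℝ) * A * K := by positivity
    push_cast
    rw [abs_sub_comm (a p.1), abs_sub_comm (a p.2)]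
    constructor <;> linarith
  have h1 := h.card_le hA (t.image Prod.fst) (by
      simp only [Finset.mem_image]; rintro i ⟨p, hp, rfl⟩; exact (htt p hp).1) (6 * c * K) (by
      simp only [Finset.mem_image]; rintro i ⟨p, hp, rfl⟩ j ⟨q, hq, rfl⟩; exact (key p hp q hq).1)
  have h2 := h.card_le hA (t.image Prod.snd) (by
      simp only [Finset.mem_image]; rintro i ⟨p, hp, rfl⟩; exact (htt p hp).2.1) (6 * c * K) (by
      simp only [Finset.mem_image]; rintro i ⟨p, hp, rfl⟩ j ⟨q, hq, rfl⟩; exact (key p hp q hq).2)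
  have h3 : t.card ≤ (t.image Prod.fst).card * (t.image Prod.snd).card := by
    rw [← Finset.card_product]
    exact Finset.card_le_card fun p hp => Finset.mem_product.2
      ⟨Finset.mem_image_of_mem _ hp, Finset.mem_image_of_mem _ hp⟩
  have h4 : 2 * (2 * (6 * c * K) + 3) ≤ (4 * (6 * c) + 6) * K := by
    have := hc.two_le
    nlinarith
  calc t.card ≤ _ := h3
    _ ≤ ((4 * (6 * c) + 6) * K) * ((4 * (6 * c) + 6) * K) :=
      Nat.mul_le_mul (h1.trans h4) (h2.trans h4)
    _ = _ := by ring

/-- Overlap of the high frequency parts. -/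
lemma card_high_le (h : Pieces a s g A r Δ) (hc : Conf a y s K m M δ) (hA : 0 < A)
    (hA0 : 1 ≤ A * (K : ℝ) ^ m) (hA1 : A ≤ 1)
    (c : ℕ) (t : Finset ι) (ht : ∀ i ∈ t, r i = i) (ξ : E2)
    (hξ : ∀ i ∈ t, A / K < |ξ 0| ∧ |ξ 1 - s i * ξ 0| ≤ c * (A * Δ i + δ)) :
    t.card ≤ 4 * (12 * c + 3) * (2 * M + 2) * K ^ 2 := by
  classical
  have hK := hc.K_pos
  have hδ := hc.delta_pos
  have hK1 : (1 : ℝ) ≤ K := by exact_mod_cast one_le_two.trans hc.two_le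
  have hK2 : (2 : ℝ) ≤ K := by exact_mod_cast hc.two_le
  set Ee : ι → ℝ := fun i => Δ i + δ / A with hE
  have hΔ : ∀ i ∈ t, 0 ≤ Δ i := fun i hi => h.nonneg i
  have hδA : δ ≤ δ / A := by rw [le_div_iff₀ hA]; nlinarith
  have hElow : ∀ i ∈ t, 1 ≤ Ee i * (K : ℝ) ^ M := fun i hi => by
    refine hc.le_delta.trans ?_
    gcongr
    have := hΔ i hi
    simp only [hE]; linarith
  have hEup : ∀ i ∈ t, Ee i * (K : ℝ) ^ M < (K : ℝ) ^ (2 * M + 2) := fun i hi => by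
    have h1 : Δ i ≤ 1 := h.osc_le_of_range (s₀ := 0) (κ := 1)
      (fun i => ⟨hc.s_nonneg i, by simpa using hc.s_le i⟩) (ht i hi)
    have h2 : δ / A ≤ (K : ℝ) ^ M := by
      rw [div_le_iff₀ hA]
      have : (K : ℝ) ^ m ≤ (K : ℝ) ^ M := pow_le_pow_right₀ hK1 hc.m_le
      calc δ ≤ 1 := hc.delta_le
        _ ≤ A * (K : ℝ) ^ m := hA0
        _ ≤ (K : ℝ) ^ M * A := by rw [mul_comm]; gcongr
    have h3 : 1 ≤ (K : ℝ) ^ M := one_le_pow₀ hK1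
    calc Ee i * (K : ℝ) ^ M ≤ (2 * (K : ℝ) ^ M) * (K : ℝ) ^ M := by
          gcongr; simp only [hE]; linarith
      _ ≤ K * (K : ℝ) ^ M * (K : ℝ) ^ M := by gcongr
      _ < K * (K : ℝ) ^ M * (K : ℝ) ^ M * K := by
          refine lt_mul_of_one_lt_right (by positivity) (by linarith)
      _ = _ := by ring
  -- the `K`-adic size class
  set q : ι → ℕ := fun i => Nat.log K ⌊Ee i * (K : ℝ) ^ M⌋₊ with hq
  have hq1 : ∀ i ∈ t, (K : ℝ) ^ q i ≤ Ee i * (K : ℝ) ^ M := fun i hi => by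
    have h0 : ⌊Ee i * (K : ℝ) ^ M⌋₊ ≠ 0 := by
      rw [← Nat.one_le_iff_ne_zero, Nat.one_le_floor_iff]; exact hElow i hi
    have h1 : K ^ q i ≤ ⌊Ee i * (K : ℝ) ^ M⌋₊ := Nat.pow_log_le_self K h0
    calc (K : ℝ) ^ q i ≤ (⌊Ee i * (K : ℝ) ^ M⌋₊ : ℝ) := by exact_mod_cast h1
      _ ≤ _ := Nat.floor_le (zero_le_one.trans (hElow i hi))
  have hq2 : ∀ i ∈ t, Ee i * (K : ℝ) ^ M < (K : ℝ) ^ (q i + 1) := fun i hi => by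
    have h1 : ⌊Ee i * (K : ℝ) ^ M⌋₊ < K ^ (q i + 1) := Nat.lt_pow_succ_log_self hc.two_le _
    have := (Nat.floor_lt' (by have := hc.two_le; positivity)).1 h1
    exact_mod_cast this
  have hq3 : ∀ i ∈ t, q i < 2 * M + 2 := fun i hi => by
    have := (hq1 i hi).trans_lt (hEup i hi)
    exact (pow_lt_pow_iff_right₀ (by linarith)).1 this
  -- gap for three consecutive pieces
  have gap : ∀ i ∈ t, ∀ j ∈ t, ∀ k ∈ t, g i = g k → a i < a j → a j < a k →
      Ee i / 3 < s k - s i := by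
    intro i hi j hj k hk hg hij hjk
    have h1 := hc.three i j k hij hjk
    have h2 : Δ i ≤ s k - s i := by
      obtain ⟨l, hl, hl'⟩ := h.top i
      rw [ht i hi] at hl hl'
      have hlk : a l ≤ a k := by
        by_contra hlk
        rw [not_le] at hlk
        have h3 : ⌊a l / A⌋₊ = ⌊a i / A⌋₊ := by rw [← h.floor_rep l, hl]
        have h4 : ⌊a i / A⌋₊ ≤ ⌊a k / A⌋₊ := Nat.floor_mono (by gcongr; linarith)
        have h5 : ⌊a k / A⌋₊ ≤ ⌊a l / A⌋₊ := Nat.floor_mono (by gcongr)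
        have h6 := h.rep_eq i k hg (by omega)
        rw [ht i hi, ht k hk] at h6
        subst h6
        exact absurd hij (by linarith)
      have := hc.mono _ _ hlk
      linarith
    have h3 : δ / A ≤ s k - s i := by
      refine le_trans ?_ h1
      rw [div_le_iff₀ hA]
      nlinarith
    have h4 : 0 < δ / A := by positivity
    simp only [hE]; linarith
  refine (Finset.card_le_mul_card_image_of_maps_to (s := t) (f := q)
    (t := Finset.range (2 * M + 2)) (fun i hi => Finset.mem_range.2 (hq3 i hi))
    (4 * (12 * c + 3) * K ^ 2) fun n _ => ?_).trans (by rw [Finset.card_range]; exact le_of_eq (by ring))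
  set u := t.filter fun i => q i = n
  have hut : ∀ i ∈ u, i ∈ t := fun i hi => (Finset.mem_filter.1 hi).1
  have hun : ∀ i ∈ u, q i = n := fun i hi => (Finset.mem_filter.1 hi).2
  set η : ℝ := (K : ℝ) ^ n / (3 * (K : ℝ) ^ M) with hη
  have hη0 : 0 < η := by positivity
  have dist : ∀ i ∈ u, |ξ 1 - s i * ξ 0| ≤ c * (3 * K ^ 2 * η) * |ξ 0| := fun i hi => by
    obtain ⟨h1, h2⟩ := hξ i (hut i hi)
    have h3 := hq2 i (hut i hi)
    rw [hun i hi] at h3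
    have h4 : Ee i ≤ 3 * K * η := by
      rw [← lt_div_iff₀ (show (0 : ℝ) < (K : ℝ) ^ M by positivity)] at h3
      exact h3.le.trans (le_of_eq (by rw [hη, pow_succ]; field_simp))
    have h5 : A * Δ i + δ = A * Ee i := by simp only [hE]; field_simp
    rw [h5] at h2
    have h6 : A ≤ K * |ξ 0| := by
      rw [div_lt_iff₀ hK] at h1; linarith
    calc |ξ 1 - s i * ξ 0| ≤ c * (A * Ee i) := h2
      _ ≤ c * (K * |ξ 0| * (3 * K * η)) := by
          have : 0 ≤ Ee i := by
            have := hΔ i (hut i hi)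
            simp only [hE]; positivity
          gcongr
      _ = _ := by ring
  have hcard := card_le_of_floor u s hη0 (6 * c * K ^ 2) 4 (fun i hi j hj => ?_)
    (fun b v hv hb => ?_)
  · refine hcard.trans ?_
    have : 1 ≤ K ^ 2 := Nat.one_le_pow _ _ (by have := hc.two_le; omega)
    nlinarith
  · have h1 := dist i hi
    have h2 := dist j hj
    have h0 : 0 < |ξ 0| := lt_trans (by positivity) (hξ i (hut i hi)).1
    have h3 : |s i - s j| * |ξ 0| ≤ (2 * (c * (3 * K ^ 2 * η))) * |ξ 0| := by
      rw [← abs_mul]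
      have : (s i - s j) * ξ 0 = (ξ 1 - s j * ξ 0) - (ξ 1 - s i * ξ 0) := by ring
      rw [this]
      refine (abs_sub _ _).trans ?_
      linarith
    have := le_of_mul_le_mul_right h3 h0
    push_cast
    linarith
  · refine card_le_two_mul_of_bool g v 2 fun β w hw hβ => ?_
    by_contra hcon
    rw [not_le] at hcon
    obtain ⟨i, j, k, hi, hj, hk, hij, hjk⟩ : ∃ i j k, i ∈ w ∧ j ∈ w ∧ k ∈ w ∧
        a i < a j ∧ a j < a k := by
      obtain ⟨i, j, k, hi, hj, hk, h1, h2, h3⟩ := Finset.two_lt_card_iff.1 hcon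
      have n1 := hc.injective.ne h1
      have n2 := hc.injective.ne h2
      have n3 := hc.injective.ne h3
      rcases lt_or_gt_of_ne n1 with n1 | n1 <;> rcases lt_or_gt_of_ne n2 with n2 | n2 <;>
        rcases lt_or_gt_of_ne n3 with n3 | n3
      · exact ⟨i, j, k, hi, hj, hk, n1, n3⟩
      · exact ⟨i, k, j, hi, hk, hj, n2, n3⟩
      · linarith
      · exact ⟨k, i, j, hk, hi, hj, n2, n1⟩
      · exact ⟨j, i, k, hj, hi, hk, n1, n2⟩
      · linarith
      · exact ⟨j, k, i, hj, hk, hi, n3, n2⟩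
      · exact ⟨k, j, i, hk, hj, hi, n3, n1⟩
    have mt : ∀ {x}, x ∈ w → x ∈ t := fun hx => hut _ (hv (hw hx))
    have h1 := gap i (mt hi) j (mt hj) k (mt hk) ((hβ i hi).trans (hβ k hk).symm) hij hjk
    have h2 := abs_sub_lt_of_floor_eq hη0 ((hb k (hw hk)).trans (hb i (hw hi)).symm)
    have h3 := hq1 i (mt hi)
    rw [hun i (hv (hw hi))] at h3
    have h4 : η ≤ Ee i / 3 := by
      rw [hη, div_le_iff₀ (by positivity)]
      linarith
    have := le_abs_self (s k - s i)
    linarith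

end Pieces

end

lemma BL.integrable_mul {S : Set E2} {f k : E2 → ℂ} (h : BL S f) (hk : Integrable k) (x : E2) :
    Integrable fun y => k (x - y) * f y := by
  obtain ⟨C, hC⟩ := h.bounded
  exact (hk.comp_sub_left x).mul_bdd h.continuous.aestronglyMeasurable
    (Filter.Eventually.of_forall hC)

lemma cnv_sum {ι : Type*} (t : Finset ι) {S : ι → Set E2} {f : ι → E2 → ℂ} {k : E2 → ℂ}
    (hk : Integrable k) (h : ∀ i ∈ t, BL (S i) (f i)) (x : E2) :
    cnv k (fun y => ∑ i ∈ t, f i y) x = ∑ i ∈ t, cnv k (f i) x := by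
  unfold cnv
  rw [← integral_finsetSum _ fun i hi => (h i hi).integrable_mul hk x]
  simp [Finset.mul_sum]

lemma lintegral_cnv_sq_le {k f : E2 → ℂ} (hk : Measurable k) (hf : Measurable f) :
    ∫⁻ x, ‖cnv k f x‖ₑ ^ 2 ≤ (∫⁻ x, ‖k x‖ₑ) ^ 2 * ∫⁻ x, ‖f x‖ₑ ^ 2 := by
  calc ∫⁻ x, ‖cnv k f x‖ₑ ^ 2
      ≤ ∫⁻ x, (∫⁻ y, ‖k y‖ₑ) * cv (fun y => ‖k y‖ₑ) (fun y => ‖f y‖ₑ ^ 2) x := by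
        refine lintegral_mono fun x => ?_
        refine le_trans ?_ (sq_cv_le hk.enorm hf.enorm x)
        gcongr
        exact enorm_cnv_le k f x
    _ = _ := by
        rw [lintegral_const_mul _ (measurable_cv hk.enorm (hf.enorm.pow_const 2)),
          lintegral_cv hk.enorm (hf.enorm.pow_const 2), sq, mul_assoc]

/-- Slowly varying functions are preserved by averaging with a rapidly decaying weight. -/
lemma cv_wt_slow {s A B A' B' : ℝ} (hA : 0 < A) (hB : 0 < B) (hAA : A ≤ A') (hBB : B ≤ B')
    (N : ℕ) {g : E2 → ℝ≥0∞} {c : ℝ≥0∞} {x : E2}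
    (hg : ∀ w, g w ≤ ENNReal.ofReal (rho s A B (w - x)) ^ N * c) (z : E2) :
    cv (wt s A' B' (3 + N)) g z ≤ wtMass * (ENNReal.ofReal (rho s A B (z - x)) ^ N * c) := by
  calc cv (wt s A' B' (3 + N)) g z
      ≤ ∫⁻ w, wt s A' B' 3 (z - w) * (ENNReal.ofReal (rho s A B (z - x)) ^ N * c) := by
        refine lintegral_mono fun w => ?_
        have h1 : rho s A B (w - x) ≤ rho s A' B' (z - w) * rho s A B (z - x) := by
          have := rho_add_le s A B (w - z) (z - x)
          rw [sub_add_sub_cancel, ← neg_sub z w, rho_neg] at this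
          refine this.trans ?_
          gcongr
          · exact (rho_pos _ _ _ _).le
          · exact rho_mono hA.le hB.le hAA hBB _
        calc wt s A' B' (3 + N) (z - w) * g w
            ≤ wt s A' B' (3 + N) (z - w) *
              ((ENNReal.ofReal (rho s A' B' (z - w)) * ENNReal.ofReal (rho s A B (z - x))) ^ N * c) := by
              gcongr
              refine (hg w).trans ?_
              rw [← ENNReal.ofReal_mul (rho_pos _ _ _ _).le]
              gcongr
          _ = _ := by
              rw [← rho_pow_mul_wt s A' B' 3 N, mul_pow]; ring
    _ ≤ _ := by
        rw [lintegral_mul_const]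
        · gcongr
          exact lintegral_wt_sub_le (hA.trans_le hAA) (hB.trans_le hBB) le_rfl z
        · exact (measurable_wt _ _ _ _).comp (measurable_const.sub measurable_id)

/-- The weight as a complex valued kernel. -/
def wtC (s A B : ℝ) (N : ℕ) (x : E2) : ℂ := ((A * B / rho s A B x ^ N : ℝ) : ℂ)

lemma continuous_wtC (s A B : ℝ) (N : ℕ) : Continuous (wtC s A B N) :=
  Complex.continuous_ofReal.comp (continuous_const.div ((continuous_rho s A B).pow N)
    fun x => (pow_pos (rho_pos s A B x) N).ne')

lemma enorm_wtC {s A B : ℝ} (hA : 0 < A) (hB : 0 < B) (N : ℕ) (x : E2) :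
    ‖wtC s A B N x‖ₑ = wt s A B N x := by
  have := rho_pos s A B x
  rw [wtC, wt, ← ofReal_norm, Complex.norm_real, Real.norm_of_nonneg (by positivity)]

lemma integrable_wtC {s A B : ℝ} (hA : 0 < A) (hB : 0 < B) {N : ℕ} (hN : 3 ≤ N) :
    Integrable (wtC s A B N) := by
  refine ⟨(continuous_wtC s A B N).aestronglyMeasurable, ?_⟩
  simp only [HasFiniteIntegral, enorm_wtC hA hB]
  exact (lintegral_wt_le hA hB hN).trans_lt wtMass_lt_top

/-- The square modulus, as a complex valued function. -/
def nsq (f : E2 → ℂ) (x : E2) : ℂ := f x * starRingEnd ℂ (f x)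

lemma enorm_nsq (f : E2 → ℂ) (x : E2) : ‖nsq f x‖ₑ = ‖f x‖ₑ ^ 2 := by
  rw [nsq, enorm_mul, sq, RCLike.enorm_conj]

lemma nsq_eq (f : E2 → ℂ) (x : E2) : nsq f x = ((‖f x‖ ^ 2 : ℝ) : ℂ) := by
  rw [nsq, Complex.mul_conj, Complex.normSq_eq_norm_sq]

lemma BL.nsq {P : E2} {s A B : ℝ} {f : E2 → ℂ} (h : BL (box P s A B) f) :
    BL (box 0 s (2 * A) (2 * B)) (nsq f) := by
  refine (h.mul h.conj).mono ?_
  rw [neg_box]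
  refine box_add_box.trans (le_of_eq ?_)
  rw [add_neg_cancel, two_mul, two_mul]

lemma sum_cv_eq {ι : Type*} (t : Finset ι) {s B : ι → ℝ} {A : ℝ} {N : ℕ} {S : ι → Set E2}
    {U : ι → E2 → ℂ} (hA : 0 < A) (hB : ∀ i, 0 < B i) (hN : 3 ≤ N) (hU : ∀ i, BL (S i) (U i))
    (x : E2) : ∑ i ∈ t, cv (wt (s i) A (B i) N) (fun y => ‖U i y‖ₑ ^ 2) x =
      ‖∑ i ∈ t, cnv (wtC (s i) A (B i) N) (nsq (U i)) x‖ₑ := by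
  have hp : ∀ i y, 0 ≤ A * B i / rho (s i) A (B i) (x - y) ^ N * ‖U i y‖ ^ 2 := fun i y => by
    have := rho_pos (s i) A (B i) (x - y)
    have := hB i
    positivity
  have h1 : ∀ i, cnv (wtC (s i) A (B i) N) (nsq (U i)) x =
      ((∫ y, A * B i / rho (s i) A (B i) (x - y) ^ N * ‖U i y‖ ^ 2 : ℝ) : ℂ) := fun i => by
    rw [cnv, ← integral_complex_ofReal]
    simp only [wtC, nsq_eq]
    push_cast
    rfl
  have h2 : ∀ i, cv (wt (s i) A (B i) N) (fun y => ‖U i y‖ₑ ^ 2) x = ENNReal.ofReal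
      (∫ y, A * B i / rho (s i) A (B i) (x - y) ^ N * ‖U i y‖ ^ 2) := fun i => by
    have hi : Integrable fun y => wtC (s i) A (B i) N (x - y) * nsq (U i) y :=
      ((hU i).mul (hU i).conj).integrable_mul (integrable_wtC hA (hB i) hN) x
    rw [ofReal_integral_eq_lintegral_ofReal _ (Filter.Eventually.of_forall (hp i)), cv]
    · refine lintegral_congr fun y => ?_
      have := rho_pos (s i) A (B i) (x - y)
      have := hB i
      rw [wt, ENNReal.ofReal_mul (by positivity), ENNReal.ofReal_pow (norm_nonneg _),
        ofReal_norm]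
    · have := hi.re
      refine this.congr (Filter.Eventually.of_forall fun y => ?_)
      simp only [wtC, nsq_eq]
      rw [← Complex.ofReal_mul]
      rfl
  simp only [h1, h2]
  rw [← Complex.ofReal_sum, ← ofReal_norm, Complex.norm_real, Real.norm_of_nonneg
    (Finset.sum_nonneg fun i _ => integral_nonneg (hp i)), ENNReal.ofReal_sum_of_nonneg
    fun i _ => integral_nonneg (hp i)]

section

lemma rho_le_mul {s s' A B B' D : ℝ} {k : ℝ} (hA : 0 ≤ A) (hB' : 0 ≤ B') (hs : |s' - s| ≤ D)
    (hk : 1 ≤ k) (hD : A * D + B' ≤ k * B) (x : E2) :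
    rho s' A B' x ≤ k * rho s A B x := by
  unfold rho
  have e : A * (x 0 + s' * x 1) = A * (x 0 + s * x 1) + A * (s' - s) * x 1 := by ring
  have h1 : |A * (s' - s) * x 1| ≤ A * D * |x 1| := by
    rw [abs_mul, abs_mul, abs_of_nonneg hA]; gcongr
  have h2 := abs_add_le (A * (x 0 + s * x 1)) (A * (s' - s) * x 1)
  have h4 : |B * x 1| = |B| * |x 1| := abs_mul _ _
  have h3 : |B' * x 1| = B' * |x 1| := by rw [abs_mul, abs_of_nonneg hB']
  have h5 := mul_le_mul_of_nonneg_right hD (abs_nonneg (x 1))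
  have h6 : k * B * |x 1| ≤ k * (|B| * |x 1|) := by
    rw [mul_assoc]; gcongr; exact le_abs_self B
  have h7 := mul_le_mul_of_nonneg_right hk (abs_nonneg (A * (x 0 + s * x 1)))
  rw [e, h3, h4]
  linarith

namespace Pieces
variable {ι : Type} {a y s : ι → ℝ} {K m M : ℕ} {δ A A' : ℝ} {g : ι → Bool} {r r' : ι → ι}
  {Δ Δ' : ι → ℝ}

lemma width_pos (h : Pieces a s g A r Δ) (hδ : 0 < δ) (hA : 0 < A) (j : ι) :
    0 < A * Δ j + δ := by
  have := h.nonneg j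
  positivity

lemma width_le (h : Pieces a s g A r Δ) (hc : Conf a y s K m M δ)
    (h' : Pieces a s g A' r' Δ') (hrr : ∀ i, r (r' i) = r i) (hA' : 0 < A') (hAA : A' ≤ A)
    {p : ι} (hp : r' p = p) : A' * Δ' p + δ ≤ A * Δ (r p) + δ := by
  have h1 := h.osc_le hc h' hrr hp
  have h2 := h.Δ_nonneg (h.rep_rep p)
  have := mul_le_mul hAA h1 (h'.Δ_nonneg hp) (hA'.le.trans hAA)
  linarith

lemma rho_le (h : Pieces a s g A r Δ) (hc : Conf a y s K m M δ)
    (h' : Pieces a s g A' r' Δ') (hrr : ∀ i, r (r' i) = r i) (hA' : 0 < A') (hAA : A' ≤ A)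
    {p : ι} (hp : r' p = p) (x : E2) :
    rho (s p) A' (A' * Δ' p + δ) x ≤ 2 * rho (s (r p)) A' (A * Δ (r p) + δ) x := by
  obtain ⟨h1, h2⟩ := h.slope_sub hc p
  have h3 := h.width_le hc h' hrr hA' hAA hp
  have h4 := h.Δ_nonneg (h.rep_rep p)
  have h5 := mul_le_mul_of_nonneg_right hAA h4
  have := hc.delta_pos
  exact rho_le_mul hA'.le (h'.width_pos hc.delta_pos hA' p).le ((abs_of_nonneg h1).le.trans h2)
    one_le_two (by linarith) x

end Pieces

/-- The low frequency part of the square function of one scale is controlled by the previous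
scale. -/
lemma exists_low_le (c N b : ℕ) (hb : 1 ≤ b) : ∃ C : ℝ≥0, ∀ {ι : Type} [Fintype ι] [DecidableEq ι]
    {a y s : ι → ℝ}
    {K m M : ℕ} {δ A A' : ℝ} {g : ι → Bool} {r r' : ι → ι} {Δ Δ' : ι → ℝ},
    Conf a y s K m M δ → Pieces a s g A r Δ → Pieces a s g A' r' Δ' →
    (∀ i, r (r' i) = r i) → 0 < A' → A' ≤ A →
    ∀ V : ι → E2 → ℂ, (∀ p, r' p ≠ p → V p = 0) →
    (∀ p, BL (box (pt a y p) (s p) (c * A') (c * (A' * Δ' p + δ))) (V p)) →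
    ∀ G : ι → E2 → ℝ≥0∞, (∀ p x, ‖V p x‖ₑ ^ 2 ≤ G p x) →
    (∀ p, r' p = p → ∀ x z, G p z ≤
      ENNReal.ofReal (rho (s p) A' (A' * Δ' p + δ) (z - x)) ^ N * G p x) →
    ∀ j, r j = j → ∀ x, cv (wt (s j) A (A * Δ j + δ) (3 + N))
      (fun z => ‖cnv (ker 0 (s j) A' (b * (A * Δ j + δ)))
        (nsq fun y => ∑ p with r p = j, V p y) z‖ₑ) x ≤ C * ∑ p with r p = j, G p x := by
  obtain ⟨C, hC⟩ := exists_ker_le (3 + N)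
  set n : ℕ := 2 * (2 * (2 * (4 + 2 * c)) + 3) with hn
  refine ⟨2 * n * (C * 2 ^ N) * wtMass.toNNReal * wtMass.toNNReal, ?_⟩
  intro ι _ _ a y s K m M δ A A' g r r' Δ Δ' hc h h' hrr hA' hAA V hV0 hV G hVG hG j hj x
  classical
  have hA : 0 < A := hA'.trans_le hAA
  have hw := h.width_pos hc.delta_pos hA j
  have hb' : (1 : ℝ) ≤ b := by exact_mod_cast hb
  have hbw : A * Δ j + δ ≤ b * (A * Δ j + δ) := le_mul_of_one_le_left hw.le hb'
  set k := ker 0 (s j) A' (b * (A * Δ j + δ)) with hk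
  have hki : Integrable k := integrable_ker 0 hA' (hw.trans_le hbw)
  set P : Finset ι := Finset.univ.filter fun p => r p = j with hP
  have hmk : Measurable k := (continuous_ker _ _ _ _).measurable
  have hVm : ∀ p, Measurable (V p) := fun p => (hV p).continuous.measurable
  -- pointwise bound through near pairs
  have far : ∀ p q z, ¬ (|a p - a q| ≤ ((4 + 2 * c : ℕ) : ℝ) * A') →
      cnv k (fun y => V p y * starRingEnd ℂ (V q y)) z = 0 := fun p q z hpq => by
    refine BL.conv_eq_zero hki ((hV p).mul (hV q).conj) (fun ξ hξ => ?_) z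
    by_contra hne
    have h1 := (mem_box_of_fourier_ker_ne_zero hA' (hw.trans_le hbw) hne).1
    obtain ⟨u, hu, v, hv, rfl⟩ := hξ
    rw [neg_box] at hv
    have h2 := hu.1
    have h3 := hv.1
    simp only [PiLp.add_apply, PiLp.neg_apply, PiLp.zero_apply, pt_zero] at h1 h2 h3
    refine hpq ?_
    push_cast
    rw [abs_le] at *
    constructor <;> linarith
  have near : ∀ p, r' p = p →
      (P.filter fun q => r' q = q ∧ |a p - a q| ≤ ((4 + 2 * c : ℕ) : ℝ) * A').card ≤ n :=
    fun p hp => by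
      refine h'.card_le hA' _ (fun i hi => (Finset.mem_filter.1 hi).2.1) (2 * (4 + 2 * c))
        fun i hi i' hi' => ?_
      · have h1 := (Finset.mem_filter.1 hi).2.2
        have h2 := (Finset.mem_filter.1 hi').2.2
        push_cast at h1 h2 ⊢
        rw [abs_le] at *
        constructor <;> linarith
  have pw : ∀ z, ‖cnv k (nsq fun y => ∑ p ∈ P, V p y) z‖ₑ ≤
      2 * n * ∑ p ∈ P, cv (fun y => ‖k y‖ₑ) (fun y => ‖V p y‖ₑ ^ 2) z := fun z => by
    set T : ι → ℝ≥0∞ := fun p => cv (fun y => ‖k y‖ₑ) (fun y => ‖V p y‖ₑ ^ 2) z with hT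
    have e1 : (nsq fun y => ∑ p ∈ P, V p y) =
        fun y => ∑ i ∈ P ×ˢ P, V i.1 y * starRingEnd ℂ (V i.2 y) := by
      ext y; rw [nsq, map_sum, Finset.sum_mul_sum, Finset.sum_product]
    rw [e1, cnv_sum (ι := ι × ι) (P ×ˢ P) hki fun i _ => (hV i.1).mul (hV i.2).conj]
    set N2 := (P ×ˢ P).filter fun i => r' i.1 = i.1 ∧ r' i.2 = i.2 ∧
      |a i.1 - a i.2| ≤ ((4 + 2 * c : ℕ) : ℝ) * A' with hN2
    have e2 : ∑ i ∈ P ×ˢ P, cnv k (fun y => V i.1 y * starRingEnd ℂ (V i.2 y)) z =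
        ∑ i ∈ N2, cnv k (fun y => V i.1 y * starRingEnd ℂ (V i.2 y)) z := by
      refine (Finset.sum_subset (Finset.filter_subset _ _) fun i hi hi' => ?_).symm
      by_cases h1 : r' i.1 = i.1
      · by_cases h2 : r' i.2 = i.2
        · exact far _ _ z fun h3 => hi' (Finset.mem_filter.2 ⟨hi, h1, h2, h3⟩)
        · simp [hV0 _ h2, cnv]
      · simp [hV0 _ h1, cnv]
    rw [e2]
    have e3 : ∀ i : ι × ι, ‖cnv k (fun y => V i.1 y * starRingEnd ℂ (V i.2 y)) z‖ₑ ≤ T i.1 + T i.2 :=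
      fun i => by
        refine (enorm_cnv_le _ _ z).trans ?_
        rw [hT]
        simp only [cv]
        rw [← lintegral_add_left (by fun_prop)]
        refine lintegral_mono fun w => ?_
        rw [← mul_add]
        gcongr
        rw [enorm_mul, RCLike.enorm_conj, sq, sq]
        rcases le_total ‖V i.1 w‖ₑ ‖V i.2 w‖ₑ with hle | hle
        · exact le_add_left (by gcongr)
        · exact le_add_right (by gcongr)
    refine (enorm_sum_le _ _).trans ((Finset.sum_le_sum fun i _ => e3 i).trans ?_)
    rw [Finset.sum_add_distrib]
    have f1 : ∑ i ∈ N2, T i.1 ≤ n * ∑ p ∈ P, T p := by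
      rw [← Finset.sum_fiberwise_of_maps_to (s := N2) (t := P) (g := Prod.fst)
        fun i hi => (Finset.mem_product.1 (Finset.mem_filter.1 hi).1).1, Finset.mul_sum]
      refine Finset.sum_le_sum fun p _ => ?_
      rw [Finset.sum_congr rfl fun i hi => by rw [(Finset.mem_filter.1 hi).2], Finset.sum_const,
        nsmul_eq_mul]
      gcongr
      by_cases hp : r' p = p
      · refine le_trans (Finset.card_le_card_of_injOn Prod.snd (fun i hi => ?_) ?_) (near p hp)
        · obtain ⟨h1, rfl⟩ := Finset.mem_filter.1 hi
          obtain ⟨h2, h3, h4, h5⟩ := Finset.mem_filter.1 h1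
          exact Finset.mem_filter.2 ⟨(Finset.mem_product.1 h2).2, h4, h5⟩
        · intro i hi i' hi' hii
          have h1 := (Finset.mem_filter.1 hi).2
          have h2 := (Finset.mem_filter.1 hi').2
          exact Prod.ext (h1.trans h2.symm) hii
      · rw [Finset.filter_eq_empty_iff.2 fun {i} hi (h1 : i.1 = p) =>
          hp (h1 ▸ (Finset.mem_filter.1 hi).2.1)]
        simp
    have f2 : ∑ i ∈ N2, T i.2 ≤ n * ∑ p ∈ P, T p := by
      rw [← Finset.sum_fiberwise_of_maps_to (s := N2) (t := P) (g := Prod.snd)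
        fun i hi => (Finset.mem_product.1 (Finset.mem_filter.1 hi).1).2, Finset.mul_sum]
      refine Finset.sum_le_sum fun p _ => ?_
      rw [Finset.sum_congr rfl fun i hi => by rw [(Finset.mem_filter.1 hi).2], Finset.sum_const,
        nsmul_eq_mul]
      gcongr
      by_cases hp : r' p = p
      · refine le_trans (Finset.card_le_card_of_injOn Prod.fst (fun i hi => ?_) ?_) (near p hp)
        · obtain ⟨h1, rfl⟩ := Finset.mem_filter.1 hi
          obtain ⟨h2, h3, h4, h5⟩ := Finset.mem_filter.1 h1
          exact Finset.mem_filter.2 ⟨(Finset.mem_product.1 h2).1, h3, by rwa [abs_sub_comm]⟩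
        · intro i hi i' hi' hii
          have h1 := (Finset.mem_filter.1 hi).2
          have h2 := (Finset.mem_filter.1 hi').2
          exact Prod.ext hii (h1.trans h2.symm)
      · rw [Finset.filter_eq_empty_iff.2 fun {i} hi (h1 : i.2 = p) =>
          hp (h1 ▸ (Finset.mem_filter.1 hi).2.2.1)]
        simp
    calc _ ≤ n * ∑ p ∈ P, T p + n * ∑ p ∈ P, T p := add_le_add f1 f2
      _ = _ := by ring
  -- each term varies slowly
  have slow : ∀ p ∈ P, ∀ z, cv (fun y => ‖k y‖ₑ) (fun y => ‖V p y‖ₑ ^ 2) z ≤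
      C * (wtMass * (ENNReal.ofReal (rho (s j) A' (A * Δ j + δ) (z - x)) ^ N *
        (2 ^ N * G p x))) := fun p hp z => by
    by_cases hp' : r' p = p
    · refine (cv_mono (fun y => hC 0 (s j) A' _ hA' (hw.trans_le hbw) y) (hVG p) z).trans ?_
      rw [cv_const_mul (by simp)]
      gcongr
      refine cv_wt_slow hA' hw le_rfl hbw N (fun w => ?_) z
      refine (hG p hp' x w).trans ?_
      rw [← mul_assoc, ← mul_pow]
      gcongr
      have := h.rho_le hc h' hrr hA' hAA hp' (w - x)
      rw [(Finset.mem_filter.1 hp).2] at this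
      calc ENNReal.ofReal (rho (s p) A' (A' * Δ' p + δ) (w - x))
          ≤ ENNReal.ofReal (2 * rho (s j) A' (A * Δ j + δ) (w - x)) :=
            ENNReal.ofReal_le_ofReal this
        _ = _ := by rw [ENNReal.ofReal_mul (by norm_num), ENNReal.ofReal_ofNat, mul_comm]
    · simp [hV0 _ hp', cv]
  calc _ ≤ cv (wt (s j) A (A * Δ j + δ) (3 + N)) (fun z => 2 * n * ∑ p ∈ P, C * (wtMass *
        (ENNReal.ofReal (rho (s j) A' (A * Δ j + δ) (z - x)) ^ N * (2 ^ N * G p x)))) x := by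
        refine cv_mono (fun _ => le_rfl) (fun z => (pw z).trans ?_) x
        gcongr with p hp
        exact slow p hp z
    _ ≤ wtMass * (ENNReal.ofReal (rho (s j) A' (A * Δ j + δ) (x - x)) ^ N *
        (2 * n * ∑ p ∈ P, C * (wtMass * (2 ^ N * G p x)))) := by
        refine cv_wt_slow hA' hw hAA le_rfl N (fun w => le_of_eq ?_) x
        simp only [Finset.mul_sum]
        refine Finset.sum_congr rfl fun p _ => by ring
    _ = _ := by
        have : rho (s j) A' (A * Δ j + δ) (x - x) = 1 := by simp [rho]
        rw [this]
        push_cast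
        rw [ENNReal.coe_toNNReal wtMass_lt_top.ne]
        simp only [Finset.mul_sum, ENNReal.ofReal_one, one_pow, one_mul]
        refine Finset.sum_congr rfl fun p _ => by ring

end

lemma measurable_cnv {k f : E2 → ℂ} (hk : Integrable k) {S : Set E2} (h : BL S f) :
    Measurable (cnv k f) := (h.conv hk).continuous.measurable

lemma exists_level_le (c N : ℕ) : ∃ C : ℝ≥0, ∀ {ι : Type} [Fintype ι] [DecidableEq ι]
    {a y s : ι → ℝ} {K m M : ℕ} {δ A s₀ κ : ℝ} {g : ι → Bool} {r r' : ι → ι} {Δ Δ' : ι → ℝ},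
    Conf a y s K m M δ → Pieces a s g A r Δ → Pieces a s g (A / K) r' Δ' →
    (∀ i, r (r' i) = r i) → 0 < A → 1 ≤ A * (K : ℝ) ^ m → A ≤ 1 →
    (∀ i, s₀ ≤ s i ∧ s i ≤ s₀ + κ) → δ ≤ 2 * (κ * A) →
    ∀ V : ι → E2 → ℂ, (∀ p, r' p ≠ p → V p = 0) →
    (∀ p, BL (box (pt a y p) (s p) (c * (A / K)) (c * (A / K * Δ' p + δ))) (V p)) →
    ∀ G : ι → E2 → ℝ≥0∞, (∀ p x, ‖V p x‖ₑ ^ 2 ≤ G p x) →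
    (∀ p, r' p = p → ∀ x z, G p z ≤
      ENNReal.ofReal (rho (s p) (A / K) (A / K * Δ' p + δ) (z - x)) ^ N * G p x) →
    ∃ h : E2 → ℂ, BL (box 0 s₀ (2 * (c + 1) * A) (8 * (c + 1) * (κ * A))) h ∧
      (∀ x, ∑ j, cv (wt (s j) A (A * Δ j + δ) (3 + N))
        (fun y => ‖∑ p with r p = j, V p y‖ₑ ^ 2) x ≤ C * ∑ p, G p x + ‖h x‖ₑ) ∧
      ∫⁻ x, ‖h x‖ₑ ^ 2 ≤
        C * ((2 * M + 2) * K ^ 2) * ∑ j, ∫⁻ x, ‖∑ p with r p = j, V p x‖ₑ ^ 4 := by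
  obtain ⟨C₁, hC₁⟩ := exists_low_le c N (2 * (c + 1)) (by omega)
  obtain ⟨C₂, hC₂⟩ := exists_ker_le 3
  refine ⟨max C₁ (4 * (12 * (2 * (c + 1)) + 3) * (wtMass.toNNReal ^ 2 *
    (2 + 2 * (C₂ * wtMass.toNNReal) ^ 2))), ?_⟩
  intro ι _ _ a y s K m M δ A s₀ κ g r r' Δ Δ' hc h h' hrr hA hA0 hA1 hs hδ V hV0 hV G hVG hG
  classical
  have hK := hc.K_pos
  have hK2 : (2 : ℝ) ≤ K := by exact_mod_cast hc.two_le
  have hA' : 0 < A / K := by positivity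
  have hAA : 2 * (A / K) ≤ A := by
    rw [← mul_div_assoc, div_le_iff₀ hK]; nlinarith
  have hw := h.width_pos hc.delta_pos hA
  have hbw : ∀ j, 0 < ((2 * (c + 1) : ℕ) : ℝ) * (A * Δ j + δ) := fun j =>
    mul_pos (by positivity) (hw j)
  set U : ι → E2 → ℂ := fun j x => ∑ p with r p = j, V p x with hUdef
  have hU0 : ∀ j, r j ≠ j → ∀ x, U j x = 0 := fun j hj x => by
    refine Finset.sum_eq_zero fun p hp => ?_
    exact (hj (by rw [← (Finset.mem_filter.1 hp).2, h.rep_rep])).elim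
  have hU : ∀ j, BL (box (pt a y j) (s j) ((c + 1) * A) ((c + 1) * (A * Δ j + δ))) (U j) :=
    fun j => by
      refine BL.sum _ fun p hp => ?_
      obtain rfl := (Finset.mem_filter.1 hp).2
      by_cases hp' : r' p = p
      · exact (hV p).mono (h.box_subset_succ hc hA h' hrr hA' hAA (by positivity) hp')
      · rw [hV0 p hp']; exact BL.zero
  have hn := fun j => (hU j).nsq
  set W : ι → E2 → ℂ := fun j => wtC (s j) A (A * Δ j + δ) (3 + N) with hWdef
  have hWi : ∀ j, Integrable (W j) := fun j => integrable_wtC hA (hw j) (by omega)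
  set Φ : ι → E2 → ℂ := fun j => ker 0 (s j) (A / K) ((2 * (c + 1) : ℕ) * (A * Δ j + δ)) with hΦdef
  have hΦi : ∀ j, Integrable (Φ j) := fun j => integrable_ker 0 hA' (hbw j)
  set L : ι → E2 → ℂ := fun j => cnv (W j) (cnv (Φ j) (nsq (U j))) with hLdef
  set f : ι → E2 → ℂ := fun j x => nsq (U j) x - cnv (Φ j) (nsq (U j)) x with hfdef
  have hf := fun j => (hn j).sub_conv (hΦi j)
  set H : ι → E2 → ℂ := fun j => cnv (W j) (f j) with hHdef
  have hH := fun j => (hf j).conv (hWi j)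
  have hsplit : ∀ j x, cnv (W j) (nsq (U j)) x = H j x + L j x := fun j x => by
    change ∫ z, W j (x - z) * nsq (U j) z = (∫ z, W j (x - z) * f j z) +
      ∫ z, W j (x - z) * cnv (Φ j) (nsq (U j)) z
    rw [← integral_add ((hf j).integrable_mul (hWi j) x)
      (((hn j).conv (hΦi j)).integrable_mul (hWi j) x)]
    refine integral_congr_ae (.of_forall fun z => ?_)
    simp only
    ring
  set R : Finset ι := Finset.univ.filter fun j => r j = j with hR
  have hf0 : ∀ j, j ∉ R → ∀ x, f j x = 0 := fun j hj x => by
    have : nsq (U j) = fun _ => 0 := by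
      ext z; simp [nsq, hU0 j (fun e => hj (Finset.mem_filter.2 ⟨Finset.mem_univ _, e⟩)) z]
    simp [hfdef, this, cnv]
  have hH0 : ∀ j, j ∉ R → ∀ x, H j x = 0 := fun j hj x => by
    simp [hHdef, cnv, hf0 j hj]
  refine ⟨fun x => ∑ j ∈ R, H j x, BL.sum _ fun j hj => (hH j).mono ?_, fun x => ?_, ?_⟩
  · have hj : r j = j := (Finset.mem_filter.1 hj).2
    refine (inter_subset_left.trans inter_subset_left).trans ?_
    have h1 := h.osc_le_of_range hs hj
    have h2 : A * Δ j ≤ A * κ := by gcongr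
    refine box_subset_box (u := 0) (v := 0) (D := κ) (by simp) (by simp)
      (abs_le.2 ⟨?_, by linarith [(hs j).2]⟩) le_rfl le_rfl (by linarith) ?_
    · have := (hs j).1
      have := h.nonneg j
      linarith
    · have : ((c : ℝ) + 1) * (A * Δ j + δ) ≤ (c + 1) * (3 * (κ * A)) := by
        gcongr; linarith
      linarith
  · rw [sum_cv_eq Finset.univ hA hw (by omega) hU]
    have e : ∑ j, cnv (wtC (s j) A (A * Δ j + δ) (3 + N)) (nsq (U j)) x =
        ∑ j, L j x + ∑ j ∈ R, H j x := by
      rw [Finset.sum_congr rfl fun j _ => hsplit j x, Finset.sum_add_distrib, add_comm]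
      congr 1
      exact (Finset.sum_subset (Finset.subset_univ _) fun j _ hj => hH0 j hj x).symm
    rw [e]
    refine (enorm_add_le _ _).trans (add_le_add_left ?_ _)
    refine (enorm_sum_le _ _).trans ?_
    rw [← Finset.sum_fiberwise (s := Finset.univ) (g := r) (f := fun p => G p x), Finset.mul_sum]
    refine Finset.sum_le_sum fun j _ => ?_
    by_cases hj : r j = j
    · refine (enorm_cnv_le _ _ x).trans ?_
      simp only [hWdef, enorm_wtC hA (hw j)]
      refine (hC₁ hc h h' hrr hA' (by linarith) V hV0 hV G hVG hG j hj x).trans ?_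
      gcongr
      exact_mod_cast le_max_left _ _
    · have : nsq (U j) = fun _ => 0 := by ext z; simp [nsq, hU0 j hj z]
      simp [hLdef, this, cnv]
  · have hov := BL.lintegral_sum_sq_le R (fun j _ => hH j)
      (4 * (12 * (2 * (c + 1)) + 3) * (2 * M + 2) * K ^ 2) fun ξ t ht hξ => by
        refine h.card_high_le hc hA hA0 hA1 (2 * (c + 1)) t
          (fun i hi => (Finset.mem_filter.1 (ht hi)).2) ξ fun i hi => ?_
        obtain ⟨⟨h1, h2⟩, -⟩ := hξ i hi
        have h3 : |ξ 1 - s i * ξ 0| ≤ ((2 * (c + 1) : ℕ) : ℝ) * (A * Δ i + δ) := by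
          have := h1.2
          simp only [PiLp.zero_apply, sub_zero] at this
          push_cast
          linarith
        refine ⟨?_, h3⟩
        by_contra hle
        refine h2 (fourier_ker_eq_one hA' (hbw i) ⟨?_, ?_⟩)
        · simpa using hle
        · simpa using h3
    refine hov.trans ?_
    have hb : ∀ j, ∫⁻ x, ‖H j x‖ₑ ^ 2 ≤ wtMass ^ 2 * (2 + 2 * (C₂ * wtMass) ^ 2) *
        ∫⁻ x, ‖U j x‖ₑ ^ 4 := fun j => by
      have m1 := (hn j).continuous.measurable
      have m2 := measurable_cnv (hΦi j) (hn j)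
      have hΦm : Measurable (Φ j) := (continuous_ker _ _ _ _).measurable
      have i1 : ∫⁻ x, ‖W j x‖ₑ ≤ wtMass := by
        simp only [hWdef, enorm_wtC hA (hw j)]
        exact lintegral_wt_le hA (hw j) (by omega)
      have i2 : ∫⁻ x, ‖Φ j x‖ₑ ≤ C₂ * wtMass := by
        refine (lintegral_mono fun x => hC₂ 0 (s j) _ _ hA' (hbw j) x).trans ?_
        rw [lintegral_const_mul _ (measurable_wt _ _ _ _)]
        gcongr
        exact lintegral_wt_le hA' (hbw j) le_rfl
      have e4 : ∫⁻ x, ‖nsq (U j) x‖ₑ ^ 2 = ∫⁻ x, ‖U j x‖ₑ ^ 4 :=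
        lintegral_congr fun x => by rw [enorm_nsq, ← pow_mul]
      calc ∫⁻ x, ‖H j x‖ₑ ^ 2 ≤ (∫⁻ x, ‖W j x‖ₑ) ^ 2 * ∫⁻ x, ‖f j x‖ₑ ^ 2 :=
            lintegral_cnv_sq_le (continuous_wtC _ _ _ _).measurable (m1.sub m2)
        _ ≤ wtMass ^ 2 * ∫⁻ x, (2 * ‖nsq (U j) x‖ₑ ^ 2 + 2 * ‖cnv (Φ j) (nsq (U j)) x‖ₑ ^ 2) := by
            gcongr with x
            have := ENNReal.rpow_add_le_mul_rpow_add_rpow ‖nsq (U j) x‖ₑ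
              ‖cnv (Φ j) (nsq (U j)) x‖ₑ (p := 2) (by norm_num)
            norm_num at this
            rw [← mul_add]
            refine le_trans ?_ this
            gcongr
            exact enorm_sub_le
        _ = wtMass ^ 2 * (2 * (∫⁻ x, ‖U j x‖ₑ ^ 4) +
            2 * ∫⁻ x, ‖cnv (Φ j) (nsq (U j)) x‖ₑ ^ 2) := by
            rw [lintegral_add_left (by fun_prop), lintegral_const_mul _ (by fun_prop),
              lintegral_const_mul _ (by fun_prop), e4]
        _ ≤ wtMass ^ 2 * (2 * (∫⁻ x, ‖U j x‖ₑ ^ 4) + 2 * ((C₂ * wtMass) ^ 2 *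
            ∫⁻ x, ‖U j x‖ₑ ^ 4)) := by
            gcongr
            refine (lintegral_cnv_sq_le hΦm m1).trans ?_
            rw [e4]
            gcongr
        _ = _ := by ring
    calc _ ≤ ((4 * (12 * (2 * (c + 1)) + 3) * (2 * M + 2) * K ^ 2 : ℕ) : ℝ≥0∞) *
          ∑ j, wtMass ^ 2 * (2 + 2 * (C₂ * wtMass) ^ 2) * ∫⁻ x, ‖U j x‖ₑ ^ 4 := by
          gcongr
          exact (Finset.sum_le_sum fun j _ => hb j).trans
            (Finset.sum_le_sum_of_subset (Finset.subset_univ _))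
      _ = ((4 * (12 * (2 * (c + 1)) + 3) * (wtMass.toNNReal ^ 2 *
          (2 + 2 * (C₂ * wtMass.toNNReal) ^ 2)) : ℝ≥0) : ℝ≥0∞) * ((2 * M + 2) * K ^ 2) *
          ∑ j, ∫⁻ x, ‖U j x‖ₑ ^ 4 := by
          rw [← Finset.mul_sum]
          push_cast
          rw [ENNReal.coe_toNNReal wtMass_lt_top.ne]
          ring
      _ ≤ _ := by
          gcongr
          exact_mod_cast le_max_right _ _

lemma BL.translate {S : Set E2} {f : E2 → ℂ} (h : BL S f) (x : E2) : BL S fun z => f (z - x) := by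
  obtain ⟨g, hm, ⟨C, hC⟩, hb, hs, rfl⟩ := h
  have hsub : Function.support (fun ξ => Complex.exp (((2 * Real.pi * inner ℝ ξ (-x) : ℝ) : ℂ) * Complex.I) * g ξ) ⊆
      Function.support g := fun ξ hξ h0 => hξ (by simp only [h0, mul_zero])
  refine ⟨fun ξ => Complex.exp (((2 * Real.pi * inner ℝ ξ (-x) : ℝ) : ℂ) * Complex.I) * g ξ,
    AEStronglyMeasurable.mul (Continuous.aestronglyMeasurable (by fun_prop)) hm,
    ⟨C, fun ξ => ?_⟩, hb.subset hsub, hsub.trans hs, ?_⟩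
  · rw [norm_mul, Complex.norm_exp_ofReal_mul_I, one_mul]; exact hC ξ
  · ext z
    rw [Real.fourierInv_eq', Real.fourierInv_eq']
    refine integral_congr_ae (.of_forall fun ξ => ?_)
    simp only [smul_eq_mul]
    rw [← mul_assoc, ← Complex.exp_add, ← add_mul, ← Complex.ofReal_add, ← mul_add, ← inner_add_right, sub_eq_add_neg]

lemma wt_sq_le {s A B : ℝ} (hA : 0 < A) (hB : 0 < B) (N : ℕ) (x : E2) :
    (ENNReal.ofReal (rho s A B x) ^ N * wt s A B (3 + N) x) ^ 2 ≤
      ENNReal.ofReal (A * B) * wt s A B 3 x := by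
  rw [rho_pow_mul_wt, sq]
  gcongr
  refine ENNReal.ofReal_le_ofReal (div_le_self (by positivity) (one_le_pow₀ (one_le_rho _ _ _ _)))

lemma exists_lintegral_ball (η : ℝ) (hη : 0 < η) : ∃ v : ℝ≥0, 0 < v ∧ ∀ s A B : ℝ, 0 < A →
    0 < B → v ≤ ENNReal.ofReal (A * B) * ∫⁻ x, {x | rho s A B x ≤ 1 + η}.indicator 1 x := by
  have hm : ∀ s A B : ℝ, MeasurableSet {x | rho s A B x ≤ 1 + η} := fun s A B =>
    (isClosed_le (continuous_rho s A B) continuous_const).measurableSet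
  set v0 : ℝ≥0∞ := ∫⁻ x, {x | rho 0 1 1 x ≤ 1 + η}.indicator 1 x with hv0
  have hpos : 0 < v0 := by
    rw [hv0, lintegral_indicator_one (hm 0 1 1)]
    have hsub : {x | rho 0 1 1 x < 1 + η} ⊆ {x | rho 0 1 1 x ≤ 1 + η} :=
      fun x (hx : rho 0 1 1 x < 1 + η) => hx.le
    refine lt_of_lt_of_le ?_ (measure_mono hsub)
    exact (isOpen_lt (continuous_rho 0 1 1) continuous_const).measure_pos _
      ⟨0, by simpa [rho] using hη⟩
  have hmin : min v0 1 ≠ ⊤ := ne_top_of_le_ne_top ENNReal.one_ne_top (min_le_right _ _)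
  refine ⟨(min v0 1).toNNReal, ?_, fun s A B hA hB => ?_⟩
  · exact ENNReal.toNNReal_pos (by simp [hpos.ne']) hmin
  · rw [ENNReal.coe_toNNReal hmin]
    refine (min_le_left _ _).trans (le_of_eq ?_)
    rw [hv0, ← lintegral_const_mul' _ _ ENNReal.ofReal_ne_top, ← lintegral_shear (s := s) hA hB]
    · refine lintegral_congr fun x => ?_
      congr 1
      simp only [indicator, mem_ofPred_eq, rho_shear, Pi.one_apply]
    · exact measurable_one.indicator (hm 0 1 1)

set_option maxHeartbeats 1000000 in
lemma exists_bilinear_le (c b N : ℕ) (hc1 : 1 ≤ c) (hb : 1 ≤ b) (hN : 3 ≤ N) : ∃ C : ℝ≥0,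
    ∀ {ι : Type} [Fintype ι] [DecidableEq ι]
    {a y s : ι → ℝ} {K m M : ℕ} {δ A s₀ κ σ : ℝ} {g : ι → Bool} {r : ι → ι} {Δ : ι → ℝ},
    Conf a y s K m M δ → Pieces a s g A r Δ → 0 < A → 0 < κ →
    (∀ i, s₀ ≤ s i ∧ s i ≤ s₀ + κ) → δ ≤ 2 * (κ * A) →
    (∀ i, g i = true → s i ≤ σ) → (∀ i, g i = false → σ + κ / K ≤ s i) →
    ∀ U : ι → E2 → ℂ, (∀ j, r j ≠ j → U j = 0) →
    (∀ j, BL (box (pt a y j) (s j) (c * A) (c * (A * Δ j + δ))) (U j)) →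
    ∀ h : E2 → ℂ, BL (box 0 s₀ (b * A) (b * (κ * A))) h →
    ∀ (Ω : Set E2) (α : ℝ≥0∞), MeasurableSet Ω → (∀ x ∈ Ω,
      α ≤ ‖∑ i with g i = true, U i x‖ₑ ∧ α ≤ ‖∑ i with g i = false, U i x‖ₑ ∧
      ∑ j, cv (wt (s j) A (A * Δ j + δ) N) (fun y => ‖U j y‖ₑ ^ 2) x ≤ 2 * ‖h x‖ₑ) →
    α ^ 4 * volume Ω ≤ C * K ^ 2 * ∫⁻ x, ‖h x‖ₑ ^ 2 := by
  obtain ⟨C₁, hC₁⟩ := exists_reproducing (a := c) (by exact_mod_cast hc1) hN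
  obtain ⟨C₂, hC₂⟩ := exists_ker_le (3 + N)
  obtain ⟨C₃, hC₃⟩ := exists_reproducing (a := b) (by exact_mod_cast hb) (le_refl 3)
  obtain ⟨η, hη, c₀, hc₀, hker⟩ := exists_le_ker
  obtain ⟨v, hv, hball⟩ := exists_lintegral_ball η hη
  set e : ℝ≥0 := (1 + η).toNNReal with he
  have he' : ENNReal.ofReal (1 + η) = e := rfl
  set M₀ : ℕ := (4 * (6 * (8 * c + 4)) + 6) ^ 2 with hM₀
  set D : ℝ≥0 := M₀ * (C₁ * 4 ^ N) ^ 2 * C₂ ^ 2 * wtMass.toNNReal with hD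
  set D' : ℝ≥0 := (c₀ ^ 2)⁻¹ * D * (2 * (4 * e) ^ N) ^ 2 * C₃ * e ^ 3 with hD'
  refine ⟨v⁻¹ * D' * wtMass.toNNReal, ?_⟩
  intro ι _ _ a y s K m M δ A s₀ κ σ g r Δ hc h hA hκ hs hδ ht hf U hU0 hU hh hhB Ω α hΩm hΩ
  classical
  have hB : 0 < κ * A := by positivity
  set X : ℝ≥0∞ := ENNReal.ofReal (A * (κ * A)) with hX
  have hX0 : X ≠ 0 := by rw [hX]; simpa using mul_pos hA hB
  have hXt : X ≠ ⊤ := ENNReal.ofReal_ne_top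
  have hw := h.width_pos hc.delta_pos hA
  set G : E2 → ℝ≥0∞ := fun x => ∑ j, cv (wt (s j) A (A * Δ j + δ) N) (fun y => ‖U j y‖ₑ ^ 2) x
    with hG
  have hUm : ∀ j, Measurable (U j) := fun j => (hU j).continuous.measurable
  have hslow : ∀ x z, G x ≤ (4 * ENNReal.ofReal (rho s₀ A (κ * A) (x - z))) ^ N * G z :=
    fun x z => by
      rw [hG, Finset.mul_sum]
      refine Finset.sum_le_sum fun j _ => ?_
      by_cases hj : r j = j
      · refine (cv_wt_le hA (hw j) N _ x z).trans ?_
        gcongr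
        rw [show (4 : ℝ≥0∞) = ENNReal.ofReal 4 by simp, ← ENNReal.ofReal_mul (by norm_num)]
        refine ENNReal.ofReal_le_ofReal (rho_le_mul hA.le (hw j).le (D := κ) ?_ (by norm_num) ?_ _)
        · rw [abs_le]; constructor <;> linarith [(hs j).1, (hs j).2]
        · have : A * Δ j ≤ A * κ := by gcongr; exact h.osc_le_of_range hs hj
          linarith
      · simp [hU0 j hj, cv]
  have hsum : ∀ z, ∑ j, ‖U j z‖ₑ ^ 2 ≤ C₁ * G z := fun z => by
    rw [hG, Finset.mul_sum]
    exact Finset.sum_le_sum fun j _ => hC₁ _ _ _ _ hA (hw j) _ (hU j) z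
  set Θ : E2 → ℂ := ker 0 s₀ A (κ * A) with hΘ
  have hΘB : BL (box 0 s₀ (4 * A) (4 * (κ * A))) Θ := BL_ker hA hB
  set F : Bool → E2 → ℂ := fun b z => ∑ i with g i = b, U i z with hF
  have hFm : ∀ b, Measurable (F b) := fun b => by simp only [hF]; fun_prop
  have stepA : ∀ x, ∫⁻ z, ‖F true z * F false z * Θ (z - x)‖ₑ ^ 2 ≤
      D * K ^ 2 * G x ^ 2 * X := fun x => by
    set T : Finset (ι × ι) := (Finset.univ.filter fun i => r i = i ∧ g i = true) ×ˢ
      (Finset.univ.filter fun i => r i = i ∧ g i = false) with hT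
    have hTm : ∀ p ∈ T, r p.1 = p.1 ∧ r p.2 = p.2 ∧ g p.1 = true ∧ g p.2 = false := fun p hp => by
      simp only [hT, Finset.mem_product, Finset.mem_filter, Finset.mem_univ, true_and] at hp
      tauto
    have hFe : ∀ b z, F b z = ∑ i with r i = i ∧ g i = b, U i z := fun b z => by
      refine (Finset.sum_subset (fun i hi => ?_) fun i hi hi' => ?_).symm
      · simp only [Finset.mem_filter, Finset.mem_univ, true_and] at hi ⊢; exact hi.2
      · simp only [Finset.mem_filter, Finset.mem_univ, true_and] at hi hi'
        rw [hU0 i fun e => hi' ⟨e, hi⟩]; rfl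
    have e1 : ∀ z, F true z * F false z * Θ (z - x) =
        ∑ p ∈ T, U p.1 z * U p.2 z * Θ (z - x) := fun z => by
      rw [hFe, hFe, Finset.sum_mul_sum, hT, Finset.sum_product, Finset.sum_mul]
      simp only [Finset.sum_mul]
    simp only [e1]
    refine (BL.lintegral_sum_sq_le T (fun p _ => ((hU p.1).mul (hU p.2)).mul (hΘB.translate x))
      (M₀ * K ^ 2) fun ξ t htT hξ => ?_).trans ?_
    · refine h.card_pairs_le hc hA hκ hs ht hf (8 * c + 4) t (fun p hp => hTm p (htT hp)) ξ
        fun p hp => ?_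
      obtain ⟨h1, h2, -, -⟩ := hTm p (htT hp)
      have i1 := h.box_subset_common (y := y) hA hs hδ (c := c) (by positivity) h1
      have i2 := h.box_subset_common (y := y) hA hs hδ (c := c) (by positivity) h2
      refine box_mono ?_ ?_ (box_add_box_zero (add_subset_add
        ((add_subset_add i1 i2).trans box_add_box) Subset.rfl (hξ p hp)))
      · push_cast; nlinarith
      · push_cast; linarith
    · calc _ = ((M₀ * K ^ 2 : ℕ) : ℝ≥0∞) * ∫⁻ z, ∑ p ∈ T, ‖U p.1 z * U p.2 z * Θ (z - x)‖ₑ ^ 2 := by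
            rw [lintegral_finsetSum']
            intro p _
            exact ((((hUm p.1).mul (hUm p.2)).mul
              (hΘB.translate x).continuous.measurable).enorm.pow_const 2).aemeasurable
        _ ≤ ((M₀ * K ^ 2 : ℕ) : ℝ≥0∞) * ∫⁻ z, (C₁ * 4 ^ N) ^ 2 * C₂ ^ 2 * G x ^ 2 *
              (X * wt s₀ A (κ * A) 3 (z - x)) := by
            gcongr with z
            set q := ENNReal.ofReal (rho s₀ A (κ * A) (z - x)) with hq
            calc ∑ p ∈ T, ‖U p.1 z * U p.2 z * Θ (z - x)‖ₑ ^ 2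
                ≤ (∑ j, ‖U j z‖ₑ ^ 2) ^ 2 * ‖Θ (z - x)‖ₑ ^ 2 := by
                  simp only [enorm_mul, mul_pow]
                  rw [← Finset.sum_mul, hT, Finset.sum_product]
                  dsimp only
                  rw [← Finset.sum_mul_sum, sq (∑ j, _)]
                  gcongr <;> exact Finset.subset_univ _
              _ ≤ (C₁ * ((4 * q) ^ N * G x)) ^ 2 *
                    (C₂ * wt s₀ A (κ * A) (3 + N) (z - x)) ^ 2 := by
                  gcongr
                  · exact (hsum z).trans (by gcongr; exact hslow z x)
                  · exact hC₂ _ _ _ _ hA hB _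
              _ = (C₁ * 4 ^ N) ^ 2 * C₂ ^ 2 * G x ^ 2 *
                    (q ^ N * wt s₀ A (κ * A) (3 + N) (z - x)) ^ 2 := by ring
              _ ≤ _ := by gcongr; exact wt_sq_le hA hB N _
        _ ≤ ((M₀ * K ^ 2 : ℕ) : ℝ≥0∞) * ((C₁ * 4 ^ N) ^ 2 * C₂ ^ 2 * G x ^ 2 *
              (X * wtMass)) := by
            have m3 : Measurable fun z => wt s₀ A (κ * A) 3 (z - x) :=
              (measurable_wt _ _ _ _).comp (by fun_prop)
            rw [lintegral_const_mul _ (m3.const_mul _), lintegral_const_mul _ m3,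
              lintegral_sub_right_eq_self (wt s₀ A (κ * A) 3) x]
            gcongr
            exact lintegral_wt_le hA hB le_rfl
        _ = _ := by
            rw [hD]; push_cast; rw [ENNReal.coe_toNNReal wtMass_lt_top.ne]; ring
  set S : E2 → Set E2 := fun x => Ω ∩ {z | rho s₀ A (κ * A) (z - x) ≤ 1 + η} with hS
  have hSm : ∀ x, MeasurableSet (S x) := fun x => hΩm.inter
    (isClosed_le ((continuous_rho _ _ _).comp (by fun_prop)) continuous_const).measurableSet
  have stepB : ∀ x, α ^ 4 * (c₀ * X) ^ 2 * volume (S x) ≤ D * K ^ 2 * G x ^ 2 * X := fun x => by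
    refine le_trans ?_ (stepA x)
    rw [← setLIntegral_const]
    refine (setLIntegral_mono' (hSm x) fun z hz => ?_).trans (setLIntegral_le_lintegral _ _)
    obtain ⟨h1, h2, -⟩ := hΩ z hz.1
    have h3 := hker s₀ A (κ * A) hA hB (z - x) hz.2
    rw [enorm_mul, enorm_mul]
    calc α ^ 4 * (c₀ * X) ^ 2 = (α * α * (c₀ * X)) ^ 2 := by ring
      _ ≤ _ := by gcongr
  have stepC : ∀ x, α ^ 4 * (X * volume (S x)) ≤
      D' * K ^ 2 * cv (wt s₀ A (κ * A) 3) (fun y => ‖hh y‖ₑ ^ 2) x := fun x => by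
    rcases (S x).eq_empty_or_nonempty with h0 | ⟨z, hz⟩
    · simp [h0]
    have hzρ : ENNReal.ofReal (rho s₀ A (κ * A) (z - x)) ≤ e :=
      (ENNReal.ofReal_le_ofReal hz.2).trans he'.le
    have hxρ : ENNReal.ofReal (rho s₀ A (κ * A) (x - z)) ≤ e := by
      rw [← rho_neg, neg_sub]; exact hzρ
    have h1 : G x ≤ (4 * e) ^ N * (2 * ‖hh z‖ₑ) :=
      (hslow x z).trans (by gcongr; exact (hΩ z hz.1).2.2)
    have h2 : ‖hh z‖ₑ ^ 2 ≤ C₃ * (e ^ 3 * cv (wt s₀ A (κ * A) 3) (fun y => ‖hh y‖ₑ ^ 2) x) := by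
      refine (hC₃ _ _ _ _ hA hB _ hhB z).trans ?_
      gcongr
      exact (cv_wt_le hA hB 3 _ z x).trans (by gcongr)
    have h3 := stepB x
    have h4 : (c₀ : ℝ≥0∞) ^ 2 * (α ^ 4 * (X * volume (S x))) ≤ D * K ^ 2 * G x ^ 2 := by
      rw [← ENNReal.mul_le_mul_iff_left hX0 hXt]
      refine le_trans (le_of_eq ?_) h3
      ring
    have hc2 : (c₀ : ℝ≥0∞) ^ 2 ≠ 0 := by positivity
    have h5 : (((c₀ ^ 2)⁻¹ : ℝ≥0) : ℝ≥0∞) * (c₀ : ℝ≥0∞) ^ 2 = 1 := by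
      rw [← ENNReal.coe_pow, ← ENNReal.coe_mul, inv_mul_cancel₀ (by positivity), ENNReal.coe_one]
    calc α ^ 4 * (X * volume (S x)) = (((c₀ ^ 2)⁻¹ : ℝ≥0) : ℝ≥0∞) *
          ((c₀ : ℝ≥0∞) ^ 2 * (α ^ 4 * (X * volume (S x)))) := by
            rw [← mul_assoc (((c₀ ^ 2)⁻¹ : ℝ≥0) : ℝ≥0∞), h5, one_mul]
      _ ≤ (((c₀ ^ 2)⁻¹ : ℝ≥0) : ℝ≥0∞) * (D * K ^ 2 * ((4 * e) ^ N * (2 * ‖hh z‖ₑ)) ^ 2) := by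
          exact mul_le_mul_right (h4.trans (by gcongr)) _
      _ = (((c₀ ^ 2)⁻¹ : ℝ≥0) : ℝ≥0∞) * (D * K ^ 2 * ((4 * e) ^ N * 2) ^ 2) * ‖hh z‖ₑ ^ 2 := by ring
      _ ≤ (((c₀ ^ 2)⁻¹ : ℝ≥0) : ℝ≥0∞) * (D * K ^ 2 * ((4 * e) ^ N * 2) ^ 2) *
          (C₃ * (e ^ 3 * cv (wt s₀ A (κ * A) 3) (fun y => ‖hh y‖ₑ ^ 2) x)) := by gcongr
      _ = _ := by rw [hD']; push_cast; ring
  set χ : E2 → ℝ≥0∞ := {x | rho s₀ A (κ * A) x ≤ 1 + η}.indicator 1 with hχ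
  have hχm : Measurable χ := measurable_one.indicator
    (isClosed_le (continuous_rho _ _ _) continuous_const).measurableSet
  have hΩi : Measurable (Ω.indicator (1 : E2 → ℝ≥0∞)) := measurable_one.indicator hΩm
  have hSχ : ∀ x, volume (S x) = cv χ (Ω.indicator 1) x := fun x => by
    rw [← lintegral_indicator_one (hSm x), cv]
    refine lintegral_congr fun z => ?_
    have : rho s₀ A (κ * A) (x - z) = rho s₀ A (κ * A) (z - x) := by rw [← rho_neg, neg_sub]
    simp only [hχ, hS, indicator, mem_inter_iff, mem_ofPred_eq, this, Pi.one_apply]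
    split_ifs <;> simp_all
  have hhm : Measurable fun y => ‖hh y‖ₑ ^ 2 := by
    have := hhB.continuous.measurable
    fun_prop
  have hint : v * (α ^ 4 * volume Ω) ≤ D' * K ^ 2 * (wtMass * ∫⁻ x, ‖hh x‖ₑ ^ 2) := by
    calc v * (α ^ 4 * volume Ω) ≤ X * (∫⁻ x, χ x) * (α ^ 4 * volume Ω) := by
          gcongr; exact hball s₀ A (κ * A) hA hB
      _ = ∫⁻ x, α ^ 4 * (X * volume (S x)) := by
          simp only [hSχ]
          rw [lintegral_const_mul _ ((measurable_cv hχm hΩi).const_mul _),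
            lintegral_const_mul _ (measurable_cv hχm hΩi), lintegral_cv hχm hΩi,
            lintegral_indicator_one hΩm]
          ring
      _ ≤ ∫⁻ x, D' * K ^ 2 * cv (wt s₀ A (κ * A) 3) (fun y => ‖hh y‖ₑ ^ 2) x :=
          lintegral_mono stepC
      _ ≤ _ := by
          rw [lintegral_const_mul _ (measurable_cv (measurable_wt _ _ _ _) hhm)]
          gcongr
          exact lintegral_cv_wt_le hA hB le_rfl hhm
  have h5 : ((v⁻¹ : ℝ≥0) : ℝ≥0∞) * v = 1 := by
    rw [← ENNReal.coe_mul, inv_mul_cancel₀ hv.ne', ENNReal.coe_one]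
  calc α ^ 4 * volume Ω = ((v⁻¹ : ℝ≥0) : ℝ≥0∞) * (v * (α ^ 4 * volume Ω)) := by
        rw [← mul_assoc, h5, one_mul]
    _ ≤ ((v⁻¹ : ℝ≥0) : ℝ≥0∞) * (D' * K ^ 2 * (wtMass * ∫⁻ x, ‖hh x‖ₑ ^ 2)) := by gcongr
    _ = _ := by push_cast; rw [ENNReal.coe_toNNReal wtMass_lt_top.ne]; ring

/-- The local square function of `U` at the scale of the box with parameters `s, A, B`. -/
def lsq (s A B : ℝ) (N : ℕ) (U : E2 → ℂ) : E2 → ℝ≥0∞ :=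
  cv (wt s A B N) fun y => ‖U y‖ₑ ^ 2

/-- `U`, smoothly cut off from the set where its local square function exceeds `l ^ 2`. -/
def trim (s A B : ℝ) (N : ℕ) (l : ℝ≥0∞) (U : E2 → ℂ) (x : E2) : ℂ :=
  U x * cut s A B {y | l ^ 2 < lsq s A B N U y}ᶜ x

lemma measurable_lsq (s A B : ℝ) (N : ℕ) {U : E2 → ℂ} (hU : Measurable U) :
    Measurable (lsq s A B N U) :=
  measurable_cv (measurable_wt _ _ _ _) (by fun_prop)

lemma trim_zero (s A B : ℝ) (N : ℕ) (l : ℝ≥0∞) : trim s A B N l 0 = 0 := by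
  ext; simp [trim]

lemma exists_trim (c N : ℕ) (hc : 1 ≤ c) (hN : 3 ≤ N) : ∃ C : ℝ≥0, ∀ (P : E2) (s A B : ℝ),
    0 < A → 0 < B → ∀ U : E2 → ℂ, BL (box P s (c * A) (c * B)) U → ∀ l : ℝ≥0∞, l ≠ 0 →
    BL (box P s ((c + 4) * A) ((c + 4) * B)) (trim s A B N l U) ∧
    (∀ x, ‖trim s A B N l U x‖ₑ ≤ C * l) ∧
    (∀ x, l * ‖U x - trim s A B N l U x‖ₑ ≤ C * lsq s A B N U x) ∧
    (∀ x, ‖trim s A B N l U x‖ₑ ≤ C * ‖U x‖ₑ) ∧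
    (∀ x, ‖U x‖ₑ ^ 2 ≤ C * lsq s A B N U x) := by
  obtain ⟨C, hC⟩ := exists_cutoff (a := c) (by exact_mod_cast hc) hN
  obtain ⟨C', hC'⟩ := exists_reproducing (a := c) (by exact_mod_cast hc) hN
  refine ⟨max C C', fun P s A B hA hB U hU l hl => ?_⟩
  have hUm := hU.continuous.measurable
  have hgm := measurable_lsq s A B N hUm
  have hS : MeasurableSet {y | l ^ 2 < lsq s A B N U y} := measurableSet_lt measurable_const hgm
  have e1 : ∀ x, U x - trim s A B N l U x = U x * cut s A B {y | l ^ 2 < lsq s A B N U y} x :=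
    fun x => by
      have := cut_add_cut_compl (s := s) hA hB hS x
      rw [trim]; linear_combination (-(U x)) * this
  obtain ⟨h1, -, h3, -⟩ := hC P s A B hA hB U hU _ hS.compl
  obtain ⟨-, h2, -, -⟩ := hC P s A B hA hB U hU _ hS
  have hm1 : (C : ℝ≥0∞) ≤ max C C' := by exact_mod_cast le_max_left _ _
  have hm2 : (C' : ℝ≥0∞) ≤ max C C' := by exact_mod_cast le_max_right _ _
  refine ⟨?_, fun x => (h1 l (fun y hy => not_lt.1 hy) x).trans (by push_cast at *; gcongr),
    fun x => ?_, fun x => (h3 x).trans (by push_cast at *; gcongr),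
    fun x => (hC' P s A B hA hB U hU x).trans (by push_cast at *; unfold lsq; gcongr)⟩
  · have hv : volume {y | l ^ 2 < lsq s A B N U y} < ⊤ := by
      refine lt_of_le_of_lt (measure_mono fun y hy => (le_of_lt hy : l ^ 2 ≤ lsq s A B N U y)) ?_
      by_cases hlt : l ^ 2 = ⊤
      · rw [hlt]
        refine lt_of_le_of_lt (measure_mono (t := {y | (1 : ℝ≥0∞) ≤ lsq s A B N U y})
          fun y hy => (le_top.trans hy : (1 : ℝ≥0∞) ≤ lsq s A B N U y)) ?_
        exact meas_ge_le_lintegral_div hgm.aemeasurable one_ne_zero ENNReal.one_ne_top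
          |>.trans_lt <| by
            rw [div_one]
            exact (lintegral_cv_wt_le hA hB hN (by fun_prop)).trans_lt
              (ENNReal.mul_lt_top wtMass_lt_top hU.lintegral_sq_lt_top)
      · exact meas_ge_le_lintegral_div hgm.aemeasurable (pow_ne_zero 2 hl) hlt
          |>.trans_lt <| ENNReal.div_lt_top ((lintegral_cv_wt_le hA hB hN (by fun_prop)).trans_lt
              (ENNReal.mul_lt_top wtMass_lt_top hU.lintegral_sq_lt_top)).ne (pow_ne_zero 2 hl)
    have h4 : BL (box P s ((c + 4) * A) ((c + 4) * B))
        (fun x => U x * cut s A B {y | l ^ 2 < lsq s A B N U y} x) :=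
      (hU.mul (BL_cut hA hB hS hv)).mono (box_add_box_zero.trans
        (box_mono (by linarith) (by linarith)))
    have h5 := (hU.mono (box_mono (A' := (c + 4) * A) (B' := (c + 4) * B) (by linarith)
      (by linarith))).sub h4
    refine (congrArg (BL _) (funext fun x => ?_)).mp h5
    rw [← e1]; ring
  · rw [e1]
    exact (h2 l (fun y hy => le_of_lt hy) x).trans (by push_cast at *; unfold lsq; gcongr)

lemma Pieces.rep_comp {ι : Type} {a s : ι → ℝ} {g : ι → Bool} {A A' : ℝ} {K : ℕ} {r r' : ι → ι}
    {Δ Δ' : ι → ℝ} (h : Pieces a s g A r Δ) (h' : Pieces a s g A' r' Δ') (hA : A = A' * K)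
    (i : ι) : r (r' i) = r i := by
  refine h.rep_eq _ _ (h'.g_rep i) ?_
  rw [hA, ← div_div, ← div_div, Nat.floor_div_natCast, Nat.floor_div_natCast, h'.floor_rep]

/-- Trim each `U p` at its own scale and add up the results over the fibres of `r`. -/
def merge {ι : Type} [Fintype ι] [DecidableEq ι] (s B : ι → ℝ) (r : ι → ι) (A : ℝ) (N : ℕ)
    (l : ℝ≥0∞) (U : ι → E2 → ℂ) (j : ι) (x : E2) : ℂ :=
  ∑ p with r p = j, trim (s p) A (B p) N l (U p) x

lemma sum_fiber {ι α : Type} [Fintype ι] [DecidableEq ι] [AddCommMonoid α] (r : ι → ι)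
    (P : ι → Prop) [DecidablePred P] (v : ι → α) :
    ∑ i with P i, ∑ p with r p = i, v p = ∑ p with P (r p), v p := by
  rw [Finset.sum_comm' (t' := Finset.univ.filter fun p => P (r p)) (s' := fun p => {r p})]
  · simp
  · intro x y
    simp only [Finset.mem_filter, Finset.mem_univ, true_and, Finset.mem_singleton]
    constructor
    · rintro ⟨h1, rfl⟩; exact ⟨rfl, h1⟩
    · rintro ⟨rfl, h1⟩; exact ⟨h1, rfl⟩

lemma sum_fiber_univ {ι α : Type} [Fintype ι] [DecidableEq ι] [AddCommMonoid α] (r : ι → ι)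
    (v : ι → α) : ∑ i, ∑ p with r p = i, v p = ∑ p, v p := by
  simpa using sum_fiber r (fun _ => True) v

lemma sum_fiber_rep {ι α : Type} [Fintype ι] [DecidableEq ι] [AddCommMonoid α] (r r' : ι → ι)
    (v : ι → α) (hv : ∀ p, r' p ≠ p → v p = 0) (j : ι) :
    ∑ p with r p = j, v p = ∑ p with r p = j ∧ r' p = p, v p := by
  refine (Finset.sum_subset (fun p hp => ?_) fun p hp hp' => ?_).symm
  · simp only [Finset.mem_filter] at hp ⊢; exact ⟨hp.1, hp.2.1⟩
  · simp only [Finset.mem_filter, Finset.mem_univ, true_and] at hp hp'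
    exact hv p fun h => hp' ⟨hp, h⟩

lemma exists_merge (c N : ℕ) (hc1 : 1 ≤ c) (hN : 3 ≤ N) : ∃ C : ℝ≥0,
    ∀ {ι : Type} [Fintype ι] [DecidableEq ι]
    {a y s : ι → ℝ} {K m M : ℕ} {δ A : ℝ} {g : ι → Bool} {r r' : ι → ι} {Δ Δ' : ι → ℝ},
    Conf a y s K m M δ → Pieces a s g A r Δ → Pieces a s g (A / K) r' Δ' → 0 < A →
    ∀ U : ι → E2 → ℂ, (∀ p, r' p ≠ p → U p = 0) →
    (∀ p, BL (box (pt a y p) (s p) (c * (A / K)) (c * (A / K * Δ' p + δ))) (U p)) →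
    ∀ l : ℝ≥0∞, l ≠ 0 → ∀ U', merge s (fun p => A / K * Δ' p + δ) r (A / K) N l U = U' →
    (∀ j, r j ≠ j → U' j = 0) ∧
    (∀ j, BL (box (pt a y j) (s j) ((c + 5) * A) ((c + 5) * (A * Δ j + δ))) (U' j)) ∧
    (∀ j x, ‖U' j x‖ₑ ≤ C * K * l) ∧
    (∀ b x, l * ‖∑ i with g i = b, U i x - ∑ i with g i = b, U' i x‖ₑ ≤
      C * ∑ p, lsq (s p) (A / K) (A / K * Δ' p + δ) N (U p) x) ∧
    ∑ j, ∫⁻ x, ‖U' j x‖ₑ ^ 2 ≤ C * ∑ j, ∫⁻ x, ‖U j x‖ₑ ^ 2 := by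
  obtain ⟨C, hC⟩ := exists_trim c N hc1 hN
  refine ⟨7 * C + C + (2 * (2 * (2 * (c + 4)) + 3) : ℕ) * C ^ 2,
    fun {ι _ _ a y s K m M δ A g r r' Δ Δ'} hcf h h' hA U hU0 hU l hl U' hUU => ?_⟩
  have hK := hcf.K_pos
  have hK2 : (2 : ℝ) ≤ K := by exact_mod_cast hcf.two_le
  have hA' : 0 < A / K := by positivity
  have hrr : ∀ i, r (r' i) = r i := h.rep_comp h' (by field_simp)
  set B : ι → ℝ := fun p => A / K * Δ' p + δ with hB
  have hBp : ∀ p, 0 < B p := h'.width_pos hcf.delta_pos hA'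
  set V : ι → E2 → ℂ := fun p => trim (s p) (A / K) (B p) N l (U p) with hV
  have hV0 : ∀ p, r' p ≠ p → V p = 0 := fun p hp => by rw [hV]; simp only [hU0 p hp, trim_zero]
  have key := fun p => hC (pt a y p) (s p) (A / K) (B p) hA' (hBp p) (U p) (hU p) l hl
  have hU' : ∀ j x, U' j x = ∑ p with r p = j, V p x := fun j x => by rw [← hUU]; rfl
  have hU'' : ∀ j x, U' j x = ∑ p with r p = j ∧ r' p = p, V p x := fun j x => by
    rw [hU', sum_fiber_rep r r' _ (fun p hp => by rw [hV0 p hp]; rfl)]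
  have c1 : (7 * C : ℝ≥0∞) ≤
      (7 * C + C + (2 * (2 * (2 * (c + 4)) + 3) : ℕ) * C ^ 2 : ℝ≥0) := by
    push_cast; rw [add_assoc]; exact le_self_add
  have c2 : (C : ℝ≥0∞) ≤
      (7 * C + C + (2 * (2 * (2 * (c + 4)) + 3) : ℕ) * C ^ 2 : ℝ≥0) := by
    push_cast; rw [add_right_comm]; exact le_add_self
  have c3 : ((2 * (2 * (2 * (c + 4)) + 3) : ℕ) * C ^ 2 : ℝ≥0∞) ≤
      (7 * C + C + (2 * (2 * (2 * (c + 4)) + 3) : ℕ) * C ^ 2 : ℝ≥0) := by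
    push_cast; exact le_add_self
  have hBL : ∀ p, r' p = p → BL (box (pt a y (r p)) (s (r p)) ((c + 5) * A)
      ((c + 5) * (A * Δ (r p) + δ))) (V p) := fun p hp => by
    refine (key p).1.mono ?_
    have := h.box_subset_succ hcf hA h' hrr hA' (by rw [← mul_div_assoc, div_le_iff₀ hK]; nlinarith)
      (c := c + 4) (by positivity) hp
    convert this using 2 <;> ring
  refine ⟨fun j hj => ?_, fun j => ?_, fun j x => ?_, fun b x => ?_, ?_⟩
  · ext x
    rw [hU', Finset.filter_false_of_mem]
    · rfl
    · rintro p - rfl; exact hj (h.rep_rep p)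
  · rw [show U' j = fun x => ∑ p with r p = j ∧ r' p = p, V p x from funext (hU'' j)]
    refine BL.sum _ fun p hp => ?_
    simp only [Finset.mem_filter, Finset.mem_univ, true_and] at hp
    rw [← hp.1]
    exact hBL p hp.2
  · rw [hU'']
    have hcard : (Finset.univ.filter fun p => r p = j ∧ r' p = p).card ≤ 7 * K := by
      refine (h'.card_le hA' _ (fun i hi => ?_) K fun i hi k hk => ?_).trans (by
        have := hcf.two_le; omega)
      · simp only [Finset.mem_filter] at hi; exact hi.2.2
      · simp only [Finset.mem_filter, Finset.mem_univ, true_and] at hi hk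
        rw [mul_div_cancel₀ _ hK.ne']
        have e1 := h.sub_lt hA hcf.a_nonneg i
        have e2 := h.sub_lt hA hcf.a_nonneg k
        have e3 := h.rep_le i
        have e4 := h.rep_le k
        rw [hi.1] at e1 e3
        rw [hk.1] at e2 e4
        rw [abs_le]; constructor <;> linarith
    calc ‖∑ p with r p = j ∧ r' p = p, V p x‖ₑ
        ≤ ∑ p with r p = j ∧ r' p = p, ‖V p x‖ₑ := enorm_sum_le _ _
      _ ≤ ∑ p with r p = j ∧ r' p = p, C * l := Finset.sum_le_sum fun p _ => (key p).2.1 x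
      _ = (Finset.univ.filter fun p => r p = j ∧ r' p = p).card * (C * l) := by
        rw [Finset.sum_const, nsmul_eq_mul]
      _ ≤ (7 * K : ℕ) * (C * l) := by gcongr
      _ = 7 * C * K * l := by push_cast; ring
      _ ≤ _ := by gcongr
  · have e : ∑ i with g i = b, U' i x = ∑ p with g p = b, V p x := by
      simp only [hU']
      rw [sum_fiber r (fun i => g i = b)]
      simp only [h.g_rep]
    rw [e, ← Finset.sum_sub_distrib]
    calc l * ‖∑ i with g i = b, (U i x - V i x)‖ₑ
        ≤ l * ∑ i with g i = b, ‖U i x - V i x‖ₑ := by gcongr; exact enorm_sum_le _ _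
      _ ≤ l * ∑ i, ‖U i x - V i x‖ₑ := by
        gcongr; exact Finset.subset_univ _
      _ ≤ C * ∑ i, lsq (s i) (A / K) (B i) N (U i) x := by
        rw [Finset.mul_sum, Finset.mul_sum]
        exact Finset.sum_le_sum fun p _ => (key p).2.2.1 x
      _ ≤ _ := by gcongr
  · calc ∑ j, ∫⁻ x, ‖U' j x‖ₑ ^ 2
        = ∑ j, ∫⁻ x, ‖∑ p with r p = j ∧ r' p = p, V p x‖ₑ ^ 2 := by simp only [hU'']
      _ ≤ ∑ j, (2 * (2 * (2 * (c + 4)) + 3) : ℕ) *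
          ∑ p with r p = j ∧ r' p = p, ∫⁻ x, ‖V p x‖ₑ ^ 2 := by
        refine Finset.sum_le_sum fun j _ => BL.lintegral_sum_sq_le _ (fun p _ => (key p).1) _
          fun ξ t ht hξ => ?_
        refine h'.card_box_le hA' (B := fun p => (c + 4) * B p) (c + 4) t (fun i hi => ?_) ξ
          fun i hi => by simpa using hξ i hi
        have := ht hi
        simp only [Finset.mem_filter] at this
        exact this.2.2
      _ ≤ ∑ j, (2 * (2 * (2 * (c + 4)) + 3) : ℕ) *
          ∑ p with r p = j, ∫⁻ x, ‖V p x‖ₑ ^ 2 := by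
        gcongr; rename_i p hp; exact And.left
      _ = (2 * (2 * (2 * (c + 4)) + 3) : ℕ) * ∑ p, ∫⁻ x, ‖V p x‖ₑ ^ 2 := by
        rw [← Finset.mul_sum, sum_fiber_univ]
      _ ≤ (2 * (2 * (2 * (c + 4)) + 3) : ℕ) * ∑ p, C ^ 2 * ∫⁻ x, ‖U p x‖ₑ ^ 2 := by
        gcongr with p
        rw [← lintegral_const_mul' _ _ (by simp)]
        refine lintegral_mono fun x => ?_
        rw [← mul_pow]
        exact pow_le_pow_left' ((key p).2.2.2.1 x) 2
      _ = ((2 * (2 * (2 * (c + 4)) + 3) : ℕ) * C ^ 2) * ∑ p, ∫⁻ x, ‖U p x‖ₑ ^ 2 := by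
        rw [← Finset.mul_sum, mul_assoc]
      _ ≤ _ := by gcongr

lemma exists_merge_bilinear (c N : ℕ) (hc1 : 1 ≤ c) (hN : 3 ≤ N) : ∃ C : ℝ≥0,
    ∀ {ι : Type} [Fintype ι] [DecidableEq ι] {a y s : ι → ℝ} {K m M : ℕ} {δ A s₀ κ σ : ℝ}
      {g : ι → Bool} {r r' : ι → ι} {Δ Δ' : ι → ℝ},
    Conf a y s K m M δ → Pieces a s g A r Δ → Pieces a s g (A / K) r' Δ' → 0 < A →
    1 ≤ A * (K : ℝ) ^ m → A ≤ 1 → 0 < κ →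
    (∀ i, s₀ ≤ s i ∧ s i ≤ s₀ + κ) → δ ≤ 2 * (κ * A) →
    (∀ i, g i = true → s i ≤ σ) → (∀ i, g i = false → σ + κ / K ≤ s i) →
    ∀ U : ι → E2 → ℂ, (∀ p, r' p ≠ p → U p = 0) →
    (∀ p, BL (box (pt a y p) (s p) (c * (A / K)) (c * (A / K * Δ' p + δ))) (U p)) →
    ∀ l : ℝ≥0∞, l ≠ 0 → ∀ U', merge s (fun p => A / K * Δ' p + δ) r (A / K) N l U = U' →
    ∀ (Ω : Set E2) (α : ℝ≥0∞), MeasurableSet Ω →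
    (∀ x ∈ Ω, α ≤ ‖∑ i with g i = true, U' i x‖ₑ ∧ α ≤ ‖∑ i with g i = false, U' i x‖ₑ ∧
      ∑ p, lsq (s p) (A / K) (A / K * Δ' p + δ) N (U p) x ≠ ⊤ ∧
      2 * C * ∑ p, lsq (s p) (A / K) (A / K * Δ' p + δ) N (U p) x ≤
        ∑ j, lsq (s j) A (A * Δ j + δ) (3 + N) (U' j) x) →
    α ^ 4 * volume Ω ≤
      C * (2 * M + 2) * K ^ 6 * l ^ 2 * ∑ j, ∫⁻ x, ‖U j x‖ₑ ^ 2 := by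
  obtain ⟨C₀, h₀⟩ := exists_trim c N hc1 hN
  obtain ⟨C₁, h₁⟩ := exists_merge c N hc1 hN
  obtain ⟨C₂, h₂⟩ := exists_level_le (c + 4) N
  obtain ⟨C₃, h₃⟩ := exists_bilinear_le (c + 5) (8 * (c + 5)) (3 + N) (by omega) (by omega)
    (by omega)
  refine ⟨C₂ * (C₀ ^ 2 * C₀) + C₃ * C₂ * C₁ ^ 2 * C₁, fun {ι _ _ a y s K m M δ A s₀ κ σ g r r' Δ Δ'}
    hcf h h' hA hA0 hA1 hκ hs hδ hgt hgf U hU0 hU l hl U' hUU Ω α hΩ hx => ?_⟩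
  have hK := hcf.K_pos
  have hA' : 0 < A / K := by positivity
  have hrr : ∀ i, r (r' i) = r i := h.rep_comp h' (by field_simp)
  have hBp : ∀ p, 0 < A / K * Δ' p + δ := h'.width_pos hcf.delta_pos hA'
  set V : ι → E2 → ℂ := fun p => trim (s p) (A / K) (A / K * Δ' p + δ) N l (U p) with hV
  have key := fun p => h₀ (pt a y p) (s p) (A / K) (A / K * Δ' p + δ) hA' (hBp p) (U p) (hU p) l hl
  obtain ⟨m1, m2, m3, -, m5⟩ := h₁ hcf h h' hA U hU0 hU l hl U' hUU
  have hU' : ∀ j x, U' j x = ∑ p with r p = j, V p x := fun j x => by rw [← hUU]; rfl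
  obtain ⟨hh, e1, e2, e3⟩ := h₂ hcf h h' hrr hA hA0 hA1 hs hδ V
    (fun p hp => by rw [hV]; simp only [hU0 p hp, trim_zero])
    (fun p => by exact_mod_cast (key p).1)
    (fun p x => C₀ ^ 2 * (C₀ * lsq (s p) (A / K) (A / K * Δ' p + δ) N (U p) x))
    (fun p x => by
      refine (pow_le_pow_left' ((key p).2.2.2.1 x) 2).trans ?_
      rw [mul_pow]; gcongr; exact (key p).2.2.2.2 x)
    (fun p _ x z => by
      have := cv_wt_le hA' (hBp p) (s := s p) N (fun y => ‖U p y‖ₑ ^ 2) z x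
      calc _ ≤ (C₀ : ℝ≥0∞) ^ 2 * (C₀ * (ENNReal.ofReal
            (rho (s p) (A / K) (A / K * Δ' p + δ) (z - x)) ^ N *
              lsq (s p) (A / K) (A / K * Δ' p + δ) N (U p) x)) := by gcongr; exact this
        _ = _ := by ring)
  simp only [← hU'] at e2 e3
  set C : ℝ≥0 := C₂ * (C₀ ^ 2 * C₀) + C₃ * C₂ * C₁ ^ 2 * C₁ with hCdef
  have c1 : (C₂ * (C₀ ^ 2 * C₀) : ℝ≥0∞) ≤ C := by rw [hCdef]; push_cast; exact le_self_add
  have c2 : (C₃ * C₂ * C₁ ^ 2 * C₁ : ℝ≥0∞) ≤ C := by rw [hCdef]; push_cast; exact le_add_self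
  have hb := h₃ hcf h hA hκ hs hδ hgt hgf U' m1
    (fun j => by exact_mod_cast m2 j) hh (e1.mono (box_mono (by push_cast; nlinarith)
      (le_of_eq (by push_cast; ring)))) Ω α hΩ fun x hxΩ => by
    obtain ⟨x1, x2, x3, x4⟩ := hx x hxΩ
    refine ⟨x1, x2, ?_⟩
    have l1 : ∑ j, lsq (s j) A (A * Δ j + δ) (3 + N) (U' j) x ≤
        C * (∑ p, lsq (s p) (A / K) (A / K * Δ' p + δ) N (U p) x) + ‖hh x‖ₑ := by
      refine (e2 x).trans (add_le_add ?_ le_rfl)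
      rw [← Finset.mul_sum, ← Finset.mul_sum]
      calc _ = (C₂ * (C₀ ^ 2 * C₀) : ℝ≥0∞) *
            ∑ p, lsq (s p) (A / K) (A / K * Δ' p + δ) N (U p) x := by ring
        _ ≤ _ := by gcongr
    have l2 : ∑ j, lsq (s j) A (A * Δ j + δ) (3 + N) (U' j) x ≠ ⊤ := by
      refine (lt_of_le_of_lt l1 ?_).ne
      exact ENNReal.add_lt_top.2 ⟨ENNReal.mul_lt_top (by simp) x3.lt_top, by simp⟩
    change ∑ j, lsq (s j) A (A * Δ j + δ) (3 + N) (U' j) x ≤ _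
    set T := ∑ j, lsq (s j) A (A * Δ j + δ) (3 + N) (U' j) x
    refine (ENNReal.add_le_add_iff_left l2).1 ?_
    calc T + T ≤ (C * (∑ p, lsq (s p) (A / K) (A / K * Δ' p + δ) N (U p) x) + ‖hh x‖ₑ) +
          (C * (∑ p, lsq (s p) (A / K) (A / K * Δ' p + δ) N (U p) x) + ‖hh x‖ₑ) := add_le_add l1 l1
      _ = 2 * C * (∑ p, lsq (s p) (A / K) (A / K * Δ' p + δ) N (U p) x) + 2 * ‖hh x‖ₑ := by ring
      _ ≤ T + 2 * ‖hh x‖ₑ := by gcongr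
  calc α ^ 4 * volume Ω ≤ C₃ * K ^ 2 * ∫⁻ x, ‖hh x‖ₑ ^ 2 := hb
    _ ≤ C₃ * K ^ 2 * (C₂ * ((2 * M + 2) * K ^ 2) * ∑ j, ∫⁻ x, ‖U' j x‖ₑ ^ 4) := by gcongr
    _ ≤ C₃ * K ^ 2 * (C₂ * ((2 * M + 2) * K ^ 2) *
        ∑ j, ((C₁ * K * l) ^ 2 * ∫⁻ x, ‖U' j x‖ₑ ^ 2)) := by
      gcongr with j
      rw [← lintegral_const_mul _ (by
        have := (m2 j).continuous.measurable; fun_prop)]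
      refine lintegral_mono fun x => ?_
      calc ‖U' j x‖ₑ ^ 4 = ‖U' j x‖ₑ ^ 2 * ‖U' j x‖ₑ ^ 2 := by ring
        _ ≤ _ := by gcongr; exact m3 j x
    _ ≤ C₃ * K ^ 2 * (C₂ * ((2 * M + 2) * K ^ 2) *
        ((C₁ * K * l) ^ 2 * (C₁ * ∑ j, ∫⁻ x, ‖U j x‖ₑ ^ 2))) := by
      rw [← Finset.mul_sum]; gcongr
    _ = (C₃ * C₂ * C₁ ^ 2 * C₁ : ℝ≥0∞) * (2 * M + 2) * K ^ 6 * l ^ 2 *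
        ∑ j, ∫⁻ x, ‖U j x‖ₑ ^ 2 := by ring
    _ ≤ _ := by gcongr

lemma Pieces.sum_eq_of_one {ι : Type} [Fintype ι] {a y s : ι → ℝ} {K m M : ℕ} {δ : ℝ}
    {g : ι → Bool} {r : ι → ι} {Δ : ι → ℝ} (h : Pieces a s g 1 r Δ) (hc : Conf a y s K m M δ)
    {α : Type} [AddCommMonoid α] (U : ι → α) (hU : ∀ j, r j ≠ j → U j = 0) (b : Bool) :
    (∑ i with g i = b, U i = 0) ∨ ∃ p, ∑ i with g i = b, U i = U p := by
  classical
  have hf : ∀ i, ⌊a i / 1⌋₊ = 0 := fun i => by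
    rw [div_one]; exact Nat.floor_eq_zero.2 (hc.a_lt i)
  by_cases hb : ∃ i, g i = b
  · obtain ⟨i, hi⟩ := hb
    refine Or.inr ⟨r i, Finset.sum_eq_single _ (fun j hj hji => hU j fun hjj => hji ?_) ?_⟩
    · simp only [Finset.mem_filter, Finset.mem_univ, true_and] at hj
      rw [← hjj, h.rep_eq j i (hj.trans hi.symm) (by rw [hf, hf])]
    · intro hn
      simp [h.g_rep, hi] at hn
  · push Not at hb
    left
    refine Finset.sum_eq_zero fun i hi => ?_
    simp only [Finset.mem_filter, Finset.mem_univ, true_and] at hi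
    exact absurd hi (hb i)

/-- The bilinear level set estimate, iterated over the scales from `scl K m t` up to `1`. -/
lemma exists_bilinear_iter (M n : ℕ) : ∀ c N : ℕ, 1 ≤ c → 3 ≤ N → ∃ C : ℝ≥0, 1 ≤ C ∧
    ∀ {ι : Type} [Fintype ι] [DecidableEq ι] {a y s : ι → ℝ} {K m t : ℕ} {δ s₀ κ σ : ℝ}
      {g : ι → Bool} {r : ι → ι} {Δ : ι → ℝ},
    Conf a y s K m M δ → t + n = m → Pieces a s g (scl K m t) r Δ → 0 < κ →
    (∀ i, s₀ ≤ s i ∧ s i ≤ s₀ + κ) → δ * (K : ℝ) ^ m ≤ 2 * κ →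
    (∀ i, g i = true → s i ≤ σ) → (∀ i, g i = false → σ + κ / K ≤ s i) →
    ∀ U : ι → E2 → ℂ, (∀ p, r p ≠ p → U p = 0) →
    (∀ p, BL (box (pt a y p) (s p) (c * scl K m t) (c * (scl K m t * Δ p + δ))) (U p)) →
    ∀ l α β : ℝ≥0∞, l ≠ 0 → l ≠ ⊤ → α ≠ ⊤ → β ≠ ⊤ → C * β ≤ l * α → C * l ≤ α →
    ∀ Ω : Set E2, MeasurableSet Ω →
    (∀ x ∈ Ω, α ≤ ‖∑ i with g i = true, U i x‖ₑ ∧ α ≤ ‖∑ i with g i = false, U i x‖ₑ ∧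
      ∑ p, lsq (s p) (scl K m t) (scl K m t * Δ p + δ) N (U p) x ≤ β) →
    α ^ 4 * volume Ω ≤ C * K ^ 6 * l ^ 2 * ∑ j, ∫⁻ x, ‖U j x‖ₑ ^ 2 := by
  induction n with
  | zero =>
    intro c N hc hN
    obtain ⟨C, hC⟩ := exists_trim c N hc hN
    refine ⟨C + 1, by simp, fun {ι _ _ a y s K m t δ s₀ κ σ g r Δ} hcf htm h hκ hs hκ2 hgt hgf U
      hU0 hU l α β hl hl' hα hβ h1 h2 Ω hΩ hx => ?_⟩
    obtain rfl : t = m := by omega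
    rw [scl_self hcf.two_le] at *
    rcases Ω.eq_empty_or_nonempty with rfl | ⟨x, hxΩ⟩
    · simp
    suffices hα0 : α = 0 by simp [hα0]
    obtain ⟨x1, -, x3⟩ := hx x hxΩ
    rcases h.sum_eq_of_one hcf (fun i => U i x) (fun j hj => by rw [hU0 j hj]; rfl) true with e | ⟨p, e⟩
    · rw [e] at x1; simpa using x1
    rw [e] at x1
    by_contra hα0
    have k1 : α ^ 2 ≤ C * β := by
      calc α ^ 2 ≤ ‖U p x‖ₑ ^ 2 := by gcongr
        _ ≤ C * lsq (s p) 1 (1 * Δ p + δ) N (U p) x :=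
          (hC (pt a y p) (s p) 1 (1 * Δ p + δ) one_pos (h.width_pos hcf.delta_pos one_pos p) (U p)
            (hU p) 1 one_ne_zero).2.2.2.2 x
        _ ≤ C * β := by
          gcongr
          exact (Finset.single_le_sum (f := fun p => lsq (s p) 1 (1 * Δ p + δ) N (U p) x)
            (fun _ _ => zero_le) (Finset.mem_univ p)).trans x3
    have k2 : ((C + 1 : ℝ≥0) : ℝ≥0∞) * β ≤ α ^ 2 := by
      calc ((C + 1 : ℝ≥0) : ℝ≥0∞) * β ≤ (C + 1 : ℝ≥0) * ((C + 1 : ℝ≥0) * β) :=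
            le_mul_of_one_le_left zero_le (by push_cast; exact le_add_self)
        _ ≤ (C + 1 : ℝ≥0) * (l * α) := by gcongr
        _ = ((C + 1 : ℝ≥0) * l) * α := by ring
        _ ≤ α * α := by gcongr
        _ = α ^ 2 := by ring
    have k3 := k2.trans k1
    push_cast at k3
    rw [add_mul, one_mul] at k3
    have hb0 : β = 0 := by
      have : (C : ℝ≥0∞) * β + β ≤ C * β + 0 := by simpa using k3
      simpa using (ENNReal.add_le_add_iff_left (ENNReal.mul_ne_top (by simp) hβ)).1 this
    rw [hb0] at k1
    simp at k1
    exact hα0 k1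
  | succ n ih =>
    intro c N hc hN
    obtain ⟨C₁, h₁⟩ := exists_merge c N hc hN
    obtain ⟨C₂, h₂⟩ := exists_merge_bilinear c N hc hN
    obtain ⟨C₃, hC₃, h₃⟩ := ih (c + 5) (3 + N) (by omega) (by omega)
    set C : ℝ≥0 := 16 * (C₂ * (2 * M + 2) + C₃ * C₁) + 4 * C₃ * C₂ + 2 * C₁ + 2 * C₃ with hC
    have b1 : 16 * (C₂ * (2 * M + 2) + C₃ * C₁) ≤ C := by
      rw [hC, add_assoc, add_assoc]; exact le_self_add
    have b2 : 4 * C₃ * C₂ ≤ C := by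
      rw [hC, add_assoc, add_right_comm]; exact le_add_self
    have b3 : 2 * C₁ ≤ C := by
      rw [hC, add_right_comm]; exact le_add_self
    have b4 : 2 * C₃ ≤ C := le_add_self
    refine ⟨C, (hC₃.trans (le_mul_of_one_le_left zero_le one_le_two)).trans b4,
      fun {ι _ _ a y s K m t δ s₀ κ σ g r' Δ'} hcf htm h' hκ hs hκ2 hgt hgf U
      hU0 hU l α β hl hl' hα hβ e1 e2 Ω hΩ hx => ?_⟩
    obtain ⟨r, Δ, h⟩ := exists_pieces a s g (scl K m (t + 1))
    have hK := hcf.K_pos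
    have hK1 : (1 : ℝ) ≤ K := by exact_mod_cast (by have := hcf.two_le; omega : 1 ≤ K)
    have hA := scl_pos hcf.two_le m (t + 1)
    have hAK : scl K m (t + 1) / K = scl K m t := by
      rw [scl_succ]; field_simp
    have hA0 : scl K m (t + 1) * (K : ℝ) ^ m = (K : ℝ) ^ (t + 1) := by
      unfold scl; field_simp
    have hA1 : 1 ≤ scl K m (t + 1) * (K : ℝ) ^ m := by rw [hA0]; exact one_le_pow₀ hK1
    have hA2 : scl K m (t + 1) ≤ 1 := by
      unfold scl; rw [div_le_one (by positivity)]; exact pow_le_pow_right₀ hK1 (by omega)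
    have hδA : δ ≤ 2 * (κ * scl K m (t + 1)) := by
      have := hcf.delta_pos
      calc δ ≤ δ * (scl K m (t + 1) * (K : ℝ) ^ m) := le_mul_of_one_le_right this.le hA1
        _ = δ * (K : ℝ) ^ m * scl K m (t + 1) := by ring
        _ ≤ 2 * κ * scl K m (t + 1) := by gcongr
        _ = _ := by ring
    rw [← hAK] at h' hU hx
    obtain ⟨m1, m2, -, m4, m5⟩ := h₁ hcf h h' hA U hU0 hU l hl _ rfl
    have hb := h₂ hcf h h' hA hA1 hA2 hκ hs hδA hgt hgf U hU0 hU l hl _ rfl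
    set U' := merge s (fun p => scl K m (t + 1) / K * Δ' p + δ) r (scl K m (t + 1) / K) N l U
    set G' : E2 → ℝ≥0∞ := fun x =>
      ∑ j, lsq (s j) (scl K m (t + 1)) (scl K m (t + 1) * Δ j + δ) (3 + N) (U' j) x with hG'
    have hG'm : Measurable G' := Finset.measurable_fun_sum _ fun j _ =>
      measurable_lsq _ _ _ _ (m2 j).continuous.measurable
    have hα2 : 2 * (α / 2) = α := ENNReal.mul_div_cancel (by simp) (by simp)
    have hα2' : α / 2 ≠ ⊤ := ENNReal.div_ne_top hα (by simp)
    have q1 : ∀ x ∈ Ω, ∀ b, α ≤ ‖∑ i with g i = b, U i x‖ₑ →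
        α / 2 ≤ ‖∑ i with g i = b, U' i x‖ₑ := fun x hxΩ b hb => by
      have k1 : ‖∑ i with g i = b, U i x - ∑ i with g i = b, U' i x‖ₑ ≤ α / 2 := by
        refine (ENNReal.mul_le_mul_iff_right hl hl').1 ((m4 b x).trans ?_)
        refine (ENNReal.mul_le_mul_iff_right two_ne_zero (by simp)).1 ?_
        calc 2 * (C₁ * _) ≤ 2 * (C₁ * β) := by gcongr; exact (hx x hxΩ).2.2
          _ = ((2 * C₁ : ℝ≥0) : ℝ≥0∞) * β := by push_cast; ring
          _ ≤ C * β := by gcongr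
          _ ≤ l * α := e1
          _ = 2 * (l * (α / 2)) := by rw [mul_left_comm, hα2]
      refine (ENNReal.add_le_add_iff_left hα2').1 ?_
      rw [← two_mul, hα2]
      calc α ≤ ‖∑ i with g i = b, U i x‖ₑ := hb
        _ = ‖(∑ i with g i = b, U i x - ∑ i with g i = b, U' i x) +
            ∑ i with g i = b, U' i x‖ₑ := by rw [sub_add_cancel]
        _ ≤ _ := (enorm_add_le _ _).trans (by gcongr)
    have r1 := hb (Ω ∩ {x | 2 * C₂ * β < G' x}) (α / 2)
      (hΩ.inter (measurableSet_lt measurable_const hG'm)) fun x hxΩ => by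
        obtain ⟨x1, x2, x3⟩ := hx x hxΩ.1
        refine ⟨q1 x hxΩ.1 _ x1, q1 x hxΩ.1 _ x2, (x3.trans_lt hβ.lt_top).ne, ?_⟩
        refine le_trans ?_ (le_of_lt hxΩ.2)
        gcongr
    have r2 := h₃ hcf (by omega) h hκ hs hκ2 hgt hgf U' m1 (fun j => by exact_mod_cast m2 j) l
      (α / 2) (2 * C₂ * β) hl hl' hα2'
      (ENNReal.mul_ne_top (ENNReal.mul_ne_top (by simp) (by simp)) hβ)
      (by
        refine (ENNReal.mul_le_mul_iff_right two_ne_zero (by simp)).1 ?_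
        calc 2 * (C₃ * (2 * C₂ * β)) = ((4 * C₃ * C₂ : ℝ≥0) : ℝ≥0∞) * β := by push_cast; ring
          _ ≤ C * β := by gcongr
          _ ≤ l * α := e1
          _ = 2 * (l * (α / 2)) := by rw [mul_left_comm, hα2])
      (by
        refine (ENNReal.mul_le_mul_iff_right two_ne_zero (by simp)).1 ?_
        rw [hα2]
        calc 2 * (C₃ * l) = ((2 * C₃ : ℝ≥0) : ℝ≥0∞) * l := by push_cast; ring
          _ ≤ C * l := by gcongr
          _ ≤ α := e2)
      (Ω ∩ {x | 2 * C₂ * β < G' x}ᶜ)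
      (hΩ.inter (measurableSet_lt measurable_const hG'm).compl) fun x hxΩ => by
        obtain ⟨x1, x2, x3⟩ := hx x hxΩ.1
        exact ⟨q1 x hxΩ.1 _ x1, q1 x hxΩ.1 _ x2, not_lt.1 hxΩ.2⟩
    set E := ∑ j, ∫⁻ x, ‖U j x‖ₑ ^ 2
    calc α ^ 4 * volume Ω
        ≤ α ^ 4 * (volume (Ω ∩ {x | 2 * C₂ * β < G' x}) +
            volume (Ω ∩ {x | 2 * C₂ * β < G' x}ᶜ)) := by
          gcongr
          refine (measure_mono (inter_union_compl Ω _).ge).trans (measure_union_le _ _)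
      _ = 16 * ((α / 2) ^ 4 * volume (Ω ∩ {x | 2 * C₂ * β < G' x}) +
            (α / 2) ^ 4 * volume (Ω ∩ {x | 2 * C₂ * β < G' x}ᶜ)) := by
          rw [← mul_add, ← mul_assoc]
          congr 1
          nth_rewrite 1 [← hα2]
          rw [mul_pow]; norm_num
      _ ≤ 16 * (C₂ * (2 * M + 2) * K ^ 6 * l ^ 2 * E + C₃ * K ^ 6 * l ^ 2 * (C₁ * E)) := by
          refine mul_le_mul_right (add_le_add r1 (r2.trans ?_)) _
          gcongr
      _ = ((16 * (C₂ * (2 * M + 2) + C₃ * C₁) : ℝ≥0) : ℝ≥0∞) * K ^ 6 * l ^ 2 * E := by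
          push_cast; ring
      _ ≤ _ := by gcongr

/-- Level set estimate for two groups of pieces with separated slopes. -/
lemma exists_bilinear_set (M : ℕ) : ∃ C : ℝ≥0,
    ∀ {ι : Type} [Fintype ι] [DecidableEq ι] {a y s : ι → ℝ} {K m : ℕ} {δ s₀ κ σ : ℝ}
      {g : ι → Bool},
    Conf a y s K m M δ → 0 < κ →
    (∀ i, s₀ ≤ s i ∧ s i ≤ s₀ + κ) → δ * (K : ℝ) ^ m ≤ 2 * κ →
    (∀ i, g i = true → s i ≤ σ) → (∀ i, g i = false → σ + κ / K ≤ s i) →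
    ∀ F : ι → E2 → ℂ,
    (∀ i, BL (box (pt a y i) (s i) (7 * scl K m 0) (7 * δ)) (F i)) →
    ∀ (b : ι → ℝ≥0∞) (β : ℝ≥0∞), β ≠ ⊤ → (∀ i x, ‖F i x‖ₑ ^ 2 ≤ b i) → ∑ i, b i ≤ β →
    ∀ (α : ℝ≥0∞) (Ω : Set E2), MeasurableSet Ω →
    (∀ x ∈ Ω, α ≤ ‖∑ i with g i = true, F i x‖ₑ ∧ α ≤ ‖∑ i with g i = false, F i x‖ₑ) →
    α ^ 6 * volume Ω ≤ C * K ^ 9 * β ^ 2 * ∑ i, ∫⁻ x, ‖F i x‖ₑ ^ 2 := by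
  choose C' hC1 hC' using fun n => exists_bilinear_iter M n 8 3 (by norm_num) le_rfl
  set C : ℝ≥0 := ∑ n ∈ Finset.range (M + 1), C' n with hC
  obtain ⟨w, hw⟩ : ∃ w : ℝ≥0, (w : ℝ≥0∞) = wtMass := ⟨wtMass.toNNReal,
    ENNReal.coe_toNNReal wtMass_lt_top.ne⟩
  refine ⟨(C ^ 3 + C ^ 4) * (49 * (w + 1) ^ 2) * 31, fun {ι _ _ a y s K m δ s₀ κ σ g}
    hcf hκ hs hκ2 hgt hgf F hF b β hβ hb hbβ α Ω hΩ hx => ?_⟩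
  have hCm : C' m ≤ C := Finset.single_le_sum (f := C') (fun _ _ => zero_le)
    (Finset.mem_range.2 (by have := hcf.m_le; omega))
  have hC0 : 1 ≤ C := (hC1 m).trans hCm
  have hK := hcf.K_pos
  have hKn : 1 ≤ K := by have := hcf.two_le; omega
  have hK1 : (1 : ℝ≥0∞) ≤ K := by exact_mod_cast hKn
  have hA := scl_pos hcf.two_le m 0
  set E := ∑ i, ∫⁻ x, ‖F i x‖ₑ ^ 2 with hE
  have hcard : ∀ ξ, ∀ t ⊆ (Finset.univ : Finset ι), (∀ i ∈ t, ξ ∈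
      box (pt a y i) (s i) (7 * scl K m 0) (7 * δ)) → t.card ≤ 31 * K := fun ξ t _ hξ =>
    hcf.card_box_le (B := fun _ => 7 * δ) 7 t ξ fun i hi => by exact_mod_cast hξ i hi
  have hsq : ∀ t : Finset ι, ∫⁻ x, ‖∑ i ∈ t, F i x‖ₑ ^ 2 ≤
      (31 * K : ℕ) * ∑ i ∈ t, ∫⁻ x, ‖F i x‖ₑ ^ 2 := fun t =>
    BL.lintegral_sum_sq_le t (fun i _ => hF i) _ fun ξ u _ => hcard ξ u (Finset.subset_univ _)
  rcases Ω.eq_empty_or_nonempty with rfl | ⟨x₀, hx₀⟩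
  · simp
  have hα : α ≠ ⊤ := ((hx x₀ hx₀).1.trans_lt enorm_lt_top).ne
  by_cases hα0 : α = 0
  · simp [hα0]
  have hβ0 : β ≠ 0 := fun h0 => hα0 <| by
    have hF0 : ∀ i x, F i x = 0 := fun i x => by
      have h1 : b i ≤ 0 := (Finset.single_le_sum (f := b) (fun _ _ => zero_le)
        (Finset.mem_univ i)).trans (hbβ.trans h0.le)
      simpa using (hb i x).trans h1
    simpa [hF0] using (hx x₀ hx₀).1
  set β₀ : ℝ≥0∞ := (w + 1) * (7 * K * β) with hβ₀
  have hβ₀0 : β₀ ≠ 0 := by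
    rw [hβ₀]; refine mul_ne_zero (by simp) (mul_ne_zero (mul_ne_zero (by simp) ?_) hβ0)
    exact (one_pos.trans_le hK1).ne'
  have hβ₀t : β₀ ≠ ⊤ := by
    rw [hβ₀]
    exact ENNReal.mul_ne_top (by simp) (ENNReal.mul_ne_top (ENNReal.mul_ne_top (by simp) (by simp)) hβ)
  have hK69 : (K : ℝ≥0∞) ^ 3 ≤ K ^ 9 := pow_le_pow_right₀ hK1 (by norm_num)
  by_cases hcase : (C : ℝ≥0∞) ^ 2 * β₀ ≤ α ^ 2
  · obtain ⟨r, Δ, h⟩ := exists_pieces a s g (scl K m 0)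
    set U : ι → E2 → ℂ := fun j x => ∑ i with r i = j, F i x with hU
    have hUB : ∀ j, BL (box (pt a y j) (s j) ((8 : ℕ) * scl K m 0)
        ((8 : ℕ) * (scl K m 0 * Δ j + δ))) (U j) := fun j => by
      refine BL.sum _ fun i hi => ?_
      simp only [Finset.mem_filter, Finset.mem_univ, true_and] at hi
      refine (hF i).mono ?_
      have := h.box_subset_zero hcf hA (c := 7) i
      rw [hi] at this
      convert this using 2 <;> norm_num
    have hG : ∀ x, ∑ p, lsq (s p) (scl K m 0) (scl K m 0 * Δ p + δ) 3 (U p) x ≤ β₀ := fun x => by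
      have hU2 : ∀ j x, ‖U j x‖ₑ ^ 2 ≤ 7 * K * ∑ i with r i = j, b i := fun j x => by
        have hc7 : (Finset.univ.filter fun i => r i = j).card ≤ 7 * K := by
          refine hcf.card_box_le (B := fun i => |pt a y j 1 - pt a y i 1 - s i *
            (pt a y j 0 - pt a y i 0)|) 1 _ (pt a y j) fun i hi => ?_
          simp only [Finset.mem_filter, Finset.mem_univ, true_and] at hi
          have e1 := h.sub_lt hA hcf.a_nonneg i
          have e2 := h.rep_le i
          rw [hi] at e1 e2
          refine ⟨?_, le_rfl⟩
          change |a j - a i| ≤ _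
          rw [abs_le]; push_cast; constructor <;> linarith
        calc ‖U j x‖ₑ ^ 2 ≤ (∑ i with r i = j, ‖F i x‖ₑ) ^ 2 := by
              gcongr; exact enorm_sum_le _ _
          _ ≤ (Finset.univ.filter fun i => r i = j).card * ∑ i with r i = j, ‖F i x‖ₑ ^ 2 := by
              have := sq_sum_le_card_mul_sum_sq (s := Finset.univ.filter fun i => r i = j)
                (f := fun i => ‖F i x‖₊)
              simp only [enorm_eq_nnnorm]
              exact_mod_cast this
          _ ≤ (7 * K : ℕ) * ∑ i with r i = j, b i := by
              gcongr with i; exact hb i x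
          _ = _ := by push_cast; ring
      calc ∑ p, lsq (s p) (scl K m 0) (scl K m 0 * Δ p + δ) 3 (U p) x
          ≤ ∑ p, w * (7 * K * ∑ i with r i = p, b i) := by
            refine Finset.sum_le_sum fun p _ => ?_
            unfold lsq cv
            calc _ ≤ ∫⁻ z, wt (s p) (scl K m 0) (scl K m 0 * Δ p + δ) 3 (x - z) *
                  (7 * K * ∑ i with r i = p, b i) := by
                  gcongr with z; exact hU2 p z
              _ = (∫⁻ z, wt (s p) (scl K m 0) (scl K m 0 * Δ p + δ) 3 z) *
                  (7 * K * ∑ i with r i = p, b i) := by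
                  rw [← lintegral_sub_left_eq_self
                    (fun z => wt (s p) (scl K m 0) (scl K m 0 * Δ p + δ) 3 z) x]
                  exact lintegral_mul_const _
                    ((measurable_wt _ _ _ _).comp (measurable_const_sub x))
              _ ≤ _ := by
                  gcongr
                  rw [hw]
                  exact lintegral_wt_le hA (h.width_pos hcf.delta_pos hA p) le_rfl
        _ = w * (7 * K * ∑ i, b i) := by
            rw [← Finset.mul_sum, ← Finset.mul_sum, sum_fiber_univ]
        _ ≤ β₀ := by rw [hβ₀]; gcongr; exact le_self_add
    have hsum : ∀ (b : Bool) x, ∑ i with g i = b, U i x = ∑ i with g i = b, F i x := fun b x => by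
      rw [hU, sum_fiber r (fun i => g i = b)]
      simp only [h.g_rep]
    have hlα : C * β₀ / α * α = C * β₀ := ENNReal.div_mul_cancel hα0 hα
    have hC0' : (C : ℝ≥0∞) ≠ 0 := by
      have := one_pos.trans_le hC0
      exact_mod_cast this.ne'
    have main := hC' m hcf (by omega) h hκ hs hκ2 hgt hgf U (fun j hj => by
        ext x
        rw [hU]
        simp only
        rw [Finset.filter_false_of_mem]
        · rfl
        · rintro p - rfl; exact hj (h.rep_rep p)) hUB (C * β₀ / α) α β₀
      (ENNReal.div_ne_zero.2 ⟨mul_ne_zero hC0' hβ₀0, hα⟩)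
      (ENNReal.div_ne_top (ENNReal.mul_ne_top (by simp) hβ₀t) hα0) hα hβ₀t
      (by rw [hlα]; gcongr)
      (by
        refine (ENNReal.mul_le_mul_iff_left hα0 hα).1 ?_
        rw [mul_assoc, hlα]
        calc C' m * (C * β₀) ≤ C * (C * β₀) := by gcongr
          _ = C ^ 2 * β₀ := by ring
          _ ≤ α ^ 2 := hcase
          _ = α * α := sq α) Ω hΩ (fun x hxΩ => by
        rw [hsum, hsum]; exact ⟨(hx x hxΩ).1, (hx x hxΩ).2, hG x⟩)
    calc α ^ 6 * volume Ω = α ^ 2 * (α ^ 4 * volume Ω) := by ring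
      _ ≤ α ^ 2 * (C' m * K ^ 6 * (C * β₀ / α) ^ 2 * ∑ j, ∫⁻ x, ‖U j x‖ₑ ^ 2) := by gcongr
      _ = C' m * K ^ 6 * (C * β₀ / α * α) ^ 2 * ∑ j, ∫⁻ x, ‖U j x‖ₑ ^ 2 := by ring
      _ ≤ C * K ^ 6 * (C * β₀) ^ 2 * ((31 * K : ℕ) * E) := by
        rw [hlα]
        gcongr
        calc ∑ j, ∫⁻ x, ‖U j x‖ₑ ^ 2
            ≤ ∑ j, (31 * K : ℕ) * ∑ i with r i = j, ∫⁻ x, ‖F i x‖ₑ ^ 2 :=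
              Finset.sum_le_sum fun j _ => hsq _
          _ = _ := by rw [← Finset.mul_sum, sum_fiber_univ]
      _ = ((C ^ 3 * (49 * (w + 1) ^ 2) * 31 : ℝ≥0) : ℝ≥0∞) * K ^ 9 * β ^ 2 * E := by
        rw [hβ₀]; push_cast; ring
      _ ≤ _ := by gcongr; exact le_self_add
  · have hlt := (not_le.1 hcase).le
    have hch : α ^ 2 * volume Ω ≤ (31 * K : ℕ) * E := by
      calc α ^ 2 * volume Ω ≤ α ^ 2 * volume {x | α ^ 2 ≤ ‖∑ i with g i = true, F i x‖ₑ ^ 2} := by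
            gcongr
            exact fun x hxΩ => pow_le_pow_left' (hx x hxΩ).1 2
        _ ≤ ∫⁻ x, ‖∑ i with g i = true, F i x‖ₑ ^ 2 :=
            mul_meas_ge_le_lintegral (by
              have : Measurable fun x => ∑ i with g i = true, F i x :=
                Finset.measurable_fun_sum _ fun i _ => (hF i).continuous.measurable
              fun_prop) _
        _ ≤ _ := (hsq _).trans (mul_le_mul_right (Finset.sum_le_univ_sum_of_nonneg fun _ => zero_le) _)
    calc α ^ 6 * volume Ω = (α ^ 2) ^ 2 * (α ^ 2 * volume Ω) := by ring
      _ ≤ (C ^ 2 * β₀) ^ 2 * ((31 * K : ℕ) * E) := by gcongr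
      _ = ((C ^ 4 * (49 * (w + 1) ^ 2) * 31 : ℝ≥0) : ℝ≥0∞) * K ^ 3 * β ^ 2 * E := by
        rw [hβ₀]; push_cast; ring
      _ ≤ _ := by gcongr; exact le_add_self

/-- Either one term, or two terms with non-adjacent indices, dominate a sum. -/
lemma exists_dominant {K : ℕ} (hK : 1 ≤ K) (z : ℕ → ℂ) :
    (∃ J ∈ Finset.range (K + 1), ‖∑ j ∈ Finset.range (K + 1), z j‖ ≤ 4 * ‖z J‖) ∨
    ∃ J ∈ Finset.range (K + 1), ∃ J' ∈ Finset.range (K + 1), J + 2 ≤ J' ∧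
      ‖∑ j ∈ Finset.range (K + 1), z j‖ ≤ 8 * K * ‖z J‖ ∧
      ‖∑ j ∈ Finset.range (K + 1), z j‖ ≤ 8 * K * ‖z J'‖ := by
  set S := ‖∑ j ∈ Finset.range (K + 1), z j‖ with hS
  obtain ⟨J, hJ, hmax⟩ := Finset.exists_max_image (Finset.range (K + 1)) (fun j => ‖z j‖)
    ⟨0, by simp⟩
  have hK1 : (1 : ℝ) ≤ K := by exact_mod_cast hK
  by_cases h4 : S ≤ 4 * ‖z J‖
  · exact Or.inl ⟨J, hJ, h4⟩
  push Not at h4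
  right
  suffices ∃ J' ∈ Finset.range (K + 1), (J + 2 ≤ J' ∨ J' + 2 ≤ J) ∧ S ≤ 8 * K * ‖z J'‖ by
    obtain ⟨J', hJ', hf, hle⟩ := this
    have hle' : S ≤ 8 * K * ‖z J‖ := hle.trans (by
      have := hmax J' hJ'; gcongr)
    rcases hf with hf | hf
    · exact ⟨J, hJ, J', hJ', hf, hle', hle⟩
    · exact ⟨J', hJ', J, hJ, hf, hle, hle'⟩
  by_contra! hcon
  set near := (Finset.range (K + 1)).filter fun j => ¬ (J + 2 ≤ j ∨ j + 2 ≤ J) with hnear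
  set far := (Finset.range (K + 1)).filter fun j => (J + 2 ≤ j ∨ j + 2 ≤ J) with hfar
  have hcn : near.card ≤ 3 := by
    calc near.card ≤ (Finset.Icc (J - 1) (J + 1)).card := Finset.card_le_card fun j hj => by
          simp only [hnear, Finset.mem_filter, Finset.mem_range, Finset.mem_Icc] at hj ⊢; omega
      _ ≤ 3 := by rw [Nat.card_Icc]; omega
  have hcf : far.card ≤ 2 * K := by
    calc far.card ≤ (Finset.range (K + 1)).card := Finset.card_filter_le _ _
      _ ≤ 2 * K := by rw [Finset.card_range]; omega
  have h1 : ∑ j ∈ near, ‖z j‖ ≤ 3 * ‖z J‖ := by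
    calc ∑ j ∈ near, ‖z j‖ ≤ ∑ j ∈ near, ‖z J‖ :=
          Finset.sum_le_sum fun j hj => hmax j (Finset.mem_filter.1 hj).1
      _ = near.card * ‖z J‖ := by rw [Finset.sum_const, nsmul_eq_mul]
      _ ≤ 3 * ‖z J‖ := by gcongr; exact_mod_cast hcn
  have h2 : ∑ j ∈ far, ‖z j‖ ≤ S / 4 := by
    have hS0 : 0 ≤ S := norm_nonneg _
    calc ∑ j ∈ far, ‖z j‖ ≤ ∑ j ∈ far, S / (8 * K) :=
          Finset.sum_le_sum fun j hj => by
            rw [le_div_iff₀ (by positivity), mul_comm]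
            exact (hcon j (Finset.mem_filter.1 hj).1 (Finset.mem_filter.1 hj).2).le
      _ = far.card * (S / (8 * K)) := by rw [Finset.sum_const, nsmul_eq_mul]
      _ ≤ (2 * K : ℕ) * (S / (8 * K)) := by gcongr
      _ = S / 4 := by push_cast; field_simp; ring
  have h3 : S ≤ ∑ j ∈ far, ‖z j‖ + ∑ j ∈ near, ‖z j‖ := by
    rw [hfar, hnear, Finset.sum_filter_add_sum_filter_not]
    exact norm_sum_le _ _
  linarith

lemma sum_subtype_filter {ι α : Type} [Fintype ι] [AddCommMonoid α] (p q : ι → Prop)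
    [DecidablePred p] [DecidablePred q] [Fintype {i // p i}] (f : ι → α) :
    ∑ i : {i // p i} with q i.1, f i.1 = ∑ i with p i ∧ q i, f i := by
  rw [Finset.sum_filter, ← Finset.filter_filter, Finset.sum_filter (p := q)]
  exact (Finset.sum_subtype (Finset.univ.filter p) (by simp) fun i => if q i then f i else 0).symm

lemma sum_subtype_univ {ι α : Type} [Fintype ι] [AddCommMonoid α] (p : ι → Prop)
    [DecidablePred p] [Fintype {i // p i}] (f : ι → α) :
    ∑ i : {i // p i}, f i.1 = ∑ i with p i, f i :=
  (Finset.sum_subtype (Finset.univ.filter p) (by simp) f).symm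

lemma sq_enorm_sum_le {ι : Type*} (t : Finset ι) (z : ι → ℂ) :
    ‖∑ i ∈ t, z i‖ₑ ^ 2 ≤ t.card * ∑ i ∈ t, ‖z i‖ₑ ^ 2 := by
  have := sq_sum_le_card_mul_sum_sq (s := t) (f := fun i => ‖z i‖₊)
  calc ‖∑ i ∈ t, z i‖ₑ ^ 2 ≤ (∑ i ∈ t, ‖z i‖ₑ) ^ 2 := by gcongr; exact enorm_sum_le _ _
    _ ≤ _ := by simp only [enorm_eq_nnnorm]; exact_mod_cast this

lemma Conf.card_le_two {ι : Type} [Fintype ι] {a y s : ι → ℝ} {K m M : ℕ} {δ s₀ κ : ℝ}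
    (hc : Conf a y s K m M δ) (hs : ∀ i, s₀ ≤ s i ∧ s i ≤ s₀ + κ) (hκ : κ < δ * (K : ℝ) ^ m) :
    Fintype.card ι ≤ 2 := by
  by_contra! h
  have key : ∀ i j k, a i < a j → a j < a k → False := fun i j k h1 h2 => by
    have := hc.three i j k h1 h2
    linarith [(hs k).2, (hs i).1]
  obtain ⟨i, j, k, hij, hik, hjk⟩ := Fintype.two_lt_card_iff.1 h
  have e1 := fun h => hij (hc.injective h)
  have e2 := fun h => hik (hc.injective h)
  have e3 := fun h => hjk (hc.injective h)
  rcases lt_or_gt_of_ne e1 with h1 | h1 <;> rcases lt_or_gt_of_ne e2 with h2 | h2 <;>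
    rcases lt_or_gt_of_ne e3 with h3 | h3
  · exact key _ _ _ h1 h3
  · exact key _ _ _ h2 h3
  · exact key _ _ _ (h1.trans h3) (h2) |>.elim
  · exact key _ _ _ h2 h1
  · exact key _ _ _ h1 h2
  · exact key _ _ _ (h3.trans h1) h2 |>.elim
  · exact key _ _ _ h3 h2
  · exact key _ _ _ h3 h1

lemma level_set_of_card_le_two {ι : Type} [Fintype ι] (hι : Fintype.card ι ≤ 2)
    (F : ι → E2 → ℂ) (hF : ∀ i, Measurable (F i)) (b : ι → ℝ≥0∞) (β : ℝ≥0∞)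
    (hb : ∀ i x, ‖F i x‖ₑ ^ 2 ≤ b i) (hβ : ∑ i, b i ≤ β) (α : ℝ≥0∞) :
    α ^ 6 * volume {x | α ≤ ‖∑ i, F i x‖ₑ} ≤ 8 * β ^ 2 * ∑ i, ∫⁻ x, ‖F i x‖ₑ ^ 2 := by
  have h1 : ∀ x, ‖∑ i, F i x‖ₑ ^ 2 ≤ 2 * ∑ i, ‖F i x‖ₑ ^ 2 := fun x =>
    (sq_enorm_sum_le _ _).trans (by gcongr; exact_mod_cast hι)
  calc α ^ 6 * volume {x | α ≤ ‖∑ i, F i x‖ₑ}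
      ≤ α ^ 6 * volume {x | α ^ 6 ≤ ‖∑ i, F i x‖ₑ ^ 6} := by
        exact mul_le_mul_right (measure_mono
          fun x (hx : α ≤ ‖∑ i, F i x‖ₑ) => pow_le_pow_left' hx 6) _
    _ ≤ ∫⁻ x, ‖∑ i, F i x‖ₑ ^ 6 := mul_meas_ge_le_lintegral (by fun_prop) _
    _ ≤ ∫⁻ x, (2 * β) ^ 2 * (2 * ∑ i, ‖F i x‖ₑ ^ 2) := by
        refine lintegral_mono fun x => ?_
        calc ‖∑ i, F i x‖ₑ ^ 6 = (‖∑ i, F i x‖ₑ ^ 2) ^ 2 * ‖∑ i, F i x‖ₑ ^ 2 := by ring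
          _ ≤ (2 * β) ^ 2 * (2 * ∑ i, ‖F i x‖ₑ ^ 2) := by
            gcongr
            · exact (h1 x).trans (by
                gcongr; exact (Finset.sum_le_sum fun i _ => hb i x).trans hβ)
            · exact h1 x
    _ = 8 * β ^ 2 * ∑ i, ∫⁻ x, ‖F i x‖ₑ ^ 2 := by
        rw [lintegral_const_mul _ (by fun_prop), lintegral_const_mul _ (by fun_prop),
          lintegral_finsetSum' _ (by fun_prop)]
        ring

lemma exists_level_set_iter (M n : ℕ) : ∃ C : ℝ≥0,
    ∀ {ι : Type} [Fintype ι] {a y s : ι → ℝ} {K m : ℕ} {δ s₀ κ : ℝ},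
    Conf a y s K m M δ → 0 < κ → (∀ i, s₀ ≤ s i ∧ s i ≤ s₀ + κ) →
    κ < δ * (K : ℝ) ^ m * (K : ℝ) ^ n →
    ∀ F : ι → E2 → ℂ,
    (∀ i, BL (box (pt a y i) (s i) (7 * scl K m 0) (7 * δ)) (F i)) →
    ∀ (b : ι → ℝ≥0∞) (β : ℝ≥0∞), β ≠ ⊤ → (∀ i x, ‖F i x‖ₑ ^ 2 ≤ b i) → ∑ i, b i ≤ β →
    ∀ α : ℝ≥0∞, α ^ 6 * volume {x | α ≤ ‖∑ i, F i x‖ₑ} ≤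
      C * K ^ 17 * β ^ 2 * ∑ i, ∫⁻ x, ‖F i x‖ₑ ^ 2 := by
  induction n with
  | zero =>
    refine ⟨8, fun {ι _ a y s K m δ s₀ κ} hcf hκ hs hκn F hF b β hβt hb hβ α => ?_⟩
    have hK1 : (1 : ℝ≥0∞) ≤ K := by exact_mod_cast (by have := hcf.two_le; omega : 1 ≤ K)
    refine (level_set_of_card_le_two (hcf.card_le_two hs (by simpa using hκn)) F
      (fun i => (hF i).continuous.measurable) b β hb hβ α).trans ?_
    gcongr
    exact le_mul_of_one_le_right zero_le (one_le_pow₀ hK1)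
  | succ n ih =>
    obtain ⟨C₁, h₁⟩ := ih
    obtain ⟨C₂, h₂⟩ := exists_bilinear_set M
    refine ⟨4 ^ 6 * C₁ + 8 ^ 6 * 4 * C₂ + 8, fun {ι _ a y s K m δ s₀ κ} hcf hκ hs hκn F hF b β
      hβt hb hβ α => ?_⟩
    classical
    have hKn : 1 ≤ K := by have := hcf.two_le; omega
    have hK1 : (1 : ℝ≥0∞) ≤ K := by exact_mod_cast hKn
    have hK := hcf.K_pos
    have hFm := fun i => (hF i).continuous.measurable
    by_cases hsm : κ < δ * (K : ℝ) ^ m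
    · refine (level_set_of_card_le_two (hcf.card_le_two hs hsm) F hFm b β hb hβ α).trans ?_
      gcongr
      calc (8 : ℝ≥0∞) ≤ 8 * K ^ 17 := le_mul_of_one_le_right zero_le (one_le_pow₀ hK1)
        _ ≤ _ := by gcongr; push_cast; exact le_add_self
    push Not at hsm
    set nd : ι → ℕ := fun i => ⌊(s i - s₀) * K / κ⌋₊ with hnd
    have hnd1 : ∀ i, s₀ + nd i * (κ / K) ≤ s i := fun i => by
      have h0 : 0 ≤ (s i - s₀) * K / κ := by
        have := (hs i).1; have := sub_nonneg.2 this; positivity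
      have := Nat.floor_le h0
      rw [le_div_iff₀ hκ] at this
      rw [← le_sub_iff_add_le', ← mul_div_assoc, div_le_iff₀ hK]
      exact this
    have hnd2 : ∀ i, s i ≤ s₀ + nd i * (κ / K) + κ / K := fun i => by
      have := Nat.lt_floor_add_one ((s i - s₀) * K / κ)
      rw [div_lt_iff₀ hκ] at this
      have h2 : s i - s₀ < (nd i + 1) * κ / K := by rw [lt_div_iff₀ hK]; exact this
      have h3 : (nd i + 1) * κ / K = nd i * (κ / K) + κ / K := by ring
      linarith
    have hndr : ∀ i, nd i ∈ Finset.range (K + 1) := fun i => by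
      rw [Finset.mem_range, Nat.lt_succ_iff]
      refine Nat.floor_le_of_le ?_
      rw [div_le_iff₀ hκ, mul_comm]
      have := (hs i).2
      gcongr; linarith
    set Z : ℕ → E2 → ℂ := fun J x => ∑ i with nd i = J, F i x with hZ
    have hZs : ∀ x, ∑ J ∈ Finset.range (K + 1), Z J x = ∑ i, F i x := fun x =>
      Finset.sum_fiberwise_of_maps_to (fun i _ => hndr i) _
    have hZm : ∀ J, Measurable (Z J) := fun J => Finset.measurable_fun_sum _ fun i _ => hFm i
    set E := ∑ i, ∫⁻ x, ‖F i x‖ₑ ^ 2 with hE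
    have hone : ∀ J, (α / 4) ^ 6 * volume {x | α / 4 ≤ ‖Z J x‖ₑ} ≤
        C₁ * K ^ 17 * β ^ 2 * ∑ i with nd i = J, ∫⁻ x, ‖F i x‖ₑ ^ 2 := fun J => by
      have := h₁ (ι := {i // nd i = J}) (hcf.comp Subtype.val_injective) (κ := κ / K)
        (s₀ := s₀ + J * (κ / K)) (by positivity)
        (fun i => by
          have h1 := hnd1 i.1; have h2 := hnd2 i.1
          rw [i.2] at h1 h2; exact ⟨h1, h2⟩)
        (by rw [div_lt_iff₀ hK]; rw [pow_succ] at hκn; linarith)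
        (fun i => F i.1) (fun i => hF i.1) (fun i => b i.1) β hβt (fun i => hb i.1)
        (by
          rw [sum_subtype_univ (fun i => nd i = J) b]
          exact (Finset.sum_le_univ_sum_of_nonneg fun _ => zero_le).trans hβ) (α / 4)
      have e : ∀ x, ∑ i : {i // nd i = J}, F i.1 x = Z J x := fun x =>
        sum_subtype_univ (fun i => nd i = J) (fun i => F i x)
      simpa only [e, sum_subtype_univ (fun i => nd i = J) (fun i => ∫⁻ x, ‖F i x‖ₑ ^ 2)]
        using this
    have htwo : ∀ J J', J + 2 ≤ J' → (α / (8 * K)) ^ 6 *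
        volume ({x | α / (8 * K) ≤ ‖Z J x‖ₑ} ∩ {x | α / (8 * K) ≤ ‖Z J' x‖ₑ}) ≤
        C₂ * K ^ 9 * β ^ 2 * E := fun J J' hJJ => by
      have := h₂ (ι := {i // nd i = J ∨ nd i = J'}) (hcf.comp Subtype.val_injective) (κ := κ)
        (s₀ := s₀) (σ := s₀ + J * (κ / K) + κ / K) (g := fun i => decide (nd i.1 = J)) hκ
        (fun i => hs i.1) (hsm.trans (by linarith))
        (fun i hi => by
          have := hnd2 i.1
          rwa [of_decide_eq_true hi] at this)
        (fun i hi => by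
          have hi' : nd i.1 = J' := i.2.resolve_left (of_decide_eq_false hi)
          have := hnd1 i.1
          rw [hi'] at this
          refine le_trans ?_ this
          have h2 : (J : ℝ) + 2 ≤ J' := by exact_mod_cast hJJ
          have h3 : 0 < κ / K := by positivity
          nlinarith)
        (fun i => F i.1) (fun i => hF i.1) (fun i => b i.1) β hβt (fun i => hb i.1)
        (by
          rw [sum_subtype_univ (fun i => nd i = J ∨ nd i = J') b]
          exact (Finset.sum_le_univ_sum_of_nonneg fun _ => zero_le).trans hβ) (α / (8 * K))
        ({x | α / (8 * K) ≤ ‖Z J x‖ₑ} ∩ {x | α / (8 * K) ≤ ‖Z J' x‖ₑ})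
        ((measurableSet_le measurable_const (hZm J).enorm).inter
          (measurableSet_le measurable_const (hZm J').enorm))
        (fun x hx => by
          have e1 : ∀ v : ι → ℂ, ∑ i : {i // nd i = J ∨ nd i = J'} with decide (nd i.1 = J) = true,
              v i.1 = ∑ i with nd i = J, v i := fun v => by
            rw [sum_subtype_filter (fun i => nd i = J ∨ nd i = J')
              (fun i => decide (nd i = J) = true) v]
            refine Finset.sum_congr (Finset.filter_congr fun i _ => ?_) fun _ _ => rfl
            simp only [decide_eq_true_eq]; tauto
          have e2 : ∀ v : ι → ℂ, ∑ i : {i // nd i = J ∨ nd i = J'} with decide (nd i.1 = J) = false,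
              v i.1 = ∑ i with nd i = J', v i := fun v => by
            rw [sum_subtype_filter (fun i => nd i = J ∨ nd i = J')
              (fun i => decide (nd i = J) = false) v]
            refine Finset.sum_congr (Finset.filter_congr fun i _ => ?_) fun _ _ => rfl
            simp only [decide_eq_false_iff_not]; omega
          rw [e1 (fun i => F i x), e2 (fun i => F i x)]
          exact hx)
      refine this.trans ?_
      gcongr
      rw [sum_subtype_univ (fun i => nd i = J ∨ nd i = J') (fun i => ∫⁻ x, ‖F i x‖ₑ ^ 2)]
      exact Finset.sum_le_univ_sum_of_nonneg fun _ => zero_le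
    have hcov : {x | α ≤ ‖∑ i, F i x‖ₑ} ⊆
        (⋃ J ∈ Finset.range (K + 1), {x | α / 4 ≤ ‖Z J x‖ₑ}) ∪
        ⋃ p ∈ (Finset.range (K + 1) ×ˢ Finset.range (K + 1)).filter fun p => p.1 + 2 ≤ p.2,
          ({x | α / (8 * K) ≤ ‖Z p.1 x‖ₑ} ∩ {x | α / (8 * K) ≤ ‖Z p.2 x‖ₑ}) := fun x hx => by
      have hx' : α ≤ ‖∑ J ∈ Finset.range (K + 1), Z J x‖ₑ := by rw [hZs]; exact hx
      have conv : ∀ (k : ℕ) (z : ℂ), ‖∑ J ∈ Finset.range (K + 1), Z J x‖ ≤ k * ‖z‖ →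
          α / k ≤ ‖z‖ₑ := fun k z hz => by
        refine ENNReal.div_le_of_le_mul' (hx'.trans ?_)
        rw [enorm_eq_nnnorm, enorm_eq_nnnorm]
        have : ‖∑ J ∈ Finset.range (K + 1), Z J x‖₊ ≤ k * ‖z‖₊ := by
          rw [← NNReal.coe_le_coe]; push_cast; exact hz
        exact_mod_cast this
      rcases exists_dominant hKn (fun J => Z J x) with ⟨J, hJ, h4⟩ | ⟨J, hJ, J', hJ', hJJ, h5, h6⟩
      · left
        simp only [mem_iUnion]
        exact ⟨J, hJ, by simpa using conv 4 _ (by exact_mod_cast h4)⟩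
      · right
        simp only [mem_iUnion]
        refine ⟨(J, J'), by simp only [Finset.mem_filter, Finset.mem_product]; exact ⟨⟨hJ, hJ'⟩, hJJ⟩,
          ?_, ?_⟩
        · have := conv (8 * K) _ (by push_cast; exact h5)
          push_cast at this; exact this
        · have := conv (8 * K) _ (by push_cast; exact h6)
          push_cast at this; exact this
    have hK0 : (K : ℝ≥0∞) ≠ 0 := (one_pos.trans_le hK1).ne'
    have q4 : α = 4 * (α / 4) := (ENNReal.mul_div_cancel (by simp) (by simp)).symm
    have q8 : α = 8 * K * (α / (8 * K)) :=
      (ENNReal.mul_div_cancel (by simp [hK0]) (ENNReal.mul_ne_top (by simp) (by simp))).symm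
    set P := (Finset.range (K + 1) ×ˢ Finset.range (K + 1)).filter fun p : ℕ × ℕ => p.1 + 2 ≤ p.2
    have hP : P.card ≤ 4 * K ^ 2 := by
      calc P.card ≤ (K + 1) * (K + 1) := by
            refine (Finset.card_filter_le _ _).trans ?_
            rw [Finset.card_product, Finset.card_range]
        _ ≤ 4 * K ^ 2 := by nlinarith
    calc α ^ 6 * volume {x | α ≤ ‖∑ i, F i x‖ₑ}
        ≤ α ^ 6 * (∑ J ∈ Finset.range (K + 1), volume {x | α / 4 ≤ ‖Z J x‖ₑ} +
            ∑ p ∈ P, volume ({x | α / (8 * K) ≤ ‖Z p.1 x‖ₑ} ∩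
              {x | α / (8 * K) ≤ ‖Z p.2 x‖ₑ})) := by
          refine mul_le_mul_right ((measure_mono hcov).trans ((measure_union_le _ _).trans ?_)) _
          exact add_le_add (measure_biUnion_finset_le _ _) (measure_biUnion_finset_le _ _)
      _ = 4 ^ 6 * ∑ J ∈ Finset.range (K + 1), (α / 4) ^ 6 * volume {x | α / 4 ≤ ‖Z J x‖ₑ} +
          (8 * (K : ℝ≥0∞)) ^ 6 * ∑ p ∈ P, (α / (8 * K)) ^ 6 *
            volume ({x | α / (8 * K) ≤ ‖Z p.1 x‖ₑ} ∩ {x | α / (8 * K) ≤ ‖Z p.2 x‖ₑ}) := by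
          rw [mul_add, ← Finset.mul_sum, ← Finset.mul_sum, ← mul_assoc, ← mul_assoc, ← mul_pow,
            ← mul_pow, ← q4, ← q8]
      _ ≤ 4 ^ 6 * (∑ J ∈ Finset.range (K + 1),
            C₁ * K ^ 17 * β ^ 2 * ∑ i with nd i = J, ∫⁻ x, ‖F i x‖ₑ ^ 2) +
          (8 * (K : ℝ≥0∞)) ^ 6 * ∑ p ∈ P, C₂ * K ^ 9 * β ^ 2 * E := by
          exact add_le_add (mul_le_mul_right (Finset.sum_le_sum fun J _ => hone J) _)
            (mul_le_mul_right (Finset.sum_le_sum fun p hp =>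
              htwo _ _ (Finset.mem_filter.1 hp).2) _)
      _ = 4 ^ 6 * (C₁ * K ^ 17 * β ^ 2 * E) +
          (8 * (K : ℝ≥0∞)) ^ 6 * (P.card * (C₂ * K ^ 9 * β ^ 2 * E)) := by
          rw [← Finset.mul_sum, Finset.sum_fiberwise_of_maps_to (fun i _ => hndr i),
            Finset.sum_const, nsmul_eq_mul]
      _ ≤ 4 ^ 6 * (C₁ * K ^ 17 * β ^ 2 * E) +
          (8 * (K : ℝ≥0∞)) ^ 6 * ((4 * K ^ 2 : ℕ) * (C₂ * K ^ 9 * β ^ 2 * E)) := by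
          exact add_le_add le_rfl (mul_le_mul_right
            (mul_le_mul_left (by exact_mod_cast hP) _) _)
      _ = ((4 ^ 6 * C₁ + 8 ^ 6 * 4 * C₂ : ℝ≥0) : ℝ≥0∞) * K ^ 17 * β ^ 2 * E := by
          push_cast; ring
      _ ≤ _ := mul_le_mul_left (mul_le_mul_left (mul_le_mul_left
          (ENNReal.coe_le_coe.2 le_self_add) _) _) _

/-- The level set estimate for one family of tiles. -/
lemma exists_level_set (M : ℕ) : ∃ C : ℝ≥0,
    ∀ {ι : Type} [Fintype ι] {a y s : ι → ℝ} {K m : ℕ} {δ : ℝ},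
    Conf a y s K m M δ → ∀ F : ι → E2 → ℂ,
    (∀ i, BL (box (pt a y i) (s i) (7 * scl K m 0) (7 * δ)) (F i)) →
    ∀ (b : ι → ℝ≥0∞) (β : ℝ≥0∞), β ≠ ⊤ → (∀ i x, ‖F i x‖ₑ ^ 2 ≤ b i) → ∑ i, b i ≤ β →
    ∀ α : ℝ≥0∞, α ^ 6 * volume {x | α ≤ ‖∑ i, F i x‖ₑ} ≤
      C * K ^ 17 * β ^ 2 * ∑ i, ∫⁻ x, ‖F i x‖ₑ ^ 2 := by
  obtain ⟨C, hC⟩ := exists_level_set_iter M (M + 1)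
  refine ⟨C, fun {ι _ a y s K m δ} hcf => hC hcf (s₀ := 0) (κ := 1) one_pos
    (fun i => ⟨hcf.s_nonneg i, by simpa using hcf.s_le i⟩) ?_⟩
  have h2 : (2 : ℝ) ≤ K := by exact_mod_cast hcf.two_le
  have h1 : 1 ≤ (K : ℝ) ^ m := one_le_pow₀ (by linarith)
  have h3 := hcf.le_delta
  have h4 := hcf.delta_pos
  calc (1 : ℝ) < 1 * K := by linarith
    _ ≤ (δ * (K : ℝ) ^ M) * K := by gcongr
    _ = δ * 1 * (K : ℝ) ^ (M + 1) := by ring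
    _ ≤ _ := by gcongr

lemma cut_diff {s A B : ℝ} (hA : 0 < A) (hB : 0 < B) {S T : Set E2} (hS : MeasurableSet S)
    (hT : MeasurableSet T) (hST : S ⊆ T) (x : E2) : cut s A B (T \ S) x = cut s A B T x - cut s A B S x := by
  have hi : Integrable fun y => ker 0 s A B (x - y) :=
    (integrable_ker 0 hA hB).comp_sub_left x
  have h : ∀ T : Set E2, (fun y => ker 0 s A B (x - y) * T.indicator 1 y) =
      T.indicator fun y => ker 0 s A B (x - y) := fun T => by
    ext y; by_cases hy : y ∈ T <;> simp [hy]
  unfold cut cnv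
  rw [eq_sub_iff_add_eq, h, h, h, ← integral_add]
  · congr 1; ext y
    by_cases h1 : y ∈ S
    · simp [h1, hST h1]
    · by_cases h2 : y ∈ T <;> simp [h1, h2]
  · exact hi.indicator (hT.diff hS)
  · exact hi.indicator hS

lemma Conf.card_le {ι : Type} [Fintype ι] {a y s : ι → ℝ} {K m M : ℕ} {δ : ℝ}
    (hc : Conf a y s K m M δ) : Fintype.card ι ≤ 7 * K ^ (M + 1) := by
  rcases isEmpty_or_nonempty ι with h | ⟨⟨i₀⟩⟩
  · simp
  have hK := hc.K_pos
  have h := hc.card_box_le (B := fun i => |pt a y i₀ 1 - pt a y i 1 - s i *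
    (pt a y i₀ 0 - pt a y i 0)|) (K ^ m) Finset.univ (pt a y i₀) fun i _ => by
      refine ⟨?_, le_rfl⟩
      change |a i₀ - a i| ≤ _
      have e : ((K ^ m : ℕ) : ℝ) * scl K m 0 = 1 := by
        unfold scl; push_cast; field_simp
      rw [e, abs_le]
      have h1 := hc.a_nonneg i; have h2 := hc.a_lt i
      have h3 := hc.a_nonneg i₀; have h4 := hc.a_lt i₀
      constructor <;> linarith
  rw [Finset.card_univ] at h
  have hK1 : 1 ≤ K := by have := hc.two_le; omega
  calc Fintype.card ι ≤ (4 * K ^ m + 3) * K := h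
    _ ≤ (7 * K ^ m) * K := by
      gcongr
      have := Nat.one_le_pow m K hK1
      omega
    _ = 7 * K ^ (m + 1) := by ring
    _ ≤ 7 * K ^ (M + 1) := by gcongr; exact hc.m_le

lemma lsq_zero (s A B : ℝ) (N : ℕ) {U : E2 → ℂ} (hU : ∀ x, U x = 0) (x : E2) :
    lsq s A B N U x = 0 := by
  simp [lsq, cv, hU]

lemma volume_lsq_lt_top {s A B : ℝ} (hA : 0 < A) (hB : 0 < B) {S : Set E2} {U : E2 → ℂ}
    (hU : BL S U) {l : ℝ≥0∞} (hl : l ≠ 0) (hlt : l ≠ ⊤) :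
    volume {x | l < lsq s A B 3 U x} < ⊤ := by
  have h : ∫⁻ x, lsq s A B 3 U x < ⊤ :=
    (lintegral_cv_wt_le hA hB le_rfl (hU.continuous.measurable.enorm.pow_const 2)).trans_lt
      (ENNReal.mul_lt_top wtMass_lt_top hU.lintegral_sq_lt_top)
  refine (measure_mono fun x hx => (le_of_lt hx : l ≤ lsq s A B 3 U x)).trans_lt ?_
  refine (meas_ge_le_lintegral_div
    (measurable_lsq s A B 3 hU.continuous.measurable).aemeasurable hl hlt).trans_lt ?_
  exact ENNReal.div_lt_top h.ne hl

set_option maxHeartbeats 1000000 in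
lemma exists_level_set_slices (M : ℕ) : ∃ (C : ℝ≥0) (Q : ℕ),
    ∀ {ι : Type} [Fintype ι] {a y s : ι → ℝ} {K m : ℕ} {δ : ℝ},
    Conf a y s K m M δ → ∀ F : ι → E2 → ℂ,
    (∀ i, BL (box (pt a y i) (s i) (3 * scl K m 0) (3 * δ)) (F i)) →
    ∀ d : ι → ℝ≥0, ∑ i, d i ^ 2 ≤ 1 → (∀ i, d i = 0 → ∀ x, F i x = 0) →
    ∀ α : ℝ≥0, α ≠ 0 → (α : ℝ≥0∞) ^ 6 * volume {x | (α : ℝ≥0∞) ≤ ‖∑ i, F i x‖ₑ} ≤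
      C * K ^ 17 * ∑ q ∈ Finset.range (Q + 1), ((α / K ^ q : ℝ≥0) : ℝ≥0∞) ^ 4 * ∑ i,
        ∫⁻ x in {x | ((d i * (α / K ^ (q + 1)) : ℝ≥0) : ℝ≥0∞) ^ 2 <
          lsq (s i) (scl K m 0) δ 3 (F i) x}, lsq (s i) (scl K m 0) δ 3 (F i) x := by
  obtain ⟨C₁, h₁⟩ := exists_level_set M
  obtain ⟨C₂, h₂⟩ := exists_cutoff (a := 3) (by norm_num) (N := 3) le_rfl
  obtain ⟨Q₀, hQ₀⟩ := exists_nat_ge (28 * C₂)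
  set Q := Q₀ + M + 1 with hQ
  refine ⟨16 * 31 * C₂ + (4 * Q) ^ 6 * C₁ * C₂ ^ 5, Q,
    fun {ι _ a y s K m δ} hcf F hF d hd hd0 α hα => ?_⟩
  have hA : 0 < scl K m 0 := scl_pos hcf.two_le m 0
  have hB := hcf.delta_pos
  have hK0 : (K : ℝ≥0) ≠ 0 := by have := hcf.two_le; norm_cast; omega
  have hK1 : (1 : ℝ≥0) ≤ K := by have := hcf.two_le; norm_cast; omega
  set G : ι → E2 → ℝ≥0∞ := fun i => lsq (s i) (scl K m 0) δ 3 (F i) with hG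
  set l : ι → ℕ → ℝ≥0 := fun i q => d i * (α / K ^ q) with hl
  set S : ι → ℕ → Set E2 := fun i q => {x | (l i q : ℝ≥0∞) ^ 2 < G i x} with hS
  have hGm : ∀ i, Measurable (G i) := fun i => measurable_lsq _ _ _ _ (hF i).continuous.measurable
  have hSm : ∀ i q, MeasurableSet (S i q) := fun i q => measurableSet_lt measurable_const (hGm i)
  have hSmono : ∀ i, Monotone (S i) := fun i => monotone_nat_of_le_succ fun q x hx => by
    have hx' : (l i q : ℝ≥0∞) ^ 2 < G i x := hx
    refine lt_of_le_of_lt ?_ hx'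
    have : l i (q + 1) ≤ l i q := by
      simp only [hl]; gcongr
      omega
    gcongr
  have hcut := fun i => h₂ (pt a y i) (s i) (scl K m 0) δ hA hB (F i) (hF i)
  have hBL : ∀ i q T, MeasurableSet T → T ⊆ S i q →
      BL (box (pt a y i) (s i) (7 * scl K m 0) (7 * δ))
        (fun x => F i x * cut (s i) (scl K m 0) δ T x) := fun i q T hT hTS => by
    by_cases h0 : d i = 0
    · simp only [hd0 i h0, zero_mul]; exact BL.zero
    · have hv : volume T < ⊤ := (measure_mono hTS).trans_lt
        (volume_lsq_lt_top hA hB (hF i) (by simp [hl, h0, hα, hK0]) (by finiteness))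
      refine ((hF i).mul (BL_cut hA hB hT hv)).mono (box_add_box_zero.trans ?_)
      exact box_mono (by linarith) (by linarith)
  set X : ι → E2 → ℂ := fun i x => F i x * cut (s i) (scl K m 0) δ (S i 0) x with hX
  set Y : ℕ → ι → E2 → ℂ := fun q i x =>
    F i x * cut (s i) (scl K m 0) δ (S i (q + 1) \ S i q) x with hY
  set Z : ι → E2 → ℂ := fun i x => F i x * cut (s i) (scl K m 0) δ (S i Q)ᶜ x with hZ
  have hdec : ∀ i x, F i x = X i x + ∑ q ∈ Finset.range Q, Y q i x + Z i x := fun i x => by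
    simp only [hX, hY, hZ]
    rw [← Finset.mul_sum, ← mul_add, ← mul_add]
    simp only [fun q => cut_diff (s := s i) hA hB (hSm i q) (hSm i (q + 1)) (hSmono i (Nat.le_succ q)) x]
    rw [Finset.sum_range_sub (fun q => cut (s i) (scl K m 0) δ (S i q) x), add_sub_cancel,
      cut_add_cut_compl hA hB (hSm i Q), mul_one]
  have hXm : Measurable fun x => ∑ i, X i x := Finset.measurable_fun_sum _ fun i _ =>
    (hBL i 0 _ (hSm i 0) le_rfl).continuous.measurable
  have hYBL : ∀ q i, BL (box (pt a y i) (s i) (7 * scl K m 0) (7 * δ)) (Y q i) := fun q i =>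
    hBL i (q + 1) _ ((hSm i _).diff (hSm i _)) sdiff_subset
  have hZs : ∀ x, ‖∑ i, Z i x‖₊ ≤ α / 4 := fun x => by
    have hZ1 : ∀ i, ‖Z i x‖₊ ≤ C₂ * (α / K ^ Q) := fun i => by
      have h := (hcut i (S i Q)ᶜ (hSm i Q).compl).1 (l i Q) (fun y hy => not_lt.1 hy) x
      have h' : ‖Z i x‖₊ ≤ C₂ * l i Q := by
        rw [← ENNReal.coe_le_coe]; push_cast; exact h
      refine h'.trans ?_
      have hd1 : d i ≤ 1 := by
        have := (Finset.single_le_sum (f := fun i => d i ^ 2) (fun _ _ => zero_le)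
          (Finset.mem_univ i)).trans hd
        exact (pow_le_one_iff_of_nonneg zero_le two_ne_zero).1 this
      simp only [hl]
      gcongr
      exact mul_le_of_le_one_left zero_le hd1
    have hn : (Fintype.card ι : ℝ≥0) ≤ 7 * K ^ (M + 1) := by exact_mod_cast hcf.card_le
    have hQK : 28 * C₂ ≤ (K : ℝ≥0) ^ Q₀ := by
      refine hQ₀.trans ?_
      have : Q₀ ≤ K ^ Q₀ := (Nat.lt_pow_self (by have := hcf.two_le; omega)).le
      exact_mod_cast this
    calc ‖∑ i, Z i x‖₊ ≤ ∑ i, ‖Z i x‖₊ := nnnorm_sum_le _ _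
      _ ≤ ∑ i : ι, C₂ * (α / K ^ Q) := Finset.sum_le_sum fun i _ => hZ1 i
      _ = Fintype.card ι * (C₂ * (α / K ^ Q)) := by simp
      _ ≤ 7 * K ^ (M + 1) * (C₂ * (α / K ^ Q)) := by gcongr
      _ = (28 * C₂) * (α / 4) / K ^ Q₀ := by
        rw [hQ, add_assoc, pow_add]; field_simp; ring
      _ ≤ K ^ Q₀ * (α / 4) / K ^ Q₀ := by gcongr
      _ = α / 4 := by field_simp
  have hQ0 : (Q : ℝ≥0) ≠ 0 := Nat.cast_ne_zero.2 (by omega)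
  have hcov : {x | (α : ℝ≥0∞) ≤ ‖∑ i, F i x‖ₑ} ⊆ {x | ((α / 4 : ℝ≥0) : ℝ≥0∞) ≤ ‖∑ i, X i x‖ₑ} ∪
      ⋃ q ∈ Finset.range Q, {x | ((α / (4 * Q) : ℝ≥0) : ℝ≥0∞) ≤ ‖∑ i, Y q i x‖ₑ} := fun x hx => by
    by_contra hn
    simp only [mem_union, mem_iUnion, mem_ofPred_eq, not_or, not_exists, not_le] at hn hx
    obtain ⟨hn1, hn2⟩ := hn
    rw [enorm_eq_nnnorm, ENNReal.coe_lt_coe] at hn1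
    rw [enorm_eq_nnnorm, ENNReal.coe_le_coe] at hx
    have hn3 : ∀ q ∈ Finset.range Q, ‖∑ i, Y q i x‖₊ ≤ α / (4 * Q) := fun q hq => by
      have := hn2 q hq
      rw [enorm_eq_nnnorm, ENNReal.coe_lt_coe] at this
      exact this.le
    have e : ∑ i, F i x = ∑ i, X i x + ∑ q ∈ Finset.range Q, ∑ i, Y q i x + ∑ i, Z i x := by
      rw [Finset.sum_comm, ← Finset.sum_add_distrib, ← Finset.sum_add_distrib]
      exact Finset.sum_congr rfl fun i _ => hdec i x
    have h3 : ‖∑ q ∈ Finset.range Q, ∑ i, Y q i x‖₊ ≤ α / 4 := by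
      calc _ ≤ ∑ q ∈ Finset.range Q, ‖∑ i, Y q i x‖₊ := nnnorm_sum_le _ _
        _ ≤ ∑ q ∈ Finset.range Q, α / (4 * Q) := Finset.sum_le_sum hn3
        _ = α / 4 := by
          rw [Finset.sum_const, Finset.card_range, nsmul_eq_mul]; field_simp
    have h4 : ‖∑ i, F i x‖₊ < α / 4 + α / 4 + α / 4 := by
      rw [e]
      refine (nnnorm_add_le _ _).trans_lt ?_
      refine add_lt_add_of_lt_of_le ?_ (hZs x)
      exact (nnnorm_add_le _ _).trans_lt (add_lt_add_of_lt_of_le hn1 h3)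
    have h5 := hx.trans_lt h4
    rw [← NNReal.coe_lt_coe] at h5
    push_cast at h5
    have := α.coe_nonneg
    linarith
  have hXv : ((α / 4 : ℝ≥0) : ℝ≥0∞) ^ 2 *
      volume {x | ((α / 4 : ℝ≥0) : ℝ≥0∞) ≤ ‖∑ i, X i x‖ₑ} ≤
      31 * K * C₂ * ∑ i, ∫⁻ x in S i 1, G i x := by
    calc _ ≤ ∫⁻ x, ‖∑ i, X i x‖ₑ ^ 2 := by
          refine le_trans ?_ (mul_meas_ge_le_lintegral (hXm.enorm.pow_const 2)
            (((α / 4 : ℝ≥0) : ℝ≥0∞) ^ 2))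
          refine mul_le_mul_right (measure_mono fun x hx => ?_) _
          have hx' : ((α / 4 : ℝ≥0) : ℝ≥0∞) ≤ ‖∑ i, X i x‖ₑ := hx
          exact pow_le_pow_left' hx' 2
      _ ≤ (31 * K : ℕ) * ∑ i, ∫⁻ x, ‖X i x‖ₑ ^ 2 :=
          BL.lintegral_sum_sq_le _ (fun i _ => hBL i 0 _ (hSm i 0) le_rfl) _ fun ξ t _ hξ =>
            hcf.card_box_le (B := fun _ => 7 * δ) 7 t ξ fun i hi => by exact_mod_cast hξ i hi
      _ ≤ (31 * K : ℕ) * ∑ i, C₂ * ∫⁻ x in S i 1, G i x := by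
          refine mul_le_mul_right (Finset.sum_le_sum fun i _ => ?_) _
          refine ((hcut i (S i 0) (hSm i 0)).2.2.2).trans (mul_le_mul_right ?_ _)
          exact lintegral_mono_set (hSmono i zero_le)
      _ = _ := by rw [← Finset.mul_sum]; push_cast; ring
  have hYv : ∀ q, ((α / (4 * Q) : ℝ≥0) : ℝ≥0∞) ^ 6 *
      volume {x | ((α / (4 * Q) : ℝ≥0) : ℝ≥0∞) ≤ ‖∑ i, Y q i x‖ₑ} ≤
      C₁ * K ^ 17 * C₂ ^ 5 * (((α / K ^ q : ℝ≥0) : ℝ≥0∞) ^ 4 *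
        ∑ i, ∫⁻ x in S i (q + 1), G i x) := fun q => by
    have hTm := fun i => (hSm i (q + 1)).diff (hSm i q)
    have h := h₁ hcf (Y q) (hYBL q) (fun i => (C₂ * l i q) ^ 2) ((C₂ * (α / K ^ q : ℝ≥0)) ^ 2)
      (by finiteness)
      (fun i x => by
        gcongr
        exact (hcut i _ (hTm i)).1 (l i q) (fun y hy => not_lt.1 hy.2) x)
      (by
        calc _ = (((∑ i, d i ^ 2) * (C₂ * (α / K ^ q)) ^ 2 : ℝ≥0) : ℝ≥0∞) := by
              rw [Finset.sum_mul]; push_cast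
              refine Finset.sum_congr rfl fun i _ => ?_
              simp only [hl]; push_cast; ring
          _ ≤ ((1 * (C₂ * (α / K ^ q)) ^ 2 : ℝ≥0) : ℝ≥0∞) := by
              rw [ENNReal.coe_le_coe]; gcongr
          _ = _ := by push_cast; ring)
      (α / (4 * Q) : ℝ≥0)
    refine h.trans ?_
    calc _ ≤ C₁ * K ^ 17 * ((C₂ * (α / K ^ q : ℝ≥0)) ^ 2) ^ 2 *
          ∑ i, C₂ * ∫⁻ x in S i (q + 1), G i x := by
          refine mul_le_mul_right (Finset.sum_le_sum fun i _ => ?_) _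
          refine ((hcut i _ (hTm i)).2.2.2).trans (mul_le_mul_right ?_ _)
          exact lintegral_mono_set sdiff_subset
      _ = _ := by rw [← Finset.mul_sum]; ring
  set J : ℕ → ℝ≥0∞ := fun q => ((α / K ^ q : ℝ≥0) : ℝ≥0∞) ^ 4 * ∑ i, ∫⁻ x in S i (q + 1), G i x
    with hJ
  have hK1' : (1 : ℝ≥0∞) ≤ K := by exact_mod_cast hK1
  have e4 : (α : ℝ≥0∞) = 4 * (α / 4 : ℝ≥0) := by
    rw [← ENNReal.coe_ofNat, ← ENNReal.coe_mul]; congr 1; field_simp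
  have eQ : (α : ℝ≥0∞) = ((4 * Q : ℝ≥0) : ℝ≥0∞) * (α / (4 * Q) : ℝ≥0) := by
    rw [← ENNReal.coe_mul]; congr 1; field_simp
  have hJ0 : J 0 ≤ ∑ q ∈ Finset.range (Q + 1), J q :=
    Finset.single_le_sum (fun _ _ => zero_le) (by simp)
  have hJQ : ∑ q ∈ Finset.range Q, J q ≤ ∑ q ∈ Finset.range (Q + 1), J q :=
    Finset.sum_le_sum_of_subset (Finset.range_mono (Nat.le_succ Q))
  have eX : (α : ℝ≥0∞) ^ 6 * volume {x | ((α / 4 : ℝ≥0) : ℝ≥0∞) ≤ ‖∑ i, X i x‖ₑ} ≤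
      16 * 31 * C₂ * K ^ 17 * J 0 := by
    calc _ = (α : ℝ≥0∞) ^ 4 * (16 * (((α / 4 : ℝ≥0) : ℝ≥0∞) ^ 2 *
          volume {x | ((α / 4 : ℝ≥0) : ℝ≥0∞) ≤ ‖∑ i, X i x‖ₑ})) := by
          rw [show (α : ℝ≥0∞) ^ 6 = α ^ 4 * α ^ 2 by ring]; nth_rw 2 [e4]; ring
      _ ≤ (α : ℝ≥0∞) ^ 4 * (16 * (31 * K * C₂ * ∑ i, ∫⁻ x in S i 1, G i x)) := by gcongr
      _ = 16 * 31 * C₂ * K ^ 1 * J 0 := by simp [hJ]; ring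
      _ ≤ _ := by gcongr; first | exact hK1' | norm_num
  have eY : ∀ q, (α : ℝ≥0∞) ^ 6 *
      volume {x | ((α / (4 * Q) : ℝ≥0) : ℝ≥0∞) ≤ ‖∑ i, Y q i x‖ₑ} ≤
      ((4 * Q : ℝ≥0) : ℝ≥0∞) ^ 6 * (C₁ * K ^ 17 * C₂ ^ 5 * J q) := fun q => by
    nth_rw 1 [eQ]
    rw [mul_pow, mul_assoc]
    exact mul_le_mul_right (hYv q) _
  calc _ ≤ (α : ℝ≥0∞) ^ 6 * (volume {x | ((α / 4 : ℝ≥0) : ℝ≥0∞) ≤ ‖∑ i, X i x‖ₑ} +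
        ∑ q ∈ Finset.range Q,
          volume {x | ((α / (4 * Q) : ℝ≥0) : ℝ≥0∞) ≤ ‖∑ i, Y q i x‖ₑ}) := by
        refine mul_le_mul_right ((measure_mono hcov).trans ((measure_union_le _ _).trans ?_)) _
        exact add_le_add le_rfl (measure_biUnion_finset_le _ _)
    _ ≤ 16 * 31 * C₂ * K ^ 17 * J 0 + ∑ q ∈ Finset.range Q,
        ((4 * Q : ℝ≥0) : ℝ≥0∞) ^ 6 * (C₁ * K ^ 17 * C₂ ^ 5 * J q) := by
        rw [mul_add, Finset.mul_sum]
        exact add_le_add eX (Finset.sum_le_sum fun q _ => eY q)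
    _ = 16 * 31 * C₂ * K ^ 17 * J 0 +
        ((4 * Q : ℝ≥0) : ℝ≥0∞) ^ 6 * (C₁ * K ^ 17 * C₂ ^ 5 * ∑ q ∈ Finset.range Q, J q) := by
        rw [← Finset.mul_sum, ← Finset.mul_sum]
    _ ≤ 16 * 31 * C₂ * K ^ 17 * (∑ q ∈ Finset.range (Q + 1), J q) +
        ((4 * Q : ℝ≥0) : ℝ≥0∞) ^ 6 * (C₁ * K ^ 17 * C₂ ^ 5 *
          ∑ q ∈ Finset.range (Q + 1), J q) := by
        exact add_le_add (mul_le_mul_right hJ0 _)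
          (mul_le_mul_right (mul_le_mul_right hJQ _) _)
    _ = _ := by push_cast; ring

lemma cube_cv_le {w g : E2 → ℝ≥0∞} (hw : Measurable w) (hg : Measurable g) (x : E2) :
    cv w g x ^ 3 ≤ (∫⁻ y, w y) ^ 2 * cv w (fun y => g y ^ 3) x := by
  have hw' : Measurable fun y => w (x - y) := hw.comp (measurable_const_sub x)
  have hc : ∀ h : E2 → ℝ≥0∞, Measurable h →
      cv w h x = ∫⁻ y, h y ∂(volume.withDensity fun y => w (x - y)) := fun h hh => by
    rw [lintegral_withDensity_eq_lintegral_mul _ hw' hh]; rfl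
  have h := ENNReal.lintegral_mul_le_Lp_mul_Lq (volume.withDensity fun y => w (x - y))
    (p := 3) (q := 3 / 2) (by rw [Real.holderConjugate_iff]; norm_num) (f := g) (g := 1)
    hg.aemeasurable aemeasurable_const
  simp only [mul_one, Pi.one_apply, ENNReal.one_rpow] at h
  rw [← hc g hg] at h
  have e3 : ∀ z : ℝ≥0∞, z ^ (3 : ℝ) = z ^ 3 := fun z => by
    rw [← ENNReal.rpow_natCast]; norm_num
  simp only [e3] at h
  rw [← hc _ (hg.pow_const 3), lintegral_one, withDensity_apply _ MeasurableSet.univ,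
    setLIntegral_univ, lintegral_sub_left_eq_self w x] at h
  calc cv w g x ^ 3 ≤ (cv w (fun y => g y ^ 3) x ^ (1 / 3 : ℝ) *
        (∫⁻ y, w y) ^ (1 / (3 / 2) : ℝ)) ^ 3 := by gcongr
    _ = _ := by
      rw [mul_pow, ← e3, ← e3, ← ENNReal.rpow_mul, ← ENNReal.rpow_mul, mul_comm]
      norm_num

lemma lintegral_cube_lsq_le {s A B : ℝ} (hA : 0 < A) (hB : 0 < B) {U : E2 → ℂ}
    (hU : Measurable U) : ∫⁻ x, lsq s A B 3 U x ^ 3 ≤ wtMass ^ 3 * ∫⁻ x, ‖U x‖ₑ ^ 6 := by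
  have hm : Measurable fun y => ‖U y‖ₑ ^ 2 := hU.enorm.pow_const 2
  calc ∫⁻ x, lsq s A B 3 U x ^ 3
      ≤ ∫⁻ x, wtMass ^ 2 * cv (wt s A B 3) (fun y => (‖U y‖ₑ ^ 2) ^ 3) x := by
        refine lintegral_mono fun x => (cube_cv_le (measurable_wt _ _ _ _) hm x).trans ?_
        gcongr
        exact lintegral_wt_le hA hB le_rfl
    _ ≤ wtMass ^ 2 * (wtMass * ∫⁻ x, (‖U x‖ₑ ^ 2) ^ 3) := by
        rw [lintegral_const_mul _ (measurable_cv (measurable_wt _ _ _ _) (hm.pow_const 3))]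
        gcongr
        exact lintegral_cv_wt_le hA hB le_rfl (hm.pow_const 3)
    _ = _ := by simp only [← pow_mul]; ring

lemma lsq_lt_top {s A B : ℝ} (hA : 0 < A) (hB : 0 < B) {S : Set E2} {U : E2 → ℂ}
    (hU : BL S U) (x : E2) : lsq s A B 3 U x < ⊤ := by
  obtain ⟨C, hC⟩ := hU.bounded
  have h : ∀ y, ‖U y‖ₑ ^ 2 ≤ ENNReal.ofReal C ^ 2 := fun y => by
    gcongr
    rw [← ofReal_norm]
    exact ENNReal.ofReal_le_ofReal (hC y)
  calc lsq s A B 3 U x ≤ ∫⁻ y, wt s A B 3 (x - y) * ENNReal.ofReal C ^ 2 :=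
        lintegral_mono fun y => mul_le_mul_right (h y) _
    _ = (∫⁻ y, wt s A B 3 (x - y)) * ENNReal.ofReal C ^ 2 :=
        lintegral_mul_const _ ((measurable_wt _ _ _ _).comp (measurable_const_sub x))
    _ < ⊤ := ENNReal.mul_lt_top ((lintegral_wt_sub_le hA hB le_rfl x).trans_lt wtMass_lt_top)
        (by finiteness)

lemma lintegral_enorm_pow_six_lt_top {S : Set E2} {U : E2 → ℂ} (hU : BL S U) :
    ∫⁻ x, ‖U x‖ₑ ^ 6 < ⊤ := by
  obtain ⟨C, hC⟩ := hU.bounded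
  calc ∫⁻ x, ‖U x‖ₑ ^ 6 ≤ ∫⁻ x, ENNReal.ofReal C ^ 4 * ‖U x‖ₑ ^ 2 := by
        refine lintegral_mono fun x => ?_
        rw [show ‖U x‖ₑ ^ 6 = ‖U x‖ₑ ^ 4 * ‖U x‖ₑ ^ 2 by ring]
        gcongr
        rw [← ofReal_norm]
        exact ENNReal.ofReal_le_ofReal (hC x)
    _ = ENNReal.ofReal C ^ 4 * ∫⁻ x, ‖U x‖ₑ ^ 2 :=
        lintegral_const_mul _ (hU.continuous.measurable.enorm.pow_const 2)
    _ < ⊤ := ENNReal.mul_lt_top (by finiteness) hU.lintegral_sq_lt_top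

/-- The layer cake formula in the form used here. -/
lemma lintegral_layer_le {G : E2 → ℝ≥0∞} (hG : Measurable G) (hGt : ∀ x, G x < ⊤) {e : ℝ≥0}
    (he : e ≠ 0) :
    ∫⁻ t in Ioi (0 : ℝ), (∫⁻ x in {x | ((e * t.toNNReal : ℝ≥0) : ℝ≥0∞) ^ 2 < G x}, G x) *
      ENNReal.ofReal (t ^ 3) ≤ ((e⁻¹ : ℝ≥0) : ℝ≥0∞) ^ 4 * ∫⁻ x, G x ^ 3 := by
  set μ := volume.withDensity G
  set h : E2 → ℝ := fun x => √(G x).toReal / e with hh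
  have hm : Measurable h := by fun_prop
  have he' : (0 : ℝ) < e := by positivity
  have key := lintegral_rpow_eq_lintegral_meas_le_mul μ (f := h)
    (ae_of_all _ fun x => by simp only [hh, Pi.zero_apply]; positivity) hm.aemeasurable
    (p := 4) (by norm_num)
  have e1 : ∀ x, ENNReal.ofReal (h x ^ (4 : ℝ)) = ((e⁻¹ : ℝ≥0) : ℝ≥0∞) ^ 4 * G x ^ 2 := fun x => by
    have : h x ^ (4 : ℝ) = ((e⁻¹ : ℝ≥0) : ℝ) ^ 4 * (G x).toReal ^ 2 := by
      rw [show (4 : ℝ) = (4 : ℕ) by norm_num, Real.rpow_natCast, hh]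
      simp only [div_pow]
      rw [show √(G x).toReal ^ 4 = (√(G x).toReal ^ 2) ^ 2 by ring,
        Real.sq_sqrt ENNReal.toReal_nonneg]
      push_cast; field_simp
    rw [this, ENNReal.ofReal_mul (by positivity), ENNReal.ofReal_pow (by positivity),
      ENNReal.ofReal_pow (by positivity), ENNReal.ofReal_coe_nnreal,
      ENNReal.ofReal_toReal (hGt x).ne]
  have e2 : ∫⁻ x, ENNReal.ofReal (h x ^ (4 : ℝ)) ∂μ =
      ((e⁻¹ : ℝ≥0) : ℝ≥0∞) ^ 4 * ∫⁻ x, G x ^ 3 := by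
    simp only [e1]
    rw [lintegral_const_mul _ (hG.pow_const 2),
      lintegral_withDensity_eq_lintegral_mul _ hG (hG.pow_const 2)]
    congr 1
    refine lintegral_congr fun x => ?_
    simp only [Pi.mul_apply]; ring
  rw [← e2, key]
  refine le_trans ?_ (le_mul_of_one_le_left zero_le (by simp))
  refine setLIntegral_mono' measurableSet_Ioi fun t ht => ?_
  have ht0 : 0 < t := ht
  rw [show t ^ ((4 : ℝ) - 1) = t ^ 3 by rw [← Real.rpow_natCast]; norm_num]
  refine mul_le_mul_left ?_ _
  have hms : MeasurableSet {x | t ≤ h x} := measurableSet_le measurable_const hm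
  rw [withDensity_apply _ hms]
  refine lintegral_mono_set fun x hx => ?_
  have hx' : ((e * t.toNNReal : ℝ≥0) : ℝ≥0∞) ^ 2 < G x := hx
  change t ≤ √(G x).toReal / e
  rw [le_div_iff₀ he']
  refine Real.le_sqrt_of_sq_le ?_
  have := ENNReal.toReal_mono (hGt x).ne hx'.le
  simp only [ENNReal.toReal_pow, ENNReal.coe_toReal, NNReal.coe_mul,
    Real.coe_toNNReal _ ht0.le] at this
  rwa [mul_comm]

lemma BL.eq_zero_of_lintegral {S : Set E2} {U : E2 → ℂ} (hU : BL S U)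
    (h : ∫⁻ x, ‖U x‖ₑ ^ 6 = 0) (x : E2) : U x = 0 := by
  rw [lintegral_eq_zero_iff (hU.continuous.measurable.enorm.pow_const 6)] at h
  have h' : U =ᵐ[volume] fun _ => 0 := by
    filter_upwards [h] with y hy
    simpa using hy
  exact congrFun ((Continuous.ae_eq_iff_eq volume hU.continuous continuous_const).1 h') x

set_option maxHeartbeats 1000000 in
/-- The decoupling inequality for one family of tiles. -/
lemma exists_decoupling_conf (M : ℕ) : ∃ C : ℝ≥0,
    ∀ {ι : Type} [Fintype ι] {a y s : ι → ℝ} {K m : ℕ} {δ : ℝ},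
    Conf a y s K m M δ → ∀ F : ι → E2 → ℂ,
    (∀ i, BL (box (pt a y i) (s i) (3 * scl K m 0) (3 * δ)) (F i)) →
    ∫⁻ x, ‖∑ i, F i x‖ₑ ^ 6 ≤
      C * K ^ 21 * (∑ i, (∫⁻ x, ‖F i x‖ₑ ^ 6) ^ (1 / 3 : ℝ)) ^ 3 := by
  obtain ⟨C, Q, hC⟩ := exists_level_set_slices M
  refine ⟨6 * C * (Q + 1) * wtMass.toNNReal ^ 3, fun {ι _ a y s K m δ} hcf F hF => ?_⟩
  have hA : 0 < scl K m 0 := scl_pos hcf.two_le m 0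
  have hB := hcf.delta_pos
  have hK0 : (K : ℝ≥0) ≠ 0 := by have := hcf.two_le; norm_cast; omega
  have hFm := fun i => (hF i).continuous.measurable
  set T : ι → ℝ≥0 := fun i => ((∫⁻ x, ‖F i x‖ₑ ^ 6) ^ (1 / 3 : ℝ)).toNNReal with hT
  have hTe : ∀ i, (∫⁻ x, ‖F i x‖ₑ ^ 6) ^ (1 / 3 : ℝ) = T i := fun i =>
    (ENNReal.coe_toNNReal (ENNReal.rpow_ne_top_of_nonneg (by norm_num)
      (lintegral_enorm_pow_six_lt_top (hF i)).ne)).symm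
  have hT3 : ∀ i, ∫⁻ x, ‖F i x‖ₑ ^ 6 = (T i : ℝ≥0∞) ^ 3 := fun i => by
    rw [← hTe, ← ENNReal.rpow_natCast, ← ENNReal.rpow_mul]; norm_num
  have hT0 : ∀ i, T i = 0 → ∀ x, F i x = 0 := fun i h =>
    (hF i).eq_zero_of_lintegral (by rw [hT3, h]; simp)
  simp only [hTe]
  set S := ∑ i, T i with hS
  by_cases hS0 : S = 0
  · have h0 : ∀ i x, F i x = 0 := fun i x =>
      hT0 i (Finset.sum_eq_zero_iff.1 hS0 i (Finset.mem_univ i)) x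
    simp [h0]
  set d : ι → ℝ≥0 := fun i => NNReal.sqrt (T i / S) with hd
  have hd2 : ∀ i, d i ^ 2 = T i / S := fun i => NNReal.sq_sqrt _
  have hdT : ∀ i, d i = 0 → T i = 0 := fun i h => by
    have := hd2 i
    rw [h, zero_pow two_ne_zero, eq_comm, div_eq_zero_iff] at this
    exact this.resolve_right hS0
  set G : ι → E2 → ℝ≥0∞ := fun i => lsq (s i) (scl K m 0) δ 3 (F i) with hG
  have hGm : ∀ i, Measurable (G i) := fun i => measurable_lsq _ _ _ _ (hFm i)
  have hlev := hC hcf F hF d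
    (by simp only [hd2]; rw [← Finset.sum_div, div_self hS0]) (fun i h => hT0 i (hdT i h))
  set I : ℕ → ι → ℝ → ℝ≥0∞ := fun q i t =>
    ∫⁻ x in {x | ((d i * (t.toNNReal / K ^ (q + 1)) : ℝ≥0) : ℝ≥0∞) ^ 2 < G i x}, G i x with hI
  have hIm : ∀ q i, Measurable (I q i) := fun q i => by
    refine Antitone.measurable fun t t' htt => lintegral_mono_set fun x hx => ?_
    have hx' : ((d i * (t'.toNNReal / K ^ (q + 1)) : ℝ≥0) : ℝ≥0∞) ^ 2 < G i x := hx
    refine lt_of_le_of_lt ?_ hx'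
    have := Real.toNNReal_le_toNNReal htt
    gcongr
  have hIle : ∀ q i, ∫⁻ t in Ioi (0 : ℝ), I q i t * ENNReal.ofReal (t ^ 3) ≤
      (K : ℝ≥0∞) ^ (4 * q + 4) * (wtMass ^ 3 * (S ^ 2 * T i)) := fun q i => by
    by_cases h0 : d i = 0
    · have : ∀ x, G i x = 0 := fun x => lsq_zero _ _ _ _ (hT0 i (hdT i h0)) x
      simp [hI, this]
    · set e : ℝ≥0 := d i / K ^ (q + 1) with he
      have he0 : e ≠ 0 := by positivity
      have h := lintegral_layer_le (hGm i) (lsq_lt_top hA hB (hF i)) he0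
      have e1 : ∀ t : ℝ, e * t.toNNReal = d i * (t.toNNReal / K ^ (q + 1)) := fun t => by
        rw [he]; ring
      simp only [e1] at h
      refine h.trans ?_
      have hT0' : T i ≠ 0 := fun h => by
        have := hd2 i
        rw [h, zero_div] at this
        exact h0 (by simpa using this)
      calc _ ≤ ((e⁻¹ : ℝ≥0) : ℝ≥0∞) ^ 4 * (wtMass ^ 3 * (T i : ℝ≥0∞) ^ 3) := by
            rw [← hT3]
            exact mul_le_mul_right (lintegral_cube_lsq_le hA hB (hFm i)) _
        _ = wtMass ^ 3 * ((e⁻¹ ^ 4 * T i ^ 3 : ℝ≥0) : ℝ≥0∞) := by push_cast; ring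
        _ = wtMass ^ 3 * ((K ^ (4 * q + 4) * (S ^ 2 * T i) : ℝ≥0) : ℝ≥0∞) := by
            have : e⁻¹ ^ 4 * T i ^ 3 = K ^ (4 * q + 4) * (S ^ 2 * T i) := by
              rw [he, inv_div, div_pow, show d i ^ 4 = (d i ^ 2) ^ 2 by ring, hd2]
              field_simp
              ring
            rw [this]
        _ = _ := by push_cast; ring
  set f : E2 → ℂ := fun x => ∑ i, F i x with hf
  have hfm : Measurable f := Finset.measurable_fun_sum _ fun i _ => hFm i
  have key := lintegral_rpow_eq_lintegral_meas_le_mul volume (f := fun x => ‖f x‖)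
    (ae_of_all _ fun x => norm_nonneg _) hfm.norm.aemeasurable (p := 6) (by norm_num)
  have e6 : ∀ x, ENNReal.ofReal (‖f x‖ ^ (6 : ℝ)) = ‖f x‖ₑ ^ 6 := fun x => by
    rw [show (6 : ℝ) = (6 : ℕ) by norm_num, Real.rpow_natCast,
      ENNReal.ofReal_pow (norm_nonneg _), ofReal_norm]
  simp only [e6] at key
  have hpt : ∀ t ∈ Ioi (0 : ℝ), volume {x | t ≤ ‖f x‖} * ENNReal.ofReal (t ^ ((6 : ℝ) - 1)) ≤
      C * K ^ 17 * ∑ q ∈ Finset.range (Q + 1), (((K : ℝ≥0) ^ (4 * q))⁻¹ : ℝ≥0) *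
        ∑ i, I q i t * ENNReal.ofReal (t ^ 3) := fun t ht => by
    have ht0 : (0 : ℝ) < t := ht
    lift t to ℝ≥0 using ht0.le
    have ht1 : t ≠ 0 := fun h => by simp [h] at ht0
    have ht1' : (t : ℝ≥0∞) ≠ 0 := by exact_mod_cast ht1
    have es : {x | (t : ℝ) ≤ ‖f x‖} = {x | (t : ℝ≥0∞) ≤ ‖∑ i, F i x‖ₑ} := by
      ext x
      simp only [mem_ofPred_eq, hf]
      rw [← ofReal_norm, ← ENNReal.ofReal_coe_nnreal, ENNReal.ofReal_le_ofReal_iff (norm_nonneg _)]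
    have h := hlev t ht1
    have e5 : ENNReal.ofReal ((t : ℝ) ^ ((6 : ℝ) - 1)) = (t : ℝ≥0∞) ^ 5 := by
      rw [show (6 : ℝ) - 1 = (5 : ℕ) by norm_num, Real.rpow_natCast,
        ENNReal.ofReal_pow t.coe_nonneg, ENNReal.ofReal_coe_nnreal]
    have e3 : ENNReal.ofReal ((t : ℝ) ^ 3) = (t : ℝ≥0∞) ^ 3 := by
      rw [ENNReal.ofReal_pow t.coe_nonneg, ENNReal.ofReal_coe_nnreal]
    rw [es, e5, e3, ← ENNReal.mul_le_mul_iff_right ht1' ENNReal.coe_ne_top]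
    calc _ = (t : ℝ≥0∞) ^ 6 * volume {x | (t : ℝ≥0∞) ≤ ‖∑ i, F i x‖ₑ} := by ring
      _ ≤ _ := h
      _ = _ := by
        simp only [hI, Real.toNNReal_coe, ← Finset.sum_mul]
        rw [Finset.mul_sum, Finset.mul_sum, Finset.mul_sum]
        refine Finset.sum_congr rfl fun q _ => ?_
        have : (((t / K ^ q : ℝ≥0)) : ℝ≥0∞) ^ 4 =
            t * ((((K : ℝ≥0) ^ (4 * q))⁻¹ : ℝ≥0) * (t : ℝ≥0∞) ^ 3) := by
          norm_cast
          field_simp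
          push_cast
          ring
        rw [this]
        ring
  rw [key]
  calc _ ≤ ENNReal.ofReal 6 * ∫⁻ t in Ioi (0 : ℝ), C * K ^ 17 * ∑ q ∈ Finset.range (Q + 1),
        (((K : ℝ≥0) ^ (4 * q))⁻¹ : ℝ≥0) * ∑ i, I q i t * ENNReal.ofReal (t ^ 3) :=
        mul_le_mul_right (setLIntegral_mono' measurableSet_Ioi hpt) _
    _ = ENNReal.ofReal 6 * (C * K ^ 17 * ∑ q ∈ Finset.range (Q + 1),
        (((K : ℝ≥0) ^ (4 * q))⁻¹ : ℝ≥0) *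
          ∑ i, ∫⁻ t in Ioi (0 : ℝ), I q i t * ENNReal.ofReal (t ^ 3)) := by
        rw [lintegral_const_mul _ (by fun_prop), lintegral_finsetSum _ (fun q _ => by fun_prop)]
        congr 2
        refine Finset.sum_congr rfl fun q _ => ?_
        rw [lintegral_const_mul _ (by fun_prop), lintegral_finsetSum _ (fun q _ => by fun_prop)]
    _ ≤ ENNReal.ofReal 6 * (C * K ^ 17 * ∑ q ∈ Finset.range (Q + 1),
        (((K : ℝ≥0) ^ (4 * q))⁻¹ : ℝ≥0) *
          ∑ i, (K : ℝ≥0∞) ^ (4 * q + 4) * (wtMass ^ 3 * (S ^ 2 * T i))) := by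
        gcongr with q _ i
        exact hIle q i
    _ = ENNReal.ofReal 6 * (C * K ^ 17 * ∑ q ∈ Finset.range (Q + 1),
          (K : ℝ≥0∞) ^ 4 * (wtMass ^ 3 * S ^ 3)) := by
        congr 2
        refine Finset.sum_congr rfl fun q _ => ?_
        rw [← Finset.mul_sum, ← Finset.mul_sum, ← Finset.mul_sum, ← ENNReal.ofNNReal_finsetSum, ← hS,
          ← mul_assoc]
        have : ((((K : ℝ≥0) ^ (4 * q))⁻¹ : ℝ≥0) : ℝ≥0∞) * (K : ℝ≥0∞) ^ (4 * q + 4) = K ^ 4 := by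
          norm_cast
          field_simp
          push_cast
          ring
        rw [this]
        ring
    _ = _ := by
        rw [Finset.sum_const, Finset.card_range, nsmul_eq_mul]
        push_cast
        rw [ENNReal.coe_toNNReal wtMass_lt_top.ne, show ENNReal.ofReal 6 = 6 by norm_num,
          hS, ENNReal.ofNNReal_finsetSum]
        ring

lemma Conf.card_le_two_of_sub_lt {ι : Type} {a y s : ι → ℝ} {K m M : ℕ} {δ : ℝ}
    (hc : Conf a y s K m M δ) (u : Finset ι)
    (hu : ∀ i ∈ u, ∀ j ∈ u, |s i - s j| < δ * (K : ℝ) ^ m) : u.card ≤ 2 := by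
  by_contra! h
  have key : ∀ i ∈ u, ∀ j ∈ u, ∀ k ∈ u, a i < a j → a j < a k → False :=
    fun i hi j hj k hk h1 h2 => by
      have := hc.three i j k h1 h2
      linarith [hu k hk i hi, le_abs_self (s k - s i)]
  obtain ⟨i, j, k, hi, hj, hk, hij, hik, hjk⟩ := Finset.two_lt_card_iff.1 h
  have e1 := fun h => hij (hc.injective h)
  have e2 := fun h => hik (hc.injective h)
  have e3 := fun h => hjk (hc.injective h)
  rcases lt_or_gt_of_ne e1 with h1 | h1 <;> rcases lt_or_gt_of_ne e2 with h2 | h2 <;>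
    rcases lt_or_gt_of_ne e3 with h3 | h3
  · exact key i hi j hj k hk h1 h3
  · exact key i hi k hk j hj h2 h3
  · linarith
  · exact key k hk i hi j hj h2 h1
  · exact key j hj i hi k hk h1 h2
  · linarith
  · exact key j hj k hk i hi h3 h2
  · exact key k hk j hj i hi h3 h1

lemma Conf.card_le_of_slopes {ι : Type} {a y s : ι → ℝ} {K m M : ℕ} {δ : ℝ}
    (hc : Conf a y s K m M δ) (u : Finset ι)
    (hu : ∀ i ∈ u, ∀ j ∈ u, |s i - s j| ≤ 6 * δ * (K : ℝ) ^ (m + 1)) :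
    u.card ≤ 2 * (2 * (6 * K) + 3) := by
  have hh : 0 < δ * (K : ℝ) ^ m := mul_pos hc.delta_pos (pow_pos hc.K_pos m)
  refine card_le_of_floor u s hh (6 * K) 2 (fun i hi j hj => ?_) fun b v _ hv => ?_
  · push_cast
    calc _ ≤ _ := hu i hi j hj
      _ = _ := by ring
  · exact hc.card_le_two_of_sub_lt v fun i hi j hj =>
      abs_sub_lt_of_floor_eq hh ((hv i hi).trans (hv j hj).symm)

/-- A strip of width comparable to `δ` contains `O(K)` of the points. -/
lemma Conf.card_le_of_strip {ι : Type} [Fintype ι] {a y s : ι → ℝ} {K m M : ℕ} {δ : ℝ}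
    (hc : Conf a y s K m M δ) {w₀ w₁ c : ℝ} (hw : 0 < |w₀| + |w₁|)
    (hcap : ∀ i, |w₀ * a i + w₁ * y i - c| ≤ δ * (|w₀| + |w₁|)) :
    Fintype.card ι ≤ 100 * K := by
  classical
  have hK := hc.two_le
  have hKp := pow_pos hc.K_pos (m + 1)
  have hδ := hc.delta_pos
  have hdiff : ∀ i j, |w₀ * (a j - a i) + w₁ * (y j - y i)| ≤ 2 * δ * (|w₀| + |w₁|) :=
    fun i j => by
      have h1 := abs_le.1 (hcap i)
      have h2 := abs_le.1 (hcap j)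
      rw [abs_le]
      constructor <;> linarith
  rcases le_or_gt |w₀| (2 * |w₁|) with hA | hB
  · have hw1 : 0 < |w₁| := by linarith
    have hw1' : w₁ ≠ 0 := abs_pos.1 hw1
    set ν := -w₀ / w₁ with hν
    have hu : ∀ i j, |(y j - y i) - ν * (a j - a i)| ≤ 6 * δ := fun i j => by
      refine le_of_mul_le_mul_left ?_ hw1
      rw [← abs_mul]
      calc _ = |w₀ * (a j - a i) + w₁ * (y j - y i)| := by
            congr 1; rw [hν]; field_simp; ring
        _ ≤ _ := hdiff i j
        _ ≤ _ := by nlinarith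
    have hgap : ∀ i j, a i < a j → 1 < (a j - a i) * (K : ℝ) ^ (m + 1) := fun i j hij => by
      have := hc.sep j i (fun h => by simp [h] at hij)
      rwa [abs_of_pos (sub_pos.2 hij)] at this
    have hplus : (Finset.univ.filter fun i => ν ≤ s i).card ≤ 2 * (2 * (6 * K) + 3) + 1 := by
      rcases (Finset.univ.filter fun i => ν ≤ s i).eq_empty_or_nonempty with h | h
      · rw [h, Finset.card_empty]; omega
      obtain ⟨k, hk, hmax⟩ := Finset.exists_max_image _ a h
      rw [← Finset.card_erase_add_one hk]
      have hb : ∀ i ∈ (Finset.univ.filter fun i => ν ≤ s i).erase k,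
          0 ≤ s i - ν ∧ s i - ν ≤ 6 * δ * (K : ℝ) ^ (m + 1) := fun i hi => by
        have hi1 := Finset.ne_of_mem_erase hi
        have hi2 := Finset.mem_of_mem_erase hi
        have hi3 : ν ≤ s i := (Finset.mem_filter.1 hi2).2
        have hlt : a i < a k := lt_of_le_of_ne (hmax i hi2) fun h => hi1 (hc.injective h)
        have h1 := hc.low i k hlt.le
        have h2 := (abs_le.1 (hu i k)).2
        have h3 : (s i - ν) * (a k - a i) ≤ 6 * δ := by linarith
        refine ⟨by linarith, ?_⟩
        calc s i - ν ≤ (s i - ν) * ((a k - a i) * (K : ℝ) ^ (m + 1)) :=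
              le_mul_of_one_le_right (by linarith) (hgap i k hlt).le
          _ = (s i - ν) * (a k - a i) * (K : ℝ) ^ (m + 1) := by ring
          _ ≤ _ := by gcongr
      refine Nat.add_le_add_right (hc.card_le_of_slopes _ fun i hi j hj => ?_) 1
      have h1 := hb i hi
      have h2 := hb j hj
      rw [abs_le]
      constructor <;> linarith
    have hminus : (Finset.univ.filter fun i => ¬ ν ≤ s i).card ≤ 2 * (2 * (6 * K) + 3) + 1 := by
      rcases (Finset.univ.filter fun i => ¬ ν ≤ s i).eq_empty_or_nonempty with h | h
      · rw [h, Finset.card_empty]; omega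
      obtain ⟨k, hk, hmin⟩ := Finset.exists_min_image _ a h
      rw [← Finset.card_erase_add_one hk]
      have hb : ∀ i ∈ (Finset.univ.filter fun i => ¬ ν ≤ s i).erase k,
          0 ≤ ν - s i ∧ ν - s i ≤ 6 * δ * (K : ℝ) ^ (m + 1) := fun i hi => by
        have hi1 := Finset.ne_of_mem_erase hi
        have hi2 := Finset.mem_of_mem_erase hi
        have hi3 : s i < ν := not_le.1 (Finset.mem_filter.1 hi2).2
        have hlt : a k < a i := lt_of_le_of_ne (hmin i hi2) fun h => hi1 (hc.injective h.symm)
        have h1 := hc.up k i hlt.le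
        have h2 := (abs_le.1 (hu k i)).1
        have h3 : (ν - s i) * (a i - a k) ≤ 6 * δ := by linarith
        refine ⟨by linarith, ?_⟩
        calc ν - s i ≤ (ν - s i) * ((a i - a k) * (K : ℝ) ^ (m + 1)) :=
              le_mul_of_one_le_right (by linarith) (hgap k i hlt).le
          _ = (ν - s i) * (a i - a k) * (K : ℝ) ^ (m + 1) := by ring
          _ ≤ _ := by gcongr
      refine Nat.add_le_add_right (hc.card_le_of_slopes _ fun i hi j hj => ?_) 1
      have h1 := hb i hi
      have h2 := hb j hj
      rw [abs_le]
      constructor <;> linarith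
    rw [← Finset.card_univ, ← Finset.card_filter_add_card_filter_not (fun i => ν ≤ s i)]
    omega
  · rcases lt_or_ge 1 (δ * (K : ℝ) ^ m) with h1 | h1
    · have := hc.card_le_two (s₀ := 0) (κ := 1)
        (fun i => ⟨hc.s_nonneg i, by linarith [hc.s_le i]⟩) h1
      omega
    have hw0 : 0 < |w₀| := by linarith [abs_nonneg w₁]
    have hclose : ∀ i j, |a i - a j| ≤ 6 * δ := fun i j => by
      obtain ⟨σ, hσ, ⟨k, hk, -⟩, ⟨k', hk', -⟩⟩ := hc.exists_slope j i
      have hσ0 : 0 ≤ σ := (hc.s_nonneg k).trans hk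
      have hσ1 : σ ≤ 1 := hk'.trans (hc.s_le k')
      have h2 := hdiff j i
      rw [hσ, show w₀ * (a i - a j) + w₁ * (σ * (a i - a j)) = (w₀ + w₁ * σ) * (a i - a j) by ring,
        abs_mul] at h2
      have h3 : |w₀| / 2 ≤ |w₀ + w₁ * σ| := by
        have e1 : |w₁ * σ| ≤ |w₁| := by
          rw [abs_mul, abs_of_nonneg hσ0]
          exact mul_le_of_le_one_right (abs_nonneg _) hσ1
        have e2 := abs_sub_abs_le_abs_sub w₀ (-(w₁ * σ))
        rw [abs_neg, sub_neg_eq_add] at e2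
        linarith
      have h4 := mul_le_mul_of_nonneg_right h3 (abs_nonneg (a i - a j))
      refine le_of_mul_le_mul_left ?_ hw0
      nlinarith
    have hh : 0 < 1 / (K : ℝ) ^ (m + 1) := by positivity
    have := card_le_of_floor Finset.univ a hh (6 * K) 1 (fun i _ j _ => (hclose i j).trans ?_)
      fun b u _ hu => Finset.card_le_one.2 fun i hi j hj => ?_
    · rw [Finset.card_univ] at this
      omega
    · push_cast
      rw [mul_one_div, le_div_iff₀ hKp]
      have := hc.K_pos
      calc 6 * δ * (K : ℝ) ^ (m + 1) = 6 * K * (δ * (K : ℝ) ^ m) := by ring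
        _ ≤ 6 * K * 1 := by gcongr
        _ = _ := by ring
    · by_contra hij
      have h2 := hc.sep i j hij
      have h3 := abs_sub_lt_of_floor_eq hh ((hu i hi).trans (hu j hj).symm)
      rw [lt_div_iff₀ hKp] at h3
      linarith

section

/-- The convexity inequalities satisfied by a curve with slopes in `[0,1]`. -/
structure CvxCurve (γ γR γL : ℝ → ℝ) : Prop where
  right : ∀ x ∈ Ico (0 : ℝ) 1, ∀ y ∈ Icc (0 : ℝ) 1, γR x * (y - x) ≤ γ y - γ x
  left : ∀ x ∈ Ioc (0 : ℝ) 1, ∀ y ∈ Icc (0 : ℝ) 1, γL x * (y - x) ≤ γ y - γ x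
  R_le_L : ∀ x y, 0 ≤ x → x < y → y ≤ 1 → γR x ≤ γL y
  L_le_R : ∀ x ∈ Ioo (0 : ℝ) 1, γL x ≤ γR x
  R_zero : 0 ≤ γR 0
  L_one : γL 1 ≤ 1

lemma ConvexOn.cvxCurve {γ γR γL : ℝ → ℝ} (hc : ConvexOn ℝ (Icc (0 : ℝ) 1) γ)
    (hd : HasOneSidedDerivs γ γR γL 0 1) (h0 : 0 ≤ γR 0) (h1 : γL 1 ≤ 1) :
    CvxCurve γ γR γL := by
  have hR : ∀ x ∈ Ico (0 : ℝ) 1, HasDerivWithinAt γ (γR x) (Ioi x) x := fun x hx =>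
    (hd.1 x hx).mono_of_mem_nhdsWithin (Ioc_mem_nhdsGT hx.2)
  have hL : ∀ x ∈ Ioc (0 : ℝ) 1, HasDerivWithinAt γ (γL x) (Iio x) x := fun x hx =>
    (hd.2 x hx).mono_of_mem_nhdsWithin (Ico_mem_nhdsLT hx.1)
  have r1 : ∀ x ∈ Icc (0 : ℝ) 1, ∀ y ∈ Icc (0 : ℝ) 1, x < y → γR x ≤ slope γ x y :=
    fun x hx y hy hxy => hc.le_slope_of_hasDerivWithinAt_Ioi hx hy hxy
      (hR x ⟨hx.1, hxy.trans_le hy.2⟩)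
  have l1 : ∀ x ∈ Icc (0 : ℝ) 1, ∀ y ∈ Icc (0 : ℝ) 1, x < y → slope γ x y ≤ γL y :=
    fun x hx y hy hxy => hc.slope_le_of_hasDerivWithinAt_Iio hx hy hxy
      (hL y ⟨hx.1.trans_lt hxy, hy.2⟩)
  have r2 : ∀ z ∈ Icc (0 : ℝ) 1, ∀ x ∈ Ico (0 : ℝ) 1, z < x → slope γ z x ≤ γR x := by
    intro z hz x hx hzx
    refine ge_of_tendsto ((hasDerivWithinAt_iff_tendsto_slope' self_notMem_Ioi).mp (hR x hx)) ?_
    filter_upwards [Ioc_mem_nhdsGT hx.2] with y hy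
    have := hc.slope_mono_adjacent hz ⟨hx.1.trans hy.1.le, hy.2⟩ hzx hy.1
    rwa [slope_def_field, slope_def_field]
  have lr : ∀ x ∈ Ioo (0 : ℝ) 1, γL x ≤ γR x := by
    intro x hx
    refine le_of_tendsto ((hasDerivWithinAt_iff_tendsto_slope' self_notMem_Iio).mp
      (hL x ⟨hx.1, hx.2.le⟩)) ?_
    filter_upwards [Ico_mem_nhdsLT hx.1] with z hz
    rw [slope_comm]
    exact r2 z ⟨hz.1, (hz.2.trans hx.2).le⟩ x ⟨hx.1.le, hx.2⟩ hz.2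
  have l2 : ∀ x ∈ Ioc (0 : ℝ) 1, ∀ y ∈ Icc (0 : ℝ) 1, x < y → γL x ≤ slope γ x y :=
    fun x hx y hy hxy => (lr x ⟨hx.1, hxy.trans_le hy.2⟩).trans (r1 x ⟨hx.1.le, hx.2⟩ y hy hxy)
  have key : ∀ x y : ℝ, slope γ x y * (y - x) = γ y - γ x := fun x y => by
    rcases eq_or_ne x y with rfl | h
    · simp
    · rw [slope_def_field, div_mul_cancel₀ _ (sub_ne_zero.2 h.symm)]
  refine ⟨fun x hx y hy => ?_, fun x hx y hy => ?_, fun x y hx hxy hy => ?_, lr, h0, h1⟩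
  · rcases lt_trichotomy x y with h | rfl | h
    · rw [← key]
      exact mul_le_mul_of_nonneg_right (r1 x ⟨hx.1, hx.2.le⟩ y hy h) (sub_nonneg.2 h.le)
    · simp
    · rw [← key, slope_comm]
      exact mul_le_mul_of_nonpos_right (r2 y hy x hx h) (sub_nonpos.2 h.le)
  · rcases lt_trichotomy x y with h | rfl | h
    · rw [← key]
      exact mul_le_mul_of_nonneg_right (l2 x hx y hy h) (sub_nonneg.2 h.le)
    · simp
    · rw [← key, slope_comm]
      exact mul_le_mul_of_nonpos_right (l1 y hy x ⟨hx.1.le, hx.2⟩ h) (sub_nonpos.2 h.le)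
  · have hx' : x ∈ Icc (0 : ℝ) 1 := ⟨hx, hxy.le.trans hy⟩
    have hy' : y ∈ Icc (0 : ℝ) 1 := ⟨hx.trans hxy.le, hy⟩
    exact (r1 x hx' y hy' hxy).trans (l1 x hx' y hy' hxy)

namespace CvxCurve
variable {γ γR γL : ℝ → ℝ}

lemma R_mono (h : CvxCurve γ γR γL) {x y : ℝ} (hx : 0 ≤ x) (hxy : x ≤ y) (hy : y < 1) :
    γR x ≤ γR y := by
  rcases hxy.eq_or_lt with rfl | hlt
  · rfl
  · exact (h.R_le_L x y hx hlt hy.le).trans (h.L_le_R y ⟨hx.trans_lt hlt, hy⟩)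

lemma R_nonneg (h : CvxCurve γ γR γL) {x : ℝ} (hx : x ∈ Ico (0 : ℝ) 1) : 0 ≤ γR x :=
  h.R_zero.trans (h.R_mono le_rfl hx.1 hx.2)

lemma R_le_one (h : CvxCurve γ γR γL) {x : ℝ} (hx : x ∈ Ico (0 : ℝ) 1) : γR x ≤ 1 :=
  (h.R_le_L x 1 hx.1 hx.2 le_rfl).trans h.L_one

lemma L_mono (h : CvxCurve γ γR γL) {x y : ℝ} (hx : 0 < x) (hxy : x ≤ y) (hy : y ≤ 1) :
    γL x ≤ γL y := by
  rcases hxy.eq_or_lt with rfl | hlt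
  · rfl
  · exact (h.L_le_R x ⟨hx, hlt.trans_le hy⟩).trans (h.R_le_L x y hx.le hlt hy)

lemma L_le_one (h : CvxCurve γ γR γL) {x : ℝ} (hx : x ∈ Ioc (0 : ℝ) 1) : γL x ≤ 1 :=
  (h.L_mono hx.1 hx.2 le_rfl).trans h.L_one

/-- Every point of the neighbourhood over `[a,b]` lies in the box of the tangent at `a`. -/
lemma mem_box (h : CvxCurve γ γR γL) {a b r : ℝ} (ha : 0 ≤ a) (hab : a < b) (hb : b ≤ 1)
    (hJ : (b - a) * (γL b - γR a) ≤ 2 * r) {ξ : E2} (hξ : |ξ 1 - γ (ξ 0)| ≤ r)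
    (h1 : a ≤ ξ 0) (h2 : ξ 0 ≤ b) {A : ℝ} (hA : b - a ≤ A) :
    ξ ∈ box !₂[a, γ a] (γR a) A (3 * r) := by
  have hx : ξ 0 ∈ Icc (0 : ℝ) 1 := ⟨ha.trans h1, h2.trans hb⟩
  have e1 := h.right a ⟨ha, hab.trans_le hb⟩ (ξ 0) hx
  have e5 := h.R_le_L a b ha hab hb
  have e6 : γ (ξ 0) - γ a - γR a * (ξ 0 - a) ≤ 2 * r := by
    rcases h1.eq_or_lt with h3 | h3
    · rw [← h3]
      nlinarith [sub_nonneg.2 hab.le, sub_nonneg.2 e5]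
    · have e7 := h.left (ξ 0) ⟨ha.trans_lt h3, hx.2⟩ a ⟨ha, hab.le.trans hb⟩
      have e8 := h.L_mono (ha.trans_lt h3) h2 hb
      nlinarith [mul_le_mul_of_nonneg_right e8 (sub_nonneg.2 h3.le),
        mul_le_mul_of_nonneg_right (sub_le_sub_right h2 a) (sub_nonneg.2 e5)]
  rw [abs_le] at hξ
  refine ⟨?_, ?_⟩
  · show |ξ 0 - a| ≤ A
    rw [abs_of_nonneg (sub_nonneg.2 h1)]; linarith
  · show |ξ 1 - γ a - γR a * (ξ 0 - a)| ≤ 3 * r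
    rw [abs_le]
    constructor <;> linarith
end CvxCurve

end

section

lemma exists_greedy (N : ℕ) (P : ℕ → ℕ → Prop) (hP : ∀ n < N, P n (n + 1)) :
    ∃ T : Finset (ℕ × ℕ),
      (∀ p ∈ T, p.1 < p.2 ∧ p.2 ≤ N ∧ P p.1 p.2 ∧ (p.2 < N → ¬ P p.1 (p.2 + 1))) ∧
      (∀ p ∈ T, ∀ q ∈ T, p = q ∨ p.2 ≤ q.1 ∨ q.2 ≤ p.1) ∧
      ∀ n < N, ∃ p ∈ T, p.1 ≤ n ∧ n < p.2 := by
  classical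
  suffices H : ∀ d k, k + d = N → ∃ T : Finset (ℕ × ℕ),
      (∀ p ∈ T, p.1 < p.2 ∧ p.2 ≤ N ∧ P p.1 p.2 ∧ (p.2 < N → ¬ P p.1 (p.2 + 1))) ∧
      (∀ p ∈ T, k ≤ p.1) ∧
      (∀ p ∈ T, ∀ q ∈ T, p = q ∨ p.2 ≤ q.1 ∨ q.2 ≤ p.1) ∧
      ∀ n < N, k ≤ n → ∃ p ∈ T, p.1 ≤ n ∧ n < p.2 by
    obtain ⟨T, h1, -, h2, h3⟩ := H N 0 (zero_add N)
    exact ⟨T, h1, h2, fun n hn => h3 n hn (Nat.zero_le n)⟩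
  intro d
  induction d using Nat.strong_induction_on with
  | _ d ih =>
    intro k hk
    rcases Nat.eq_zero_or_pos d with rfl | hd
    · exact ⟨∅, by simp, by simp, by simp, fun n h1 h2 => by omega⟩
    have hkN : k < N := by omega
    set b := Nat.findGreatest (P k) N with hb
    have hb1 : k + 1 ≤ b := Nat.le_findGreatest (by omega) (hP k hkN)
    have hb2 : b ≤ N := Nat.findGreatest_le N
    have hb3 : P k b := Nat.findGreatest_spec (m := k + 1) (by omega) (hP k hkN)
    have hb4 : b < N → ¬ P k (b + 1) := fun h =>
      Nat.findGreatest_is_greatest (Nat.lt_succ_self b) (by omega)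
    obtain ⟨T, h1, h2, h3, h4⟩ := ih (N - b) (by omega) b (by omega)
    refine ⟨insert (k, b) T, ?_, ?_, ?_, ?_⟩
    · intro p hp
      rcases Finset.mem_insert.1 hp with rfl | hp
      · exact ⟨by simpa using hb1, hb2, hb3, hb4⟩
      · exact h1 p hp
    · intro p hp
      rcases Finset.mem_insert.1 hp with rfl | hp
      · exact le_rfl
      · have := h2 p hp
        omega
    · intro p hp q hq
      rcases Finset.mem_insert.1 hp with rfl | hp <;> rcases Finset.mem_insert.1 hq with rfl | hq
      · exact Or.inl rfl
      · exact Or.inr (Or.inl (h2 q hq))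
      · exact Or.inr (Or.inr (h2 p hp))
      · exact h3 p hp q hq
    · intro n hn hkn
      rcases lt_or_ge n b with h | h
      · exact ⟨(k, b), Finset.mem_insert_self _ _, hkn, h⟩
      · obtain ⟨p, hp, hp'⟩ := h4 n hn h
        exact ⟨p, Finset.mem_insert_of_mem hp, hp'⟩

/-- A tiling of `[0,1]` by grid intervals `[p.1 / N, p.2 / N]` which are maximal subject to
`(b - a) (γL b - γR a) ≤ 2 / R`. -/
structure Tiling (γR γL : ℝ → ℝ) (R : ℝ) (N : ℕ) (T : Finset (ℕ × ℕ)) : Prop where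
  pos : 0 < N
  le : (N : ℝ) ≤ R
  lt : ∀ p ∈ T, p.1 < p.2
  le_N : ∀ p ∈ T, p.2 ≤ N
  small : ∀ p ∈ T, ((p.2 : ℝ) / N - p.1 / N) * (γL (p.2 / N) - γR (p.1 / N)) ≤ 2 / R
  maximal : ∀ p ∈ T, p.2 < N →
    2 / R < (((p.2 + 1 : ℕ) : ℝ) / N - p.1 / N) * (γL ((p.2 + 1 : ℕ) / N) - γR (p.1 / N))
  disj : ∀ p ∈ T, ∀ q ∈ T, p = q ∨ p.2 ≤ q.1 ∨ q.2 ≤ p.1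
  cover : ∀ n < N, ∃ p ∈ T, p.1 ≤ n ∧ n < p.2

variable {γ γR γL : ℝ → ℝ}

lemma grid_mem_Ico {N n : ℕ} (h : n < N) : (n : ℝ) / N ∈ Ico (0 : ℝ) 1 := by
  have : (n : ℝ) < N := by exact_mod_cast h
  have h0 : (0 : ℝ) < N := (Nat.cast_nonneg n).trans_lt this
  exact ⟨by positivity, (div_lt_one h0).2 this⟩

lemma grid_mem_Ioc {N n : ℕ} (h0 : 0 < n) (h : n ≤ N) : (n : ℝ) / N ∈ Ioc (0 : ℝ) 1 := by
  have h1 : (0 : ℝ) < n := by exact_mod_cast h0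
  have h2 : (n : ℝ) ≤ N := by exact_mod_cast h
  exact ⟨div_pos h1 (h1.trans_le h2), div_le_one_of_le₀ h2 (h1.le.trans h2)⟩

lemma CvxCurve.exists_tiling (h : CvxCurve γ γR γL) {R : ℝ} (hR : 1 ≤ R) :
    ∃ N T, Tiling γR γL R N T := by
  have hN : 0 < ⌊R⌋₊ := Nat.floor_pos.2 hR
  have hNR : (⌊R⌋₊ : ℝ) ≤ R := Nat.floor_le (by linarith)
  have hN' : (1 : ℝ) ≤ ⌊R⌋₊ := by exact_mod_cast hN
  generalize hNe : ⌊R⌋₊ = N at *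
  have hRN : R < N + 1 := by rw [← hNe]; exact Nat.lt_floor_add_one R
  obtain ⟨T, h1, h2, h3⟩ := exists_greedy N (fun n n' =>
    ((n' : ℝ) / N - n / N) * (γL (n' / N) - γR (n / N)) ≤ 2 / R) fun n hn => by
      have e1 := h.L_le_one (grid_mem_Ioc (Nat.succ_pos n) hn)
      have e2 := h.R_nonneg (grid_mem_Ico hn)
      have e3 : ((n + 1 : ℕ) : ℝ) / N - n / N = 1 / N := by push_cast; ring
      rw [e3]
      calc _ ≤ 1 / (N : ℝ) * 1 := by gcongr; linarith
        _ ≤ 2 / R := by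
          rw [mul_one, div_le_div_iff₀ (by linarith) (by linarith)]; linarith
  exact ⟨N, T, hN, hNR, fun p hp => (h1 p hp).1, fun p hp => (h1 p hp).2.1,
    fun p hp => (h1 p hp).2.2.1, fun p hp hlt => not_le.1 ((h1 p hp).2.2.2 hlt), h2, h3⟩

/-- The scale of a tile relative to the base `K`. -/
def tileScale (K N : ℕ) (p : ℕ × ℕ) : ℕ := Nat.log K (N / (p.2 - p.1))

namespace Tiling
variable {R : ℝ} {N : ℕ} {T : Finset (ℕ × ℕ)}

lemma scale_spec (h : Tiling γR γL R N T) {K : ℕ} (hK : 2 ≤ K) {p : ℕ × ℕ} (hp : p ∈ T) :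
    ((p.2 : ℝ) - p.1) * K ^ tileScale K N p ≤ N ∧
      (N : ℝ) < (p.2 - p.1) * K ^ (tileScale K N p + 1) := by
  have h1 := h.lt p hp
  have h2 := h.le_N p hp
  have h3 : 0 < p.2 - p.1 := by omega
  have h4 : N / (p.2 - p.1) ≠ 0 := (Nat.div_pos (by omega) h3).ne'
  have e1 : K ^ tileScale K N p ≤ N / (p.2 - p.1) := Nat.pow_log_le_self K h4
  have e2 : N / (p.2 - p.1) < K ^ (tileScale K N p + 1) := Nat.lt_pow_succ_log_self hK _
  rw [Nat.le_div_iff_mul_le h3, mul_comm] at e1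
  rw [Nat.div_lt_iff_lt_mul h3, mul_comm] at e2
  rw [← Nat.cast_sub h1.le]
  exact ⟨by exact_mod_cast e1, by exact_mod_cast e2⟩

lemma scale_le (h : Tiling γR γL R N T) {K M : ℕ} (hK : 2 ≤ K) (hM : R ≤ (K : ℝ) ^ M)
    {p : ℕ × ℕ} (hp : p ∈ T) : tileScale K N p ≤ M := by
  have h1 : (p.1 : ℝ) + 1 ≤ p.2 := by exact_mod_cast h.lt p hp
  have h2 := (h.scale_spec hK hp).1
  have h3 : (K : ℝ) ^ tileScale K N p ≤ (K : ℝ) ^ M := by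
    have : (0 : ℝ) ≤ (K : ℝ) ^ tileScale K N p := by positivity
    nlinarith [h.le]
  have h4 : (1 : ℝ) < K := by exact_mod_cast hK
  exact (pow_le_pow_iff_right₀ h4).1 h3

set_option maxHeartbeats 1000000 in
/-- The tiles of a given scale form an admissible configuration. -/
lemma conf (h : Tiling γR γL R N T) (hγ : CvxCurve γ γR γL) (hR : 1 ≤ R) {K M m : ℕ}
    (hK : 2 ≤ K) (hM : R ≤ (K : ℝ) ^ M) (hm : m ≤ M) {ι : Type} (f : ι → ℕ × ℕ)
    (hf : Function.Injective f) (hfT : ∀ i, f i ∈ T) (hfm : ∀ i, tileScale K N (f i) = m) :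
    Conf (fun i => ((f i).1 : ℝ) / N) (fun i => γ ((f i).1 / N)) (fun i => γR ((f i).1 / N))
      K m M R⁻¹ := by
  have hN : (0 : ℝ) < N := by exact_mod_cast h.pos
  have hR0 : 0 < R := by linarith
  have hK0 : (0 : ℝ) < K := by have : 0 < K := by omega
                               exact_mod_cast this
  have hI : ∀ i, ((f i).1 : ℝ) / N ∈ Ico (0 : ℝ) 1 := fun i =>
    grid_mem_Ico ((h.lt _ (hfT i)).trans_le (h.le_N _ (hfT i)))
  have hI' : ∀ i, ((f i).1 : ℝ) / N ∈ Icc (0 : ℝ) 1 := fun i => Ico_subset_Icc_self (hI i)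
  have hlt : ∀ i j, ((f i).1 : ℝ) / N < (f j).1 / N → (f i).2 ≤ (f j).1 := fun i j hij => by
    have h1 : (f i).1 < (f j).1 := by
      have := (div_lt_div_iff_of_pos_right hN).1 hij
      exact_mod_cast this
    have h2 := h.lt _ (hfT j)
    rcases h.disj _ (hfT i) _ (hfT j) with e | e | e
    · rw [e] at h1; omega
    · exact e
    · omega
  have hsep : ∀ i j, (f i).2 ≤ (f j).1 →
      1 < ((f j).1 / N - (f i).1 / N : ℝ) * (K : ℝ) ^ (m + 1) := fun i j hij => by
    have h1 := (h.scale_spec hK (hfT i)).2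
    rw [hfm i] at h1
    have h2 : ((f i).2 : ℝ) ≤ (f j).1 := by exact_mod_cast hij
    rw [← sub_div, div_mul_eq_mul_div, one_lt_div hN]
    refine h1.trans_le ?_
    gcongr
  refine ⟨hK, hm, inv_pos.2 hR0, inv_le_one_of_one_le₀ hR, ?_, fun i => (hI i).1, fun i => (hI i).2,
    fun i => hγ.R_nonneg (hI i), fun i => hγ.R_le_one (hI i),
    fun i j _ => hγ.right _ (hI i) _ (hI' j), fun i j _ => ?_,
    fun i j hij => hγ.R_mono (hI i).1 hij (hI j).2, fun i j hij => ?_, fun i j k hij hjk => ?_⟩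
  · rw [inv_mul_eq_div, one_le_div hR0]; exact hM
  · have := hγ.right _ (hI j) _ (hI' i)
    linarith
  · rcases h.disj _ (hfT i) _ (hfT j) with e | e | e
    · exact absurd (hf e) hij
    · refine (hsep i j e).trans_le ?_
      rw [abs_sub_comm]
      gcongr
      exact le_abs_self _
    · refine (hsep j i e).trans_le ?_
      gcongr
      exact le_abs_self _
  · have hij' := hlt i j hij
    have hjk' := hlt j k hjk
    have hj := h.lt _ (hfT j)
    have hk := (h.lt _ (hfT k)).trans_le (h.le_N _ (hfT k))
    have hmax := h.maximal _ (hfT i) (by omega)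
    have h1 := hγ.L_mono (grid_mem_Ioc (N := N) (Nat.succ_pos (f i).2) (by omega)).1
      (y := ((f k).1 : ℝ) / N) (by gcongr; omega) (hI' k).2
    have h2 := hγ.L_le_R (((f k).1 : ℝ) / N)
      ⟨(grid_mem_Ioc (N := N) (n := (f k).1) (by omega) hk.le).1, (hI k).2⟩
    have h3 := (h.scale_spec hK (hfT i)).1
    rw [hfm i] at h3
    set X := γR ((f k).1 / N) - γR ((f i).1 / N) with hX
    have hlen : ((f i).1 : ℝ) + 1 ≤ (f i).2 := by exact_mod_cast h.lt _ (hfT i)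
    have hX0 : 0 ≤ X := sub_nonneg.2 (hγ.R_mono (hI i).1 (hij.trans hjk).le (hI k).2)
    have h4 : 2 / R < 2 * ((f i).2 - (f i).1) / N * X := by
      refine hmax.trans_le ?_
      have e1 : ((f i).2 + 1 : ℕ) / (N : ℝ) - (f i).1 / N ≤ 2 * ((f i).2 - (f i).1) / N := by
        rw [← sub_div]; push_cast; gcongr; linarith
      have e0 : (0 : ℝ) ≤ ((f i).2 + 1 : ℕ) / (N : ℝ) - (f i).1 / N := by
        rw [← sub_div]; push_cast; apply div_nonneg _ hN.le; linarith
      exact (mul_le_mul_of_nonneg_left (by linarith) e0).trans (mul_le_mul_of_nonneg_right e1 hX0)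
    rw [div_lt_iff₀ hR0] at h4
    rw [inv_mul_eq_div, div_le_iff₀ hR0]
    have h5 : 2 * ((f i).2 - (f i).1 : ℝ) / N * X * R * K ^ m =
        2 * (X * R) * (((f i).2 - (f i).1 : ℝ) * K ^ m / N) := by ring
    have h6 : ((f i).2 - (f i).1 : ℝ) * K ^ m / N ≤ 1 := div_le_one_of_le₀ h3 hN.le
    have h7 : 0 ≤ X * R := by positivity
    have h8 := mul_le_mul_of_nonneg_right h4.le (pow_pos hK0 m).le
    rw [h5] at h8
    nlinarith

end Tiling

end

section

variable {γ γR γL : ℝ → ℝ}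

lemma inner_E2 (w x : E2) : inner (𝕜 := ℝ) w x = w 0 * x 0 + w 1 * x 1 := by
  simp [PiLp.inner_apply, Fin.sum_univ_two, mul_comm]

lemma CvxCurve.exists_capNumber (h : CvxCurve γ γR γL) {R : ℝ} (hR : 1 ≤ R) :
    ∃ (w : Fin (capNumber γ R⁻¹) → E2) (c : Fin (capNumber γ R⁻¹) → ℝ),
      (∀ i, IsSupportingLine γ (w i) (c i)) ∧
      curveGraph γ ⊆ ⋃ i, cap γ (w i) (c i) R⁻¹ := by
  refine Nat.sInf_mem (s := {n : ℕ | ∃ (w : Fin n → E2) (c : Fin n → ℝ),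
    (∀ i, IsSupportingLine γ (w i) (c i)) ∧ curveGraph γ ⊆ ⋃ i, cap γ (w i) (c i) R⁻¹}) ?_
  have hR0 : 0 < R := by linarith
  obtain ⟨L, hL⟩ := exists_nat_gt R
  have hL0 : (0 : ℝ) < L := hR0.trans hL
  have hL1 : 0 < L := by exact_mod_cast hL0
  have hx : ∀ i : Fin L, ((i : ℕ) : ℝ) / L ∈ Ico (0 : ℝ) 1 := fun i => grid_mem_Ico i.2
  refine ⟨L, fun i => !₂[-γR (i / L), 1], fun i => γ (i / L) - γR (i / L) * (i / L),
    fun i => ⟨fun h0 => ?_, ?_, Or.inr fun ξ hξ => ?_⟩, fun ξ hξ => ?_⟩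
  · have := congrArg (fun v : E2 => v 1) h0
    simp at this
  · refine ⟨!₂[(i : ℝ) / L, γ (i / L)], subset_closure ⟨Ico_subset_Icc_self (hx i), rfl⟩, ?_⟩
    rw [inner_E2]
    simp
    ring
  · have := h.right _ (hx i) _ hξ.1
    rw [inner_E2, hξ.2]
    simp
    linarith
  · rw [mem_iUnion]
    obtain ⟨i, hi1, hi2⟩ : ∃ i : Fin L, (i : ℝ) / L ≤ ξ 0 ∧ ξ 0 ≤ (i + 1) / L := by
      rcases hξ.1.2.lt_or_eq with h1 | h1
      · have h2 := hξ.1.1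
        refine ⟨⟨⌊ξ 0 * L⌋₊, (Nat.floor_lt (by positivity)).2 (by nlinarith)⟩, ?_, ?_⟩
        · rw [div_le_iff₀ hL0]; exact Nat.floor_le (by positivity)
        · rw [le_div_iff₀ hL0]; exact (Nat.lt_floor_add_one _).le
      · refine ⟨⟨L - 1, by omega⟩, ?_, ?_⟩
        · rw [h1]; exact (grid_mem_Ico (by omega)).2.le
        · rw [h1, le_div_iff₀ hL0]; push_cast [Nat.cast_sub hL1]; linarith
    refine ⟨i, hξ, ?_⟩
    have e1 := h.right _ (hx i) _ hξ.1
    have e2 : γ (ξ 0) - γ (i / L) - γR (i / L) * (ξ 0 - i / L) ≤ ξ 0 - i / L := by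
      have e5 := mul_nonneg (h.R_nonneg (hx i)) (sub_nonneg.2 hi1)
      rcases hi1.eq_or_lt with h3 | h3
      · rw [← h3]; simp
      · have h4 : 0 < ξ 0 := (hx i).1.trans_lt h3
        have := h.left (ξ 0) ⟨h4, hξ.1.2⟩ _ (Ico_subset_Icc_self (hx i))
        have := mul_le_mul_of_nonneg_right (h.L_le_one ⟨h4, hξ.1.2⟩) (sub_nonneg.2 hi1)
        linarith
    have e3 : (1 : ℝ) ≤ ‖(!₂[-γR (i / L), 1] : E2)‖ := by
      have := PiLp.norm_apply_le (!₂[-γR (i / L), 1] : E2) 1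
      simpa using this
    have e4 : inner (𝕜 := ℝ) (!₂[-γR (i / L), 1] : E2) ξ - (γ (i / L) - γR (i / L) * (i / L)) =
        γ (ξ 0) - γ (i / L) - γR (i / L) * (ξ 0 - i / L) := by
      rw [inner_E2, hξ.2]
      simp
      ring
    rw [e4, abs_of_nonneg (by linarith)]
    calc _ ≤ γ (ξ 0) - γ (i / L) - γR (i / L) * (ξ 0 - i / L) := div_le_self (by linarith) e3
      _ ≤ ((i : ℕ) + 1) / L - i / L := e2.trans (by linarith)
      _ = (L : ℝ)⁻¹ := by ring
      _ < R⁻¹ := by gcongr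

/-- The number of tiles is controlled by the covering number by caps. -/
lemma Tiling.card_le {R : ℝ} {N : ℕ} {T : Finset (ℕ × ℕ)} (h : Tiling γR γL R N T)
    (hγ : CvxCurve γ γR γL) (hR : 1 ≤ R) {K M : ℕ} (hK : 2 ≤ K) (hM : R ≤ (K : ℝ) ^ M) :
    T.card ≤ 100 * K * (capNumber γ R⁻¹ * (M + 1)) := by
  classical
  obtain ⟨w, c, hw, hcov⟩ := hγ.exists_capNumber hR
  have hpt : ∀ p : T, ∃ i, (!₂[(p.1.1 : ℝ) / N, γ (p.1.1 / N)] : E2) ∈ cap γ (w i) (c i) R⁻¹ :=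
    fun p => mem_iUnion.1 (hcov ⟨Ico_subset_Icc_self
      (grid_mem_Ico ((h.lt _ p.2).trans_le (h.le_N _ p.2))), rfl⟩)
  choose i hi using hpt
  have key := Finset.card_le_mul_card_image_of_maps_to (s := Finset.univ (α := T))
    (f := fun p => (i p, tileScale K N p)) (t := Finset.univ ×ˢ Finset.range (M + 1))
    (fun p _ => by simp [h.scale_le hK hM p.2]) (100 * K) fun b _ => ?_
  · simpa using key
  set u := Finset.univ.filter fun p : T => (i p, tileScale K N p) = b with hu
  have hb : ∀ p : u, i p = b.1 ∧ tileScale K N p = b.2 := fun p => by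
    have := (Finset.mem_filter.1 p.2).2
    exact ⟨congrArg Prod.fst this, congrArg Prod.snd this⟩
  rcases u.eq_empty_or_nonempty with h0 | ⟨p₀, hp₀⟩
  · rw [h0]; simp
  have hconf := h.conf hγ hR hK hM (m := b.2)
    ((hb ⟨p₀, hp₀⟩).2 ▸ h.scale_le hK hM p₀.2) (fun p : u => (p : T).1)
    (Subtype.val_injective.comp Subtype.val_injective) (fun p => p.1.2) fun p => (hb p).2
  have hw0 := norm_pos_iff.2 (hw b.1).1
  have hle := norm_le_abs_add_abs (w b.1)
  have := hconf.card_le_of_strip (w₀ := w b.1 0) (w₁ := w b.1 1) (c := c b.1) (by linarith)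
    fun p => by
      have h1 := (hi p).2
      rw [(hb p).1, div_lt_iff₀ hw0, inner_E2] at h1
      exact h1.le.trans (mul_le_mul_of_nonneg_left hle (by positivity))
  rwa [Fintype.card_coe] at this

end

section

variable {γ γR γL : ℝ → ℝ}

lemma isBounded_box (P : E2) (s A B : ℝ) : Bornology.IsBounded (box P s A B) := by
  refine (Metric.isBounded_closedBall (x := P) (r := A + (B + |s| * A))).subset ?_
  rintro ξ ⟨h1, h2⟩
  rw [Metric.mem_closedBall, dist_eq_norm]
  refine (norm_le_abs_add_abs _).trans ?_
  simp only [PiLp.sub_apply]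
  have h3 : |ξ 1 - P 1| ≤ |ξ 1 - P 1 - s * (ξ 0 - P 0)| + |s * (ξ 0 - P 0)| := by
    simpa using abs_add_le (ξ 1 - P 1 - s * (ξ 0 - P 0)) (s * (ξ 0 - P 0))
  rw [abs_mul] at h3
  have := mul_le_mul_of_nonneg_left h1 (abs_nonneg s)
  linarith

lemma volume_vertical_line (c : ℝ) : volume {ξ : E2 | ξ 0 = c} = 0 := by
  have h := (PiLp.volume_preserving_ofLp (Fin 2)).measure_preimage
    (s := {v : Fin 2 → ℝ | v 0 = c})
    (measurableSet_eq_fun (measurable_pi_apply 0) measurable_const).nullMeasurableSet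
  have e : {ξ : E2 | ξ 0 = c} = WithLp.ofLp ⁻¹' {v : Fin 2 → ℝ | v 0 = c} := rfl
  rw [e, h, volume_pi]
  exact Measure.pi_hyperplane (fun _ : Fin 2 => (volume : Measure ℝ)) 0 c

lemma measurableSet_strip (a b : ℝ) : MeasurableSet {ξ : E2 | ξ 0 ∈ Icc a b} := by
  have : Measurable fun ξ : E2 => ξ 0 := by fun_prop
  exact this measurableSet_Icc

lemma BL.fourierProj {γ γR γL : ℝ → ℝ} (h : CvxCurve γ γR γL) (f : SchwartzMap E2 ℂ) {r : ℝ}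
    (hf : Function.support (𝓕 ⇑f) ⊆ vnbhd γ r) {a b : ℝ} (ha : 0 ≤ a) (hab : a < b)
    (hb : b ≤ 1) (hJ : (b - a) * (γL b - γR a) ≤ 2 * r) {A : ℝ} (hA : b - a ≤ A) :
    BL (box !₂[a, γ a] (γR a) A (3 * r)) (fourierProj f (Icc a b)) := by
  have hc : Continuous (𝓕 ⇑f) := continuous_fourier' f.integrable
  have hs : Function.support (Set.indicator {ξ : E2 | ξ 0 ∈ Icc a b} (𝓕 ⇑f)) ⊆
      box !₂[a, γ a] (γR a) A (3 * r) := by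
    intro ξ hξ
    rw [Function.mem_support, Set.indicator_apply_ne_zero] at hξ
    exact h.mem_box ha hab hb hJ (hf hξ.2).2 hξ.1.1 hξ.1.2 hA
  refine ⟨_, hc.aestronglyMeasurable.indicator (measurableSet_strip a b),
    ⟨∫ x, ‖f x‖, fun ξ => ?_⟩, (isBounded_box _ _ _ _).subset hs, hs, rfl⟩
  exact (norm_indicator_le_norm_self _ _).trans (norm_fourier_le _ _)

/-- The function is the sum of its projections to the tiles. -/
lemma Tiling.sum_fourierProj {R : ℝ} {N : ℕ} {T : Finset (ℕ × ℕ)} (h : Tiling γR γL R N T)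
    (f : SchwartzMap E2 ℂ) {r : ℝ} (hf : Function.support (𝓕 ⇑f) ⊆ vnbhd γ r) (x : E2) :
    f x = ∑ p ∈ T, fourierProj f (Icc ((p.1 : ℝ) / N) (p.2 / N)) x := by
  have hi : Integrable (𝓕 ⇑f) := by
    rw [← SchwartzMap.fourier_coe]; exact (𝓕 f).integrable
  have hinv : (𝓕⁻ (𝓕 ⇑f) : E2 → ℂ) = f := f.continuous.fourierInv_fourier_eq f.integrable hi
  have hN : (0 : ℝ) < N := by exact_mod_cast h.pos
  have hs := BL.fourierInv_sum T
    (G := fun p => Set.indicator {ξ : E2 | ξ 0 ∈ Icc ((p.1 : ℝ) / N) (p.2 / N)} (𝓕 ⇑f))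
    fun p _ => hi.indicator (measurableSet_strip _ _)
  have hae : 𝓕 ⇑f =ᵐ[volume] fun ξ => ∑ p ∈ T,
      Set.indicator {ξ : E2 | ξ 0 ∈ Icc ((p.1 : ℝ) / N) (p.2 / N)} (𝓕 ⇑f) ξ := by
    have hnull : ∀ᵐ ξ : E2, ∀ n : ℕ, ξ 0 ≠ (n : ℝ) / N :=
      ae_all_iff.2 fun n => compl_mem_ae_iff.2 (volume_vertical_line _)
    filter_upwards [hnull] with ξ hξ
    by_cases h0 : 𝓕 (⇑f) ξ = 0
    · refine (h0.trans (Finset.sum_eq_zero fun p _ => ?_).symm)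
      rw [Set.indicator_apply, h0, ite_self]
    have hI := (hf h0).1
    have h1 : ξ 0 < 1 := lt_of_le_of_ne hI.2 fun e => hξ N (by rw [e, div_self hN.ne'])
    obtain ⟨p, hp, hp1, hp2⟩ := h.cover ⌊ξ 0 * N⌋₊
      ((Nat.floor_lt (mul_nonneg hI.1 hN.le)).2 (by nlinarith))
    have hm : ∀ q : ℕ × ℕ, ξ ∈ {ξ : E2 | ξ 0 ∈ Icc ((q.1 : ℝ) / N) (q.2 / N)} ↔
        (q.1 : ℝ) / N ≤ ξ 0 ∧ ξ 0 ≤ q.2 / N := fun q => Iff.rfl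
    have hpξ : ξ ∈ {ξ : E2 | ξ 0 ∈ Icc ((p.1 : ℝ) / N) (p.2 / N)} := by
      rw [hm, div_le_iff₀ hN, le_div_iff₀ hN]
      have e1 := Nat.floor_le (mul_nonneg hI.1 hN.le)
      have e2 := Nat.lt_floor_add_one (ξ 0 * N)
      have e3 : (p.1 : ℝ) ≤ ⌊ξ 0 * N⌋₊ := by exact_mod_cast hp1
      have e4 : (⌊ξ 0 * N⌋₊ : ℝ) + 1 ≤ p.2 := by exact_mod_cast hp2
      constructor <;> linarith
    rw [Finset.sum_eq_single_of_mem p hp fun q hq hqp => ?_, Set.indicator_of_mem hpξ]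
    refine Set.indicator_of_notMem (fun hqξ => ?_) _
    rw [hm] at hpξ hqξ
    rcases h.disj q hq p hp with e | e | e
    · exact hqp e
    · have : (q.2 : ℝ) / N ≤ p.1 / N := by gcongr
      exact hξ _ (le_antisymm hqξ.2 (this.trans hpξ.1))
    · have : (p.2 : ℝ) / N ≤ q.1 / N := by gcongr
      exact hξ _ (le_antisymm hpξ.2 (this.trans hqξ.1))
  have hcongr : (𝓕⁻ (𝓕 ⇑f) : E2 → ℂ) = 𝓕⁻ (fun ξ => ∑ p ∈ T,
      Set.indicator {ξ : E2 | ξ 0 ∈ Icc ((p.1 : ℝ) / N) (p.2 / N)} (𝓕 ⇑f) ξ : E2 → ℂ) := by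
    funext x
    rw [Real.fourierInv_eq, Real.fourierInv_eq]
    refine integral_congr_ae ?_
    filter_upwards [hae] with ξ hξ
    rw [hξ]
  rw [← congrFun hinv x, hcongr, hs]
  rfl

lemma eLpNorm_six_eq (g : E2 → ℂ) :
    eLpNorm g 6 volume = (∫⁻ x, ‖g x‖ₑ ^ 6) ^ (1 / 6 : ℝ) := by
  rw [eLpNorm_eq_lintegral_rpow_enorm_toReal (by norm_num) (by norm_num)]
  have : (6 : ℝ≥0∞).toReal = (6 : ℕ) := by norm_num
  simp only [this, ENNReal.rpow_natCast]
  norm_num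

lemma eLpNorm_six_sq (g : E2 → ℂ) :
    eLpNorm g 6 volume ^ 2 = (∫⁻ x, ‖g x‖ₑ ^ 6) ^ (1 / 3 : ℝ) := by
  rw [eLpNorm_six_eq, ← ENNReal.rpow_natCast, ← ENNReal.rpow_mul]
  norm_num

/-- Decoupling for the tiles of one scale. -/
lemma exists_decoupling_scale (M : ℕ) : ∃ C : ℝ≥0, ∀ {γ γR γL : ℝ → ℝ} {R : ℝ} {N : ℕ}
    {T : Finset (ℕ × ℕ)}, Tiling γR γL R N T → CvxCurve γ γR γL → 1 ≤ R →
    ∀ {K m : ℕ}, 2 ≤ K → R ≤ (K : ℝ) ^ M → m ≤ M →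
    ∀ f : SchwartzMap E2 ℂ, Function.support (𝓕 ⇑f) ⊆ vnbhd γ R⁻¹ →
    eLpNorm (fun x => ∑ p ∈ T with tileScale K N p = m,
      fourierProj f (Icc ((p.1 : ℝ) / N) (p.2 / N)) x) 6 volume ≤
      (C * K ^ 21 : ℝ≥0∞) ^ (1 / 6 : ℝ) *
        (∑ p ∈ T, eLpNorm (fourierProj f (Icc ((p.1 : ℝ) / N) (p.2 / N))) 6 volume ^ 2)
          ^ (1 / 2 : ℝ) := by
  obtain ⟨C, hC⟩ := exists_decoupling_conf M
  refine ⟨C, fun {γ γR γL R N T} h hγ hR {K m} hK hM hm f hf => ?_⟩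
  have hN : (0 : ℝ) < N := by exact_mod_cast h.pos
  set u := T.filter fun p => tileScale K N p = m with hu
  have huT : ∀ p ∈ u, p ∈ T := fun p hp => (Finset.mem_filter.1 hp).1
  have hum : ∀ p ∈ u, tileScale K N p = m := fun p hp => (Finset.mem_filter.1 hp).2
  have hcf := h.conf hγ hR hK hM hm (fun p : u => (p : ℕ × ℕ)) Subtype.val_injective
    (fun p => huT p p.2) fun p => hum p p.2
  have hK0 : (0 : ℝ) < K := by have : 0 < K := by omega
                               exact_mod_cast this
  have key := hC hcf (fun p => fourierProj f (Icc ((p.1.1 : ℝ) / N) (p.1.2 / N))) fun p => by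
    have hp := huT p p.2
    have h1 := h.lt _ hp
    have h2 := (h.scale_spec hK hp).1
    rw [hum p p.2] at h2
    refine BL.fourierProj hγ f hf (grid_mem_Ico (h1.trans_le (h.le_N _ hp))).1 (by gcongr)
      (grid_mem_Ioc (by omega) (h.le_N _ hp)).2 ?_ ?_
    · rw [← div_eq_mul_inv]; exact h.small _ hp
    · rw [← sub_div, scl, pow_zero, mul_one_div, div_le_div_iff₀ hN (by positivity)]
      linarith
  have e1 : ∀ x, ∑ p ∈ u, fourierProj f (Icc ((p.1 : ℝ) / N) (p.2 / N)) x =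
      ∑ p : u, fourierProj f (Icc ((p.1.1 : ℝ) / N) (p.1.2 / N)) x := fun x =>
    (Finset.sum_coe_sort u fun p => fourierProj f (Icc ((p.1 : ℝ) / N) (p.2 / N)) x).symm
  simp only [← eLpNorm_six_sq] at key
  rw [eLpNorm_six_eq]
  simp only [e1]
  refine (ENNReal.rpow_le_rpow key (by norm_num)).trans ?_
  rw [ENNReal.mul_rpow_of_nonneg _ _ (by norm_num), ← ENNReal.rpow_natCast _ 3,
    ← ENNReal.rpow_mul]
  norm_num
  refine mul_le_mul_right (ENNReal.rpow_le_rpow ?_ (by norm_num)) _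
  rw [Finset.sum_attach u fun p =>
    eLpNorm (fourierProj f (Icc ((p.1 : ℝ) / N) (p.2 / N))) 6 volume ^ 2]
  exact Finset.sum_le_sum_of_subset (Finset.filter_subset _ _)

end

section

variable {γ γR γL : ℝ → ℝ}

lemma exists_base {M : ℕ} (hM : 1 ≤ M) {R : ℝ} (hR : 1 ≤ R) :
    ∃ K : ℕ, 2 ≤ K ∧ R ≤ (K : ℝ) ^ M ∧ (K : ℝ) ≤ 3 * R ^ (1 / M : ℝ) := by
  have h1 : 1 ≤ R ^ (1 / M : ℝ) := Real.one_le_rpow hR (by positivity)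
  have h2 : 1 ≤ ⌈R ^ (1 / M : ℝ)⌉₊ := Nat.one_le_ceil_iff.2 (by linarith)
  have h3 : R ^ (1 / M : ℝ) ≤ ⌈R ^ (1 / M : ℝ)⌉₊ := Nat.le_ceil _
  have h4 : (⌈R ^ (1 / M : ℝ)⌉₊ : ℝ) < R ^ (1 / M : ℝ) + 1 := Nat.ceil_lt_add_one (by linarith)
  refine ⟨⌈R ^ (1 / M : ℝ)⌉₊ + 1, by omega, ?_, by push_cast; linarith⟩
  calc R = (R ^ (1 / M : ℝ)) ^ M := by
        rw [one_div, Real.rpow_inv_natCast_pow (by linarith) (by omega)]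
    _ ≤ _ := by gcongr; push_cast; linarith

lemma Tiling.eLpNorm_le {R : ℝ} {N : ℕ} {T : Finset (ℕ × ℕ)} (h : Tiling γR γL R N T)
    {K M : ℕ} (hK : 2 ≤ K) (hM : R ≤ (K : ℝ) ^ M)
    (hγ : CvxCurve γ γR γL) (f : SchwartzMap E2 ℂ)
    (hf : Function.support (𝓕 ⇑f) ⊆ vnbhd γ R⁻¹) {D : ℝ≥0∞}
    (hD : ∀ m ≤ M, eLpNorm (fun x => ∑ p ∈ T with tileScale K N p = m,
      fourierProj f (Icc ((p.1 : ℝ) / N) (p.2 / N)) x) 6 volume ≤ D) :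
    eLpNorm f 6 volume ≤ (M + 1) * D := by
  have hN : (0 : ℝ) < N := by exact_mod_cast h.pos
  have hcont : ∀ p ∈ T, Continuous (fourierProj f (Icc ((p.1 : ℝ) / N) (p.2 / N))) := fun p hp => by
    have h1 := h.lt _ hp
    refine (BL.fourierProj hγ f hf (grid_mem_Ico (h1.trans_le (h.le_N _ hp))).1 (by gcongr)
      (grid_mem_Ioc (by omega) (h.le_N _ hp)).2 ?_ le_rfl).continuous
    rw [← div_eq_mul_inv]; exact h.small _ hp
  have e : (f : E2 → ℂ) = ∑ m ∈ Finset.range (M + 1), fun x => ∑ p ∈ T with tileScale K N p = m,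
      fourierProj f (Icc ((p.1 : ℝ) / N) (p.2 / N)) x := by
    funext x
    rw [h.sum_fourierProj f hf x, Finset.sum_apply]
    exact (Finset.sum_fiberwise_of_maps_to
      (fun p hp => Finset.mem_range.2 (Nat.lt_succ_of_le (h.scale_le hK hM hp))) _).symm
  rw [e]
  refine (eLpNorm_sum_le (fun m _ => (continuous_finsetSum _ fun p hp =>
    hcont p (Finset.mem_filter.1 hp).1).aestronglyMeasurable) (by norm_num)).trans ?_
  refine (Finset.sum_le_card_nsmul _ _ D fun m hm =>
    hD m (Nat.lt_succ_iff.1 (Finset.mem_range.1 hm))).trans ?_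
  simp

/-- The decoupling inequality for a tiling, with the dependence on `R` made explicit. -/
lemma exists_decoupling_tiling {M : ℕ} (hM : 1 ≤ M) : ∃ C : ℝ, 1 ≤ C ∧
    ∀ {γ γR γL : ℝ → ℝ} {R : ℝ} {N : ℕ} {T : Finset (ℕ × ℕ)}, Tiling γR γL R N T →
    CvxCurve γ γR γL → 1 ≤ R → ∀ f : SchwartzMap E2 ℂ,
    Function.support (𝓕 ⇑f) ⊆ vnbhd γ R⁻¹ →
    eLpNorm f 6 volume ≤ ENNReal.ofReal (C * R ^ (4 / M : ℝ)) *
      (∑ p ∈ T, eLpNorm (fourierProj f (Icc ((p.1 : ℝ) / N) (p.2 / N))) 6 volume ^ 2)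
        ^ (1 / 2 : ℝ) := by
  obtain ⟨C, hC⟩ := exists_decoupling_scale M
  refine ⟨1 + (M + 1) * (C * 3 ^ 21 : ℝ) ^ (1 / 6 : ℝ), le_add_of_nonneg_right (by positivity),
    fun {γ γR γL R N T} h hγ hR f hf => ?_⟩
  obtain ⟨K, hK, hKM, hK3⟩ := exists_base hM hR
  have hM0 : (0 : ℝ) < M := by exact_mod_cast hM
  have hR0 : 0 < R := by linarith
  refine (h.eLpNorm_le hK hKM hγ f hf fun m hm => hC h hγ hR hK hKM hm f hf).trans ?_
  rw [← mul_assoc]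
  refine mul_le_mul_left ?_ _
  have hreal : (C * K ^ 21 : ℝ) ^ (1 / 6 : ℝ) ≤
      (C * 3 ^ 21 : ℝ) ^ (1 / 6 : ℝ) * R ^ (4 / M : ℝ) := by
    calc _ ≤ (C * (3 * R ^ (1 / M : ℝ)) ^ 21 : ℝ) ^ (1 / 6 : ℝ) := by gcongr
      _ = (C * 3 ^ 21 : ℝ) ^ (1 / 6 : ℝ) * R ^ (21 / (6 * M) : ℝ) := by
        rw [mul_pow, ← mul_assoc, Real.mul_rpow (by positivity) (by positivity),
          ← Real.rpow_natCast (R ^ (1 / M : ℝ)), ← Real.rpow_mul hR0.le, ← Real.rpow_mul hR0.le]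
        congr 2
        field_simp
        norm_num
      _ ≤ _ := by
        gcongr _ * R ^ ?_
        rw [div_le_div_iff₀ (by positivity) hM0]; nlinarith
  have hcast : (C * K ^ 21 : ℝ≥0∞) ^ (1 / 6 : ℝ) =
      ENNReal.ofReal ((C * K ^ 21 : ℝ) ^ (1 / 6 : ℝ)) := by
    rw [← ENNReal.ofReal_rpow_of_nonneg (by positivity) (by norm_num),
      ENNReal.ofReal_mul (by positivity), ENNReal.ofReal_pow (by positivity),
      ENNReal.ofReal_natCast, ENNReal.ofReal_coe_nnreal]
  have hcast' : (M + 1 : ℝ≥0∞) = ENNReal.ofReal (M + 1) := by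
    rw [ENNReal.ofReal_add (by positivity) zero_le_one, ENNReal.ofReal_natCast, ENNReal.ofReal_one]
  rw [hcast, hcast', ← ENNReal.ofReal_mul (by positivity)]
  refine ENNReal.ofReal_le_ofReal ?_
  calc _ ≤ (M + 1 : ℝ) * ((C * 3 ^ 21 : ℝ) ^ (1 / 6 : ℝ) * R ^ (4 / M : ℝ)) := by gcongr
    _ ≤ _ := by
      have : 0 ≤ R ^ (4 / M : ℝ) := by positivity
      nlinarith

end

end

theorem statement_0 (ε : ℝ) (hε : 0 < ε) :
    ∃ cε Cε : ℝ, 1 ≤ cε ∧ 1 ≤ Cε ∧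
      ∀ R : ℝ, 1 ≤ R → ∀ γ γR γL : ℝ → ℝ,
        ConvexOn ℝ (Icc (0:ℝ) 1) γ →
        HasOneSidedDerivs γ γR γL 0 1 →
        0 ≤ γR 0 → γR 0 ≤ γL 1 → γL 1 ≤ 1 →
        ∃ 𝒥 : Finset (ℝ × ℝ),
          (∀ p ∈ 𝒥, 0 ≤ p.1 ∧ p.1 ≤ p.2 ∧ p.2 ≤ 1) ∧
          (Icc (0:ℝ) 1 ⊆ ⋃ p ∈ 𝒥, Icc p.1 p.2) ∧
          (∀ p ∈ 𝒥, (p.2 - p.1) * (γL p.2 - γR p.1) ≤ 2 / R) ∧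
          ((𝒥.card : ℝ) ≤ cε * R ^ ε * (capNumber γ R⁻¹ : ℝ)) ∧
          (∀ p ∈ 𝒥, R⁻¹ ≤ p.2 - p.1) ∧
          ∀ f : SchwartzMap E2 ℂ,
            Function.support (𝓕 ⇑f) ⊆ vnbhd γ R⁻¹ →
            eLpNorm (⇑f) 6 volume ≤
              ENNReal.ofReal (Cε * R ^ ε) *
                (∑ p ∈ 𝒥, eLpNorm (fourierProj (⇑f) (Icc p.1 p.2)) 6 volume ^ 2)
                  ^ ((1 : ℝ) / 2) := by
  set M := ⌈4 / ε⌉₊ + 1 with hMdef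
  have hM0 : (0 : ℝ) < M := by positivity
  have hMε : 4 / (M : ℝ) ≤ ε := by
    have : 4 / ε ≤ (M : ℝ) := (Nat.le_ceil _).trans (by rw [hMdef]; push_cast; linarith)
    rwa [div_le_iff₀ hε, mul_comm, ← div_le_iff₀ hM0] at this
  have hM1 : 1 ≤ M := Nat.le_add_left _ _
  clear_value M
  obtain ⟨C, hC1, hC⟩ := exists_decoupling_tiling hM1
  refine ⟨300 * (M + 1), C, by nlinarith, hC1, fun R hR γ γR γL hconv hd h0 _ h1 => ?_⟩
  have hγ := hconv.cvxCurve hd h0 h1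
  have hR0 : 0 < R := by linarith
  obtain ⟨N, T, h⟩ := hγ.exists_tiling hR
  have hN : (0 : ℝ) < N := by exact_mod_cast h.pos
  have hinj : Function.Injective fun p : ℕ × ℕ => ((p.1 : ℝ) / N, (p.2 : ℝ) / N) := by
    intro p q hpq
    simp only [Prod.mk.injEq, div_left_inj' hN.ne', Nat.cast_inj] at hpq
    exact Prod.ext hpq.1 hpq.2
  refine ⟨T.map ⟨_, hinj⟩, ?_, fun x hx => ?_, ?_, ?_, ?_, fun f hf => ?_⟩
  · simp only [Finset.forall_mem_map, Function.Embedding.coeFn_mk]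
    intro p hp
    have h2 := h.lt _ hp
    exact ⟨by positivity, by gcongr, (grid_mem_Ioc (by omega) (h.le_N _ hp)).2⟩
  · obtain ⟨n, hn, hn1, hn2⟩ : ∃ n : ℕ, n < N ∧ (n : ℝ) ≤ x * N ∧ x * N ≤ n + 1 := by
      rcases hx.2.lt_or_eq with hx1 | rfl
      · have : 0 ≤ x * N := mul_nonneg hx.1 hN.le
        exact ⟨⌊x * N⌋₊, (Nat.floor_lt this).2 (by nlinarith), Nat.floor_le this,
          (Nat.lt_floor_add_one _).le⟩
      · have := h.pos
        refine ⟨N - 1, by omega, ?_, ?_⟩ <;> rw [Nat.cast_sub this] <;> push_cast <;> linarith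
    obtain ⟨p, hp, hp1, hp2⟩ := h.cover n hn
    refine mem_biUnion (Finset.mem_map_of_mem _ hp) ?_
    have e1 : (p.1 : ℝ) ≤ n := by exact_mod_cast hp1
    have e2 : (n : ℝ) + 1 ≤ p.2 := by exact_mod_cast hp2
    exact ⟨(div_le_iff₀ hN).2 (e1.trans hn1), (le_div_iff₀ hN).2 (hn2.trans e2)⟩
  · simpa only [Finset.forall_mem_map, Function.Embedding.coeFn_mk] using h.small
  · obtain ⟨K, hK, hKM, hK3⟩ := exists_base hM1 hR
    rw [Finset.card_map]
    have hcard : (T.card : ℝ) ≤ 100 * K * (capNumber γ R⁻¹ * (M + 1)) := by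
      exact_mod_cast h.card_le hγ hR hK hKM
    have hK4 : (K : ℝ) ≤ 3 * R ^ ε := hK3.trans (by
      gcongr 3 * R ^ ?_
      exact le_trans (by gcongr; norm_num) hMε)
    calc _ ≤ 100 * (K : ℝ) * (capNumber γ R⁻¹ * (M + 1)) := hcard
      _ ≤ 100 * (3 * R ^ ε) * (capNumber γ R⁻¹ * (M + 1)) := by gcongr
      _ = _ := by ring
  · simp only [Finset.forall_mem_map, Function.Embedding.coeFn_mk]
    intro p hp
    have h2 : (p.1 : ℝ) + 1 ≤ p.2 := by exact_mod_cast h.lt _ hp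
    rw [← sub_div, le_div_iff₀ hN, inv_mul_eq_div]
    exact (div_le_one_of_le₀ h.le hR0.le).trans (by linarith)
  · rw [Finset.sum_map]
    refine (hC h hγ hR f hf).trans (mul_le_mul_left (ENNReal.ofReal_le_ofReal ?_) _)
    gcongr

end
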